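/- Let (R, m) be an analytically unramified Cohen-Macaulay local ring of dimension d ≥ 3 with infinite residue field, I an m-primary ideal, J a minimal reduction. If ē₁(I) = e₀(I) − λ(R/closure(I)) + 1 and ē₃(I) = 0, then the associated graded ring Ḡ of the normal filtration is Cohen-Macaulay and closure(I^{n+1}) = J^{n−1}·closure(I²) for all n ≥ 1 (reduction number at most 2). -/

import Mathlib

set_option synthInstance.maxHeartbeats 1000000
set_option maxHeartbeats 2000000

open IsLocalRing Polynomial Finset

variable {R : Type*}

/-- `x` is integral over the ideal `I`: it satisfies an equation
`x^n + a₁ x^{n-1} + ⋯ + aₙ = 0` with `aᵢ ∈ Iⁱ`. -/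
def IsIntegralOverIdeal [CommRing R] (I : Ideal R) (x : R) : Prop :=
  ∃ n : ℕ, 0 < n ∧ ∃ a : ℕ → R, (∀ i ∈ Finset.Icc 1 n, a i ∈ I ^ i) ∧
    x ^ n + ∑ i ∈ Finset.Icc 1 n, a i * x ^ (n - i) = 0

/-- The integral closure of an ideal (the set of integral elements is an ideal,
so the span equals it). -/
def intCl [CommRing R] (I : Ideal R) : Ideal R :=
  Ideal.span {x | IsIntegralOverIdeal I x}

/-- Length of a module, as the Krull dimension of its lattice of submodules. -/
noncomputable def mlen (R M : Type*) [CommRing R] [AddCommGroup M] [Module R M] :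
    WithBot ℕ∞ :=
  Order.krullDim (Submodule R M)

/-- The quotient module `N/(K ∩ N)` for ideals `N K`. -/
abbrev idealQuot [CommRing R] (N K : Ideal R) :=
  N ⧸ (Submodule.comap N.subtype K)

/-- Depth of `M` with respect to the ideal `J`: sup of lengths of `M`-regular
sequences contained in `J`. -/
noncomputable def rdepth (A : Type*) [CommRing A] (J : Ideal A)
    (M : Type*) [AddCommGroup M] [Module A M] : ℕ∞ :=
  sSup {n : ℕ∞ | ∃ rs : List A, (rs.length : ℕ∞) = n ∧ (∀ x ∈ rs, x ∈ J) ∧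
    RingTheory.Sequence.IsRegular M rs}

/-- A local ring is Cohen-Macaulay if its depth equals its Krull dimension. -/
def IsCMLocal (R : Type*) [CommRing R] [IsLocalRing R] : Prop :=
  (rdepth R (maximalIdeal R) R : WithBot ℕ∞) = ringKrullDim R

/-- A local ring is analytically unramified if its `m`-adic completion is reduced. -/
def AnalyticallyUnramified (R : Type*) [CommRing R] [IsLocalRing R] : Prop :=
  IsReduced (AdicCompletion (maximalIdeal R) R)

/-- An ideal is `m`-primary. -/
def IsMPrimary [CommRing R] [IsLocalRing R] (I : Ideal R) : Prop :=
  I.radical = maximalIdeal R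

/-- `J ⊆ I` is a minimal reduction: generated by `d = dim R` elements and
`I^{n+1} = J I^n` for `n ≫ 0`. -/
def IsMinimalReduction [CommRing R] (d : ℕ) (J I : Ideal R) : Prop :=
  J ≤ I ∧ (∃ s : Fin d → R, J = Ideal.span (Set.range s)) ∧
    ∃ N : ℕ, ∀ n ≥ N, I ^ (n + 1) = J * I ^ n

/-- Normal Hilbert data: `L n = λ(R/ intCl(I^{n+1}))` and for `n ≫ 0` this agrees
with the polynomial whose normalized coefficients are the `e i`. -/
def NormalHilbertData [CommRing R] (d : ℕ) (I : Ideal R) (L : ℕ → ℕ) (e : ℕ → ℤ) : Prop :=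
  (∀ n, mlen R (R ⧸ intCl (I ^ (n + 1))) = (L n : WithBot ℕ∞)) ∧
    ∃ N : ℕ, ∀ n ≥ N, (L n : ℤ) =
      ∑ i ∈ Finset.range (d + 1), (-1 : ℤ) ^ i * e i * ((n + d - i).choose (d - i))

/-- `t` is the Cohen-Macaulay type of the local ring `R` of dimension `d`:
`t = λ((Q : m)/Q)` for every ideal `Q` generated by a maximal regular sequence in `m`. -/
def CMTypeData (R : Type*) [CommRing R] [IsLocalRing R] (d t : ℕ) : Prop :=
  ∀ s : List R, s.length = d → (∀ x ∈ s, x ∈ maximalIdeal R) →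
    RingTheory.Sequence.IsRegular R s →
      mlen R (idealQuot ((Ideal.span {x | x ∈ s}).colon (maximalIdeal R))
        (Ideal.span {x | x ∈ s})) = (t : WithBot ℕ∞)

/-- The quotient module `N/(K ∩ N)` for submodules `N K` of a module. -/
abbrev submoduleQuot {A M : Type*} [CommRing A] [AddCommGroup M] [Module A M]
    (N K : Submodule A M) :=
  N ⧸ (Submodule.comap N.subtype K)

namespace NHC

theorem exists_k1 (k : Type*) [Field k] (p n : ℕ) [ExpChar k p] (t : Set k) (ht : t.Finite) :
    ∃ (k1 : Subfield k) (fr : k →+* k1), (∀ c, (fr c : k) = c ^ p ^ n) ∧ fr.Finite ∧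
      ∀ c ∈ t, c ∈ k1 := by
  let k0 := (iterateFrobenius k p n).fieldRange
  let E := IntermediateField.adjoin k0 t
  have hfin : Finite t := ht
  have hE : FiniteDimensional k0 E := by
    apply IntermediateField.finiteDimensional_adjoin
    intro x _
    refine IsIntegral.of_pow (n := p ^ n) (expChar_pow_pos k p n) ?_
    have : x ^ p ^ n = algebraMap k0 k ⟨x ^ p ^ n, x, rfl⟩ := rfl
    rw [this]
    exact isIntegral_algebraMap
  let r := (iterateFrobenius k p n).rangeRestrictField
  let fr : k →+* E := (algebraMap k0 E).comp r
  refine ⟨E.toSubfield, fr, fun c => rfl, ?_, fun c hc => IntermediateField.subset_adjoin _ _ hc⟩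
  refine RingHom.Finite.comp (f := r) (g := algebraMap k0 E) ?_ ?_
  · exact RingHom.finite_algebraMap.mpr hE
  · exact RingHom.Finite.of_surjective _ (fun ⟨_, x, hx⟩ => ⟨x, Subtype.ext hx⟩)

theorem phi_finite {k k1 : Type*} [Field k] [Field k1] (σ : Type*) [Finite σ] (i : k1 →+* k)
    (fr : k →+* k1) (hfr : fr.Finite) (p n : ℕ) [ExpChar k p] 
    (h : ∀ c, i (fr c) = c ^ p ^ n) :
    (((MvPolynomial.expand (p ^ n)).toRingHom.comp (MvPolynomial.map fr)) :
      MvPolynomial σ k →+* MvPolynomial σ k1).Finite := by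
  classical
  have : ExpChar k1 p := expChar_of_injective_ringHom fr.injective p
  set Φ := (((MvPolynomial.expand (p ^ n)).toRingHom.comp (MvPolynomial.map fr)) :
      MvPolynomial σ k →+* MvPolynomial σ k1) with hΦ
  have hfi : ∀ c, fr (i c) = c ^ p ^ n := fun c => i.injective (by rw [h, map_pow])
  apply RingHom.IsIntegral.to_finite
  · intro f
    algebraize [Φ]
    change IsIntegral _ _
    refine IsIntegral.of_pow (n := p ^ n) (expChar_pow_pos k p n) ?_
    have : f ^ p ^ n = algebraMap _ _ (MvPolynomial.map i f) := by
      change _ = MvPolynomial.expand (p ^ n) (MvPolynomial.map fr (MvPolynomial.map i f))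
      rw [MvPolynomial.map_map, ← MvPolynomial.map_iterateFrobenius_expand, MvPolynomial.map_expand]
      have : iterateFrobenius k1 p n = fr.comp i := by
        ext c
        simp [iterateFrobenius_def, hfi]
      rw [this]
    rw [this]
    exact isIntegral_algebraMap
  · algebraize [Φ]
    algebraize [fr]
    change Algebra.FiniteType _ _
    have hf : Module.Finite k k1 := hfr
    obtain ⟨s, hs⟩ := hf
    refine ⟨⟨(s.image MvPolynomial.C) ∪ (Set.finite_range (MvPolynomial.X (R := k1) (σ := σ))).toFinset, ?_⟩⟩
    rw [eq_top_iff]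
    rintro f -
    induction f using MvPolynomial.induction_on with
    | C a =>
      have ha : a ∈ Submodule.span k (s : Set k1) := hs ▸ trivial
      induction ha using Submodule.span_induction with
      | mem x hx => exact Algebra.subset_adjoin (by simp; left; exact hx)
      | zero => simp
      | add x y _ _ hx hy => rw [map_add]; exact add_mem hx hy
      | smul c x _ hx =>
        have : (MvPolynomial.C (c • x) : MvPolynomial σ k1) = algebraMap (MvPolynomial σ k) _ (MvPolynomial.C c) * MvPolynomial.C x := by
          rw [Algebra.smul_def, map_mul]
          congr 1
          change _ = MvPolynomial.expand (p ^ n) (MvPolynomial.map fr (MvPolynomial.C c))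
          simp
          rfl
        rw [this]
        exact mul_mem (Subalgebra.algebraMap_mem _ _) hx
    | add f g hf hg => exact add_mem hf hg
    | mul_X f j hf => exact mul_mem hf (Algebra.subset_adjoin (by simp))

theorem retract {k : Type*} [Field k] (k1 : Subfield k) (σ : Type*) (f g : MvPolynomial σ k1)
    (hf : f ≠ 0) (b : MvPolynomial σ k)
    (h : MvPolynomial.map k1.subtype f * b = MvPolynomial.map k1.subtype g) :
    ∃ b', MvPolynomial.map k1.subtype b' = b := by
  classical
  obtain ⟨ρ, hρ⟩ := LinearMap.exists_leftInverse_of_injective (Algebra.linearMap k1 k)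
    (LinearMap.ker_eq_bot.mpr (algebraMap k1 k).injective)
  have hρ1 : ∀ c : k1, ρ c = c := fun c => LinearMap.congr_fun hρ c
  let ρb : MvPolynomial σ k1 := ∑ m ∈ b.support, MvPolynomial.monomial m (ρ (b.coeff m))
  have hc : ∀ m, ρb.coeff m = ρ (b.coeff m) := by
    intro m
    simp only [ρb, MvPolynomial.coeff_sum, MvPolynomial.coeff_monomial]
    simp
    intro h
    rw [h, map_zero]
  have h1 : f * ρb = g := by
    ext m
    have := congrArg (fun q => ρ (MvPolynomial.coeff m q)) h
    simp only [MvPolynomial.coeff_mul, MvPolynomial.coeff_map, map_sum] at this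
    rw [MvPolynomial.coeff_mul]
    have h2 : ρ (k1.subtype (MvPolynomial.coeff m g)) = MvPolynomial.coeff m g := hρ1 _
    rw [h2] at this
    rw [← this]
    congr 1
    refine Finset.sum_congr rfl fun x _ => ?_
    rw [hc, ← smul_eq_mul, ← map_smul]
    rfl
  refine ⟨ρb, ?_⟩
  have h3 : MvPolynomial.map k1.subtype f ≠ 0 := by
    rwa [Ne, map_eq_zero_iff _ (MvPolynomial.map_injective _ k1.subtype.injective)]
  apply mul_left_cancel₀ h3
  rw [h, ← map_mul, h1]


theorem sum_smul_aux {S E ι κ : Type*} [CommRing S] [AddCommGroup E] [Module S E] [Fintype ι]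
    [Fintype κ] (m : ι → S) (c : ι → κ → S) (y : κ → E) :
    (∑ i, (m i • ∑ j, c i j • y j : E)) = ∑ j, (∑ i, m i * c i j) • y j := by
  simp_rw [Finset.smul_sum, Finset.sum_smul, mul_smul]
  rw [Finset.sum_comm]

theorem N2 {k : Type*} [Field k] (σ : Type*) [Finite σ] (K L : Type*) [Field K] [Field L]
    [Algebra (MvPolynomial σ k) K] [IsFractionRing (MvPolynomial σ k) K] [Algebra K L]
    [Algebra (MvPolynomial σ k) L] [IsScalarTower (MvPolynomial σ k) K L]
    [FiniteDimensional K L] :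
    IsNoetherian (MvPolynomial σ k) (integralClosure (MvPolynomial σ k) L) := by
  classical
  set S := MvPolynomial σ k
  let E := separableClosure K L
  obtain ⟨p, hp⟩ := ExpChar.exists k
  have hpS : ExpChar S p := expChar_of_injective_ringHom (MvPolynomial.C_injective σ k) p
  have hpK : ExpChar K p := expChar_of_injective_ringHom (IsFractionRing.injective S K) p
  have hpL : ExpChar L p := expChar_of_injective_ringHom (algebraMap K L).injective p
  have hpE : ExpChar E p := expChar_of_injective_ringHom (algebraMap K E).injective p
  have hE : IsPurelyInseparable E L := separableClosure.isPurelyInseparable K L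
  let n := IsPurelyInseparable.exponent E L
  have hq : ∀ x : L, ∃ z : E, (z : L) = x ^ p ^ n := fun x =>
    IsPurelyInseparable.exponent_def' E p x
  obtain ⟨s, b, hb⟩ := FiniteDimensional.exists_is_basis_integral S K E
  have hspan := integralClosure_le_span_dualBasis (A := S) b hb
  set y := (Algebra.traceForm K E).dualBasis (traceForm_nondegenerate K E) b
  have inj : ∀ β γ : s → S, ∑ j, β j • y j = ∑ j, γ j • y j → β = γ := by
    intro β γ h
    have h' : ∑ j, (algebraMap S K (β j)) • y j = ∑ j, (algebraMap S K (γ j)) • y j := by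
      simpa [algebraMap_smul] using h
    funext j
    apply IsFractionRing.injective S K
    have := congrArg (fun z => y.repr z j) h'
    simp only [Module.Basis.repr_sum_self] at this
    exact this
  have key : ∀ x : L, IsIntegral S x → ∃ β : s → S, x ^ p ^ n = ((∑ j, β j • y j : E) : L) := by
    intro x hx
    obtain ⟨z, hz⟩ := hq x
    have hzi : IsIntegral S z := by
      have : IsIntegral S (algebraMap E L z) := by
        change IsIntegral S (z : L)
        rw [hz]; exact hx.pow _
      have : IsScalarTower S E L := IsScalarTower.of_algebraMap_eq fun a => rfl
      exact (isIntegral_algebraMap_iff (algebraMap E L).injective).mp ‹_›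
    have := hspan (x := z) hzi
    obtain ⟨β, hβ⟩ := (Submodule.mem_span_range_iff_exists_fun S).mp this
    exact ⟨β, by rw [hβ, hz]⟩
  obtain ⟨s', x, hx⟩ := FiniteDimensional.exists_is_basis_integral S K L
  choose c hc using fun i => key (x i) (hx i)
  obtain ⟨k1, fr, hfr, hfin, ht⟩ := exists_k1 k p n (⋃ i, ⋃ j, ((c i j).coeffs : Set k))
    (Set.finite_iUnion fun i => Set.finite_iUnion fun j => Finset.finite_toSet _)
  let Φ : S →+* MvPolynomial σ k1 :=
    ((MvPolynomial.expand (p ^ n)).toRingHom.comp (MvPolynomial.map fr))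
  have hΦfin : Φ.Finite := phi_finite σ k1.subtype fr hfin p n hfr
  let ι := MvPolynomial.map (σ := σ) k1.subtype
  have hι : Function.Injective ι := MvPolynomial.map_injective _ k1.subtype.injective
  have hιΦ : ∀ f : S, ι (Φ f) = f ^ p ^ n := by
    intro f
    change MvPolynomial.map _ (MvPolynomial.expand _ (MvPolynomial.map fr f)) = _
    rw [MvPolynomial.map_expand, MvPolynomial.map_map, ← MvPolynomial.map_iterateFrobenius_expand,
      MvPolynomial.map_expand]
    have : iterateFrobenius k p n = k1.subtype.comp fr := by
      ext a
      simp [iterateFrobenius_def, hfr]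
    rw [this]
  have hcι : ∀ i j, ∃ g, ι g = c i j := by
    intro i j
    have : (c i j) ∈ Set.range (MvPolynomial.map (σ := σ) k1.subtype) := by
      rw [MvPolynomial.mem_range_map_iff_coeffs_subset]
      intro a ha
      have := ht a (Set.mem_iUnion.mpr ⟨i, Set.mem_iUnion.mpr ⟨j, ha⟩⟩)
      exact ⟨⟨a, this⟩, rfl⟩
    exact this
  choose c' hc' using hcι
  have key2 : ∀ z : L, IsIntegral S z → ∃ β : s → MvPolynomial σ k1,
      z ^ p ^ n = ((∑ j, ι (β j) • y j : E) : L) := by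
    intro z hz
    obtain ⟨β, hβ⟩ := key z hz
    obtain ⟨den, hden⟩ := IsLocalization.exist_integer_multiples (nonZeroDivisors S) Finset.univ
      (fun i => x.repr z i)
    choose m hm using fun i => hden i (Finset.mem_univ i)
    have hzz : (den : S) • z = ∑ i, m i • x i := by
      conv_lhs => rw [← x.sum_repr z, Finset.smul_sum]
      refine Finset.sum_congr rfl fun i _ => ?_
      rw [← algebraMap_smul K (m i) (x i), hm i, smul_assoc]
    have h2 : ∑ j, ((den : S) ^ p ^ n * β j) • y j = ∑ j, (∑ i, m i ^ p ^ n * c i j) • y j := by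
      apply Subtype.coe_injective
      have := congrArg (· ^ p ^ n) hzz
      simp only [sum_pow_char_pow, _root_.smul_pow] at this
      rw [hβ] at this
      simp only [hc] at this
      have e1 : ((∑ j, ((den : S) ^ p ^ n * β j) • y j : E) : L) =
          (den : S) ^ p ^ n • ((∑ j, β j • y j : E) : L) := by
        simp only [mul_smul, ← Finset.smul_sum]
        rfl
      refine e1.trans (this.trans ?_)
      have e2 : ∀ i, m i ^ p ^ n • ((∑ j, c i j • y j : E) : L) =
          ((m i ^ p ^ n • ∑ j, c i j • y j : E) : L) := fun i => rfl
      simp only [e2]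
      have e3 : (∑ i, (m i ^ p ^ n • ∑ j, c i j • y j : E)) =
          ∑ j, (∑ i, m i ^ p ^ n * c i j) • y j := by
        exact sum_smul_aux _ _ _
      rw [← e3]
      exact (AddSubmonoidClass.coe_finsetSum _ _).symm
    have h3 := inj _ _ h2
    have h4 : ∀ j, ∃ b', ι b' = β j := by
      intro j
      have h5 := congrFun h3 j
      apply retract k1 σ (Φ den) (∑ i, Φ (m i) * c' i j)
      · intro h0
        have := hιΦ den
        rw [h0, map_zero] at this
        exact nonZeroDivisors.coe_ne_zero den (pow_eq_zero_iff (expChar_pow_pos k p n).ne' |>.mp this.symm)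
      · change ι _ * _ = ι _
        rw [hιΦ, map_sum]
        simp only [map_mul, hιΦ, hc']
        exact h5
    choose β' hβ' using h4
    exact ⟨β', by rw [hβ]; simp only [hβ']⟩
  choose θ hθ using fun z : integralClosure S L => key2 z z.2
  have inj2 : ∀ β γ : s → MvPolynomial σ k1,
      ((∑ j, ι (β j) • y j : E) : L) = ((∑ j, ι (γ j) • y j : E) : L) → β = γ := by
    intro β γ h
    have := inj _ _ (Subtype.coe_injective h)
    funext j
    exact hι (congrFun this j)
  let _ : Module S (MvPolynomial σ k1) := Module.compHom _ Φ
  have hmod : ∀ (a : S) (f : MvPolynomial σ k1), a • f = Φ a * f := fun _ _ => rfl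
  have hfin' : Module.Finite S (MvPolynomial σ k1) := hΦfin
  have : IsNoetherian S (MvPolynomial σ k1) := isNoetherian_of_isNoetherianRing_of_finite _ _
  let Θ : integralClosure S L →ₗ[S] (s → MvPolynomial σ k1) :=
    { toFun := θ
      map_add' := by
        intro u v
        apply inj2
        rw [← hθ]
        simp only [Pi.add_apply, map_add, add_smul, Finset.sum_add_distrib]
        push_cast
        rw [add_pow_expChar_pow, hθ, hθ]
        push_cast
        rfl
      map_smul' := by
        intro a u
        apply inj2
        rw [← hθ]
        simp only [Pi.smul_apply, RingHom.id_apply, hmod, map_mul, hιΦ, mul_smul, ← Finset.smul_sum]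
        have : ((a • u : integralClosure S L) : L) = a • (u : L) := rfl
        rw [this, _root_.smul_pow, hθ]
        rfl }
  refine isNoetherian_of_injective Θ ?_
  rw [injective_iff_map_eq_zero]
  intro u hu
  have h1 := hθ u
  have h2 : θ u = 0 := hu
  rw [h2] at h1
  simp at h1
  have := h1
  exact this.1

theorem N2dom {k : Type*} [Field k] (σ : Type*) [Finite σ] (D : Type*) [CommRing D] [IsDomain D]
    [Algebra (MvPolynomial σ k) D] (hinj : Function.Injective (algebraMap (MvPolynomial σ k) D))
    [Algebra.IsIntegral (MvPolynomial σ k) D] (e : ℕ)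
    (he : ∀ s : Finset D, LinearIndependent (MvPolynomial σ k) (fun i : s => (i : D)) →
      s.card ≤ e) :
    IsNoetherian (MvPolynomial σ k) D := by
  set S := MvPolynomial σ k
  have : FaithfulSMul S D := (faithfulSMul_iff_algebraMap_injective S D).mpr hinj
  let K := FractionRing S
  let L := FractionRing D
  have hSL : Function.Injective (algebraMap S L) := by
    rw [IsScalarTower.algebraMap_eq S D L]
    exact (IsFractionRing.injective D L).comp hinj
  have : FaithfulSMul S L := (faithfulSMul_iff_algebraMap_injective S L).mpr hSL
  let _ : Algebra K L := FractionRing.liftAlgebra S L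
  have : IsScalarTower S K L := FractionRing.isScalarTower_liftAlgebra S L
  have hr : Module.rank S D ≤ e := rank_le he
  have : FiniteDimensional K L := by
    have h1 : Module.rank K L = Module.rank S D := Algebra.IsAlgebraic.rank_fractionRing S D
    apply Module.rank_lt_aleph0_iff.mp
    rw [h1]
    exact hr.trans_lt Cardinal.natCast_lt_aleph0
  have := N2 (k := k) σ K L
  let f : D →ₗ[S] integralClosure S L :=
    ((IsScalarTower.toAlgHom S D L).codRestrict (integralClosure S L) (fun x =>
      (Algebra.IsIntegral.isIntegral (R := S) x).map (IsScalarTower.toAlgHom S D L))).toLinearMap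
  refine isNoetherian_of_injective f ?_
  intro x y h
  exact IsFractionRing.injective D L (congrArg Subtype.val h)

end NHC

namespace NHC

theorem isIntegral_of_pow_eq {A B : Type*} [CommRing A] [CommRing B] [Algebra A B] (b : B) (n : ℕ)
    (c : ℕ → A) (h : b ^ n = ∑ i ∈ range n, algebraMap A B (c i) * b ^ i) : IsIntegral A b := by
  refine ⟨X ^ n - ∑ i ∈ range n, C (c i) * X ^ i, ?_, ?_⟩
  · nontriviality A
    rw [sub_eq_add_neg]
    apply monic_X_pow_add
    rw [degree_neg]
    refine lt_of_le_of_lt (degree_sum_le _ _) ?_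
    refine (Finset.sup_lt_iff (WithBot.bot_lt_coe n)).mpr fun i hi => ?_
    exact (degree_C_mul_X_pow_le i (c i)).trans_lt (Nat.cast_lt.mpr (Finset.mem_range.mp hi))
  · rw [← aeval_def]
    simp [h]

variable {S B : Type*} [CommRing S] [CommRing B] [Algebra S B] (A : Subalgebra S B) (x : B)
  (K : Ideal A) (hK : ∀ p : A, p ∈ K ↔ x * p ∈ A) (W : Submonoid S)

include hK in
theorem notMem_c (h1 : ∀ b : B, IsIntegral A b → b ∈ A) (h2 : ∀ w ∈ W, ∀ b : B, w • b ∈ A → b ∈ A)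
    (h3 : ∀ y : ℕ → A, ∃ k, ∃ g ∈ W, ∃ r : ℕ → S, g • y k - ∑ i ∈ range k, r i • y i ∈ K)
    (α : A) (hα : α ∈ K) (w0 : S) (hw0W : w0 ∈ W) (hw0 : x * α = algebraMap S B w0)
    (𝔭 : Ideal A) (hK𝔭 : K ≤ 𝔭) (y0 : A) (hy0 : y0 ∉ K) (hy : ∀ p ∈ 𝔭, y0 * p ∈ K) :
    ∃ p0 ∈ 𝔭, ∃ c : A, (c : B) = x * (y0 * p0) ∧ c ∉ 𝔭 := by
  by_contra hcon
  push Not at hcon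
  set z : B := x * y0 with hz
  have hstep : ∀ p ∈ 𝔭, ∃ p' ∈ 𝔭, (p' : B) = p * z := by
    intro p hp
    have h := (hK _).mp (hy p hp)
    refine ⟨⟨_, h⟩, hcon p hp ⟨_, h⟩ (by simp), ?_⟩
    simp [hz]; ring
  have hpow : ∀ k : ℕ, ∃ p' ∈ 𝔭, (p' : B) = α * z ^ (k + 1) := by
    intro k
    induction k with
    | zero => simpa using hstep α (hK𝔭 hα)
    | succ k ih =>
      obtain ⟨p, hp, e⟩ := ih
      obtain ⟨p', hp', e'⟩ := hstep p hp
      exact ⟨p', hp', by rw [e', e]; ring⟩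
  choose y hy𝔭 hyv using hpow
  obtain ⟨k, g, hg, r, hr⟩ := h3 y
  have h4 := (hK _).mp hr
  have h5 : g • z ^ (k + 1) - ∑ i ∈ range k, r i • z ^ (i + 1) ∈ A := by
    apply h2 w0 hw0W
    convert h4 using 1
    push_cast
    simp only [hyv, mul_sub, Finset.mul_sum, Algebra.smul_def, ← hw0]
    congr 1
    · ring
    · refine Finset.sum_congr rfl fun i _ => ?_
      ring
  obtain ⟨a, ha⟩ : ∃ a : A, (a : B) = g • z ^ (k + 1) - ∑ i ∈ range k, r i • z ^ (i + 1) := ⟨⟨_, h5⟩, rfl⟩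
  have hInt : IsIntegral A (g • z) := by
    refine isIntegral_of_pow_eq (g • z) (k + 1)
      (fun i => if i = 0 then algebraMap S A (g ^ k) * a else algebraMap S A (r (i - 1) * g ^ (k - i))) ?_
    rw [Finset.sum_range_succ']
    have e1 : ∀ i ∈ range k, algebraMap A B (if i + 1 = 0 then algebraMap S A (g ^ k) * a else
        algebraMap S A (r (i + 1 - 1) * g ^ (k - (i + 1)))) * (g • z) ^ (i + 1) =
        algebraMap S B (g ^ k) * (r i • z ^ (i + 1)) := by
      intro i hi
      have hik : k = (k - (i + 1)) + (i + 1) := by have := Finset.mem_range.mp hi; omega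
      simp only [Nat.add_eq_zero_iff, one_ne_zero, and_false, if_false, Nat.add_sub_cancel,
        Algebra.smul_def, mul_pow]
      have : algebraMap S B (g ^ k) = algebraMap S B (g ^ (k - (i + 1))) * algebraMap S B (g ^ (i + 1)) := by
        rw [← map_mul, ← pow_add, ← hik]
      rw [this, ← IsScalarTower.algebraMap_apply S A B]
      simp only [map_mul, map_pow]
      ring
    rw [Finset.sum_congr rfl e1, ← Finset.mul_sum]
    simp only [if_true, map_mul, pow_zero, mul_one]
    have : algebraMap A B a = a := rfl
    rw [this, ha, ← IsScalarTower.algebraMap_apply S A B]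
    simp only [Algebra.smul_def, mul_pow, map_pow]
    ring
  exact hy0 ((hK _).mpr (h2 g hg _ (h1 _ hInt)))

include hK in
theorem absNoethQ {Q : Type*} [CommRing Q] (π : A →+* Q)
    (hπ0 : ∀ p : A, π p = 0 ↔ p ∈ K) (hπu : ∀ w ∈ W, IsUnit (π (algebraMap S A w)))
    (hπs : ∀ q : Q, ∃ p : A, ∃ w ∈ W, π (algebraMap S A w) * q = π p) (h1 : ∀ b : B, IsIntegral A b → b ∈ A)
    (h2 : ∀ w ∈ W, ∀ b : B, w • b ∈ A → b ∈ A) (e : ℕ)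
    (h3 : ∀ y : ℕ → A, ∃ k ≤ e, ∃ g ∈ W, ∃ r : ℕ → S, g • y k - ∑ i ∈ range k, r i • y i ∈ K)
    (α : A) (hα : α ∈ K) (w0 : S) (hw0W : w0 ∈ W) (hw0 : x * α = algebraMap S B w0)
    (h5 : ∀ 𝔭 : Ideal A, 𝔭.IsPrime → K ≤ 𝔭 → (∀ w ∈ W, algebraMap S A w ∉ 𝔭) →
      IsNoetherian S (A ⧸ 𝔭)) :
    IsNoetherian S (A ⧸ K) := by
  have hπsm : ∀ (s : S) (p : A), π (s • p) = π (algebraMap S A s) * π p := by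
    intro s p
    rw [Algebra.smul_def, map_mul]
  have hArt : IsArtinianRing Q := by
    change IsArtinian Q Q
    rw [isArtinian_iff, RelEmbedding.wellFounded_iff_isEmpty]
    refine ⟨fun f => ?_⟩
    have hlt : ∀ i, f (i + 1) < f i := fun i => f.map_rel_iff.mpr (Nat.lt_succ_self i)
    have hanti : ∀ i j, i ≤ j → f j ≤ f i := fun i j hij => antitone_nat_of_succ_le (fun i => (hlt i).le) hij
    have hex : ∀ i, ∃ p : A, π p ∈ f i ∧ π p ∉ f (i + 1) := by
      intro i
      obtain ⟨q, hq, hq'⟩ := SetLike.exists_of_lt (hlt i)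
      obtain ⟨p, w, hw, hp⟩ := hπs q
      refine ⟨p, hp ▸ Ideal.mul_mem_left _ _ hq, fun h => hq' ?_⟩
      rw [← hp] at h
      exact (Ideal.unit_mul_mem_iff_mem _ (hπu w hw)).mp h
    choose y hy hy' using hex
    obtain ⟨k, hk, g, hg, r, hr⟩ := h3 (fun i => y (e - i))
    have h6 := (hπ0 _).mpr hr
    rw [map_sub, sub_eq_zero, map_sum] at h6
    apply hy' (e - k)
    apply (Ideal.unit_mul_mem_iff_mem _ (hπu g hg)).mp
    rw [← hπsm, h6]
    refine Ideal.sum_mem _ fun i hi => ?_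
    rw [hπsm]
    apply Ideal.mul_mem_left
    have := Finset.mem_range.mp hi
    exact hanti (e - k + 1) (e - i) (by omega) (hy (e - i))
  have hQN : IsNoetherianRing Q := inferInstance
  -- per-prime facts
  have hprime : ∀ P : Ideal Q, P.IsPrime → ∃ y0 p0 c h : A, ∃ g ∈ W, p0 ∈ P.comap π ∧
      (∀ p ∈ P.comap π, y0 * p ∈ K) ∧ (c : B) = x * (y0 * p0) ∧
      algebraMap S A g - c * h ∈ P.comap π := by
    intro P hP
    have hmax : P.IsMaximal := inferInstance
    have hPm : P ∈ (Module.annihilator Q Q).minimalPrimes := by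
      refine ⟨⟨hP, ?_⟩, fun P' hP' hle => ?_⟩
      · rw [Module.annihilator_eq_bot.mpr inferInstance]; exact bot_le
      · have := hP'.1
        have hm : P'.IsMaximal := inferInstance
        exact (hm.eq_of_le hP.ne_top hle).ge
    have hass : IsAssociatedPrime P Q :=
      Module.associatedPrimes.minimalPrimes_annihilator_subset_associatedPrimes Q Q hPm
    rw [isAssociatedPrime_iff] at hass
    obtain ⟨-, q, hq⟩ := hass
    have hq' : ∀ t, t ∈ P ↔ t * q = 0 := by
      intro t
      rw [hq, Submodule.mem_colon_singleton]
      rfl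
    obtain ⟨y0, w, hw, hy0⟩ := hπs q
    have hyP : ∀ p ∈ P.comap π, y0 * p ∈ K := by
      intro p hp
      rw [← hπ0, map_mul, ← hy0]
      have := (hq' _).mp hp
      linear_combination π (algebraMap S A w) * this
    have hy0K : y0 ∉ K := by
      intro h
      rw [← hπ0, ← hy0] at h
      have : π (algebraMap S A w) ∈ P := (hq' _).mpr h
      exact hP.ne_top (P.eq_top_of_isUnit_mem this (hπu w hw))
    obtain ⟨p0, hp0, c, hc, hcP⟩ := notMem_c A x K hK W h1 h2
      (fun y => by obtain ⟨k, -, h⟩ := h3 y; exact ⟨k, h⟩) α hα w0 hw0W hw0 (P.comap π)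
      (fun p hp => by rw [Ideal.mem_comap, (hπ0 p).mpr hp]; exact P.zero_mem) y0 hy0K hyP
    have : ∃ q' , 1 - π c * q' ∈ P := by
      obtain ⟨a, i, hi, hai⟩ := hmax.exists_inv hcP
      refine ⟨a, ?_⟩
      have : 1 - π c * a = i := by linear_combination -hai
      rwa [this]
    obtain ⟨q', hq'⟩ := this
    obtain ⟨h, g, hg, hh⟩ := hπs q'
    refine ⟨y0, p0, c, h, g, hg, hp0, hyP, hc, ?_⟩
    rw [Ideal.mem_comap, map_sub, map_mul, ← hh]
    have : π (algebraMap S A g) - π c * (π (algebraMap S A g) * q') =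
      π (algebraMap S A g) * (1 - π c * q') := by ring
    rw [this]
    exact P.mul_mem_left _ hq'
  have hstep : ∀ (P 𝔟 : Ideal Q), P.IsPrime → IsNoetherian S (A ⧸ 𝔟.comap π) →
      IsNoetherian S (A ⧸ (P * 𝔟).comap π) := by
    intro P 𝔟 hP hN
    obtain ⟨y0, p0, c, h, g, hg, hp0, hyP, hc, hgc⟩ := hprime P hP
    have hNP : IsNoetherian S (A ⧸ P.comap π) := by
      apply h5 _ inferInstance
      · intro p hp; rw [Ideal.mem_comap, (hπ0 p).mpr hp]; exact P.zero_mem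
      · intro w hw hmem
        exact hP.ne_top (P.eq_top_of_isUnit_mem hmem (hπu w hw))
    let 𝔭 : Submodule S A := (P.comap π).restrictScalars S
    let ξ : 𝔭 →ₗ[S] A :=
      { toFun := fun p => ⟨x * (y0 * p.1 : A), (hK _).mp (hyP p.1 p.2)⟩
        map_add' := by intro a b; apply Subtype.ext; simp [mul_add]
        map_smul' := by intro a b; apply Subtype.ext; simp [mul_smul_comm] }
    let f : 𝔭 →ₗ[S] (A ⧸ 𝔟.comap π) × (A ⧸ 𝔟.comap π) :=
      LinearMap.prod ((Ideal.Quotient.mkₐ S (𝔟.comap π)).toLinearMap ∘ₗ ξ)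
        ((Ideal.Quotient.mkₐ S (𝔟.comap π)).toLinearMap ∘ₗ 𝔭.subtype)
    let G : 𝔭 →ₗ[S] (A ⧸ (P * 𝔟).comap π) :=
      (Ideal.Quotient.mkₐ S ((P * 𝔟).comap π)).toLinearMap ∘ₗ 𝔭.subtype
    have hle : LinearMap.ker f ≤ LinearMap.ker G := by
      intro p hp
      have hp' : f p = 0 := hp
      have hp1 : ξ p ∈ 𝔟.comap π := Ideal.Quotient.eq_zero_iff_mem.mp (congrArg Prod.fst hp')
      have hp2 : (p : A) ∈ 𝔟.comap π := Ideal.Quotient.eq_zero_iff_mem.mp (congrArg Prod.snd hp')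
      change Ideal.Quotient.mk _ (p : A) = 0
      rw [Ideal.Quotient.eq_zero_iff_mem, Ideal.mem_comap]
      have e1 : algebraMap S A g * p = p0 * (h * ξ p) + (algebraMap S A g - c * h) * p := by
        apply Subtype.ext
        simp only [MulMemClass.coe_mul, AddMemClass.coe_add, AddSubgroupClass.coe_sub, hc, ξ,
          LinearMap.coe_mk, AddHom.coe_mk]
        ring
      have e2 : π (algebraMap S A g) * π p ∈ P * 𝔟 := by
        rw [← map_mul, e1, map_add, map_mul, map_mul]
        refine add_mem (Ideal.mul_mem_mul hp0 ?_) (map_mul π _ _ ▸ Ideal.mul_mem_mul hgc hp2)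
        exact 𝔟.mul_mem_left _ hp1
      exact (Ideal.unit_mul_mem_iff_mem _ (hπu g hg)).mp e2
    have hN1 : IsNoetherian S (𝔭 ⧸ LinearMap.ker f) :=
      isNoetherian_of_linearEquiv f.quotKerEquivRange.symm
    have hN2 : IsNoetherian S (LinearMap.range G) := by
      have : LinearMap.range G = LinearMap.range ((LinearMap.ker f).liftQ G hle) := by
        rw [Submodule.range_liftQ]
      rw [this]
      exact isNoetherian_of_surjective ((LinearMap.ker f).liftQ G hle).rangeRestrict
        (LinearMap.range_eq_top.mpr (LinearMap.surjective_rangeRestrict _))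
    have hcomap : (P * 𝔟).comap π ≤ P.comap π := Ideal.comap_mono Ideal.mul_le_left
    refine isNoetherian_of_range_eq_ker (LinearMap.range G).subtype
      (Ideal.Quotient.factorₐ S hcomap).toLinearMap ?_
    rw [Submodule.range_subtype]
    ext a
    obtain ⟨a, rfl⟩ := Ideal.Quotient.mk_surjective a
    constructor
    · rintro ⟨p, hp⟩
      rw [← hp]
      change Ideal.Quotient.mk _ (p : A) = 0
      rw [Ideal.Quotient.eq_zero_iff_mem]
      exact p.2
    · intro ha
      have : Ideal.Quotient.mk (P.comap π) a = 0 := ha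
      rw [Ideal.Quotient.eq_zero_iff_mem] at this
      exact ⟨⟨a, this⟩, rfl⟩
  obtain ⟨Z, hZ⟩ := PrimeSpectrum.exists_primeSpectrum_prod_le Q (⊥ : Ideal Q)
  have hmain : ∀ Z : Multiset (PrimeSpectrum Q),
      IsNoetherian S (A ⧸ (Z.map PrimeSpectrum.asIdeal).prod.comap π) := by
    intro Z
    induction Z using Multiset.induction_on with
    | empty =>
      rw [Multiset.map_zero, Multiset.prod_zero, Ideal.one_eq_top, Ideal.comap_top]
      infer_instance
    | cons P Z ih =>
      rw [Multiset.map_cons, Multiset.prod_cons]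
      exact hstep _ _ P.2 ih
  have hfin := hmain Z
  have : (Z.map PrimeSpectrum.asIdeal).prod.comap π = K := by
    rw [le_bot_iff.mp hZ]
    ext p
    exact hπ0 p
  rwa [this] at hfin

include hK in
theorem absNoethM (M : Submonoid (A ⧸ K)) (hM : M = W.map (algebraMap S (A ⧸ K)))
    {Q : Type*} [CommRing Q] [Algebra (A ⧸ K) Q] [IsLocalization M Q]
    (h1 : ∀ b : B, IsIntegral A b → b ∈ A)
    (h2 : ∀ w ∈ W, ∀ b : B, w • b ∈ A → b ∈ A) (e : ℕ)
    (h3 : ∀ y : ℕ → A, ∃ k ≤ e, ∃ g ∈ W, ∃ r : ℕ → S, g • y k - ∑ i ∈ range k, r i • y i ∈ K)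
    (α : A) (hα : α ∈ K) (w0 : S) (hw0W : w0 ∈ W) (hw0 : x * α = algebraMap S B w0)
    (h5 : ∀ 𝔭 : Ideal A, 𝔭.IsPrime → K ≤ 𝔭 → (∀ w ∈ W, algebraMap S A w ∉ 𝔭) →
      IsNoetherian S (A ⧸ 𝔭)) :
    IsNoetherian S (A ⧸ K) := by
  have hsat : ∀ w ∈ W, ∀ p : A, w • p ∈ K → p ∈ K := by
    intro w hw p hp
    rw [hK] at hp ⊢
    apply h2 w hw
    rw [← mul_smul_comm]
    exact hp
  subst hM
  let π : A →+* Q := (algebraMap (A ⧸ K) Q).comp (Ideal.Quotient.mk K)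
  have hπ0 : ∀ p : A, π p = 0 ↔ p ∈ K := by
    intro p
    constructor
    · intro h
      have := (IsLocalization.map_eq_zero_iff (W.map (algebraMap S (A ⧸ K))) Q (Ideal.Quotient.mk K p)).mp h
      obtain ⟨⟨_, w, hw, rfl⟩, hm⟩ := this
      apply hsat w hw
      rw [← Ideal.Quotient.eq_zero_iff_mem, Algebra.smul_def, map_mul]
      exact hm
    · intro h
      simp [π, Ideal.Quotient.eq_zero_iff_mem.mpr h]
  have hπu : ∀ w ∈ W, IsUnit (π (algebraMap S A w)) := fun w hw =>
    IsLocalization.map_units Q (⟨_, w, hw, rfl⟩ : W.map (algebraMap S (A ⧸ K)))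
  have hπs : ∀ q : Q, ∃ p : A, ∃ w ∈ W, π (algebraMap S A w) * q = π p := by
    intro q
    obtain ⟨⟨a, ⟨_, w, hw, rfl⟩⟩, h⟩ := IsLocalization.surj (W.map (algebraMap S (A ⧸ K))) q
    obtain ⟨p, rfl⟩ := Ideal.Quotient.mk_surjective a
    exact ⟨p, w, hw, (mul_comm _ _).trans h⟩
  exact absNoethQ A x K hK W π hπ0 hπu hπs h1 h2 e h3 α hα w0 hw0W hw0 h5

include hK in
theorem absNoeth (h1 : ∀ b : B, IsIntegral A b → b ∈ A)
    (h2 : ∀ w ∈ W, ∀ b : B, w • b ∈ A → b ∈ A) (e : ℕ)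
    (h3 : ∀ y : ℕ → A, ∃ k ≤ e, ∃ g ∈ W, ∃ r : ℕ → S, g • y k - ∑ i ∈ range k, r i • y i ∈ K)
    (α : A) (hα : α ∈ K) (w0 : S) (hw0W : w0 ∈ W) (hw0 : x * α = algebraMap S B w0)
    (h5 : ∀ 𝔭 : Ideal A, 𝔭.IsPrime → K ≤ 𝔭 → (∀ w ∈ W, algebraMap S A w ∉ 𝔭) →
      IsNoetherian S (A ⧸ 𝔭)) :
    IsNoetherian S (A ⧸ K) :=
  absNoethM A x K hK W (W.map (algebraMap S (A ⧸ K))) rfl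
    (Q := Localization (W.map (algebraMap S (A ⧸ K)))) h1 h2 e h3 α hα w0 hw0W hw0 h5

end NHC

namespace NHC
universe u
open RingTheory.Sequence CategoryTheory Abelian Pointwise

theorem assoc_dim {R : Type*} [CommRing R] [IsLocalRing R] [IsNoetherianRing R] (rs : List R) :
    ∀ (M : Type _) [AddCommGroup M] [Module R M] [Module.Finite R M], (∀ r ∈ rs, r ∈ maximalIdeal R) →
    IsRegular M rs → ∀ P : Ideal R, IsAssociatedPrime P M → (rs.length : WithBot ℕ∞) ≤ ringKrullDim (R ⧸ P) := by
  induction rs with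
  | nil =>
    intro M _ _ _ _ _ P hP
    have := hP.isPrime
    simpa using ringKrullDim_nonneg_of_nontrivial
  | cons x rs ih =>
    intro M _ _ _ hm hreg P hP
    rw [isRegular_cons_iff] at hreg
    obtain ⟨hx, hreg⟩ := hreg
    have hPp := hP.isPrime
    obtain ⟨-, u, hu⟩ := isAssociatedPrime_iff.mp hP
    have huP : ∀ t, t ∈ P ↔ t • u = 0 := by
      intro t; rw [hu, Submodule.mem_colon_singleton]; rfl
    have hu0 : u ≠ 0 := by
      rintro rfl
      exact hPp.ne_top (by rw [Ideal.eq_top_iff_one]; rw [huP]; simp)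
    have hxP : x ∉ P := by
      intro h
      have := (huP x).mp h
      exact hu0 (hx (by simpa using this))
    let U : Submodule R M :=
      { carrier := {v | ∀ t ∈ P, t • v = 0}
        add_mem' := by intro a b ha hb t ht; rw [smul_add, ha t ht, hb t ht, add_zero]
        zero_mem' := by intro t _; simp
        smul_mem' := by intro c a ha t ht; rw [smul_comm, ha t ht, smul_zero] }
    have hUx : ¬ U ≤ x • (⊤ : Submodule R M) := by
      intro hle
      have : U ≤ (Ideal.span {x}) • U := by
        intro v hv
        obtain ⟨v', -, hv'⟩ := hle hv
        have : v' ∈ U := by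
          intro t ht
          apply hx
          have h1 := hv t ht
          rw [← hv'] at h1
          change x • t • v' = x • (0 : M)
          rw [smul_zero, smul_comm]
          exact h1
        rw [Submodule.ideal_span_singleton_smul]
        exact ⟨v', this, hv'⟩
      have hbot := Submodule.eq_bot_of_le_smul_of_le_jacobson_bot _ U (IsNoetherian.noetherian U) this
        (by rw [IsLocalRing.jacobson_eq_maximalIdeal ⊥ bot_ne_top, Ideal.span_singleton_le_iff_mem]
            exact hm x (by simp))
      have : u ∈ U := fun t ht => (huP t).mp ht
      rw [hbot] at this
      exact hu0 this
    obtain ⟨v, hvU, hv⟩ := SetLike.not_le_iff_exists.mp hUx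
    have hv0 : (Submodule.Quotient.mk v : QuotSMulTop x M) ≠ 0 := by
      rwa [Ne, Submodule.Quotient.mk_eq_zero]
    obtain ⟨Q, hQ, hle⟩ := exists_le_isAssociatedPrime_of_isNoetherianRing R
      (Submodule.Quotient.mk v : QuotSMulTop x M) hv0
    have hPQ : P ≤ Q := by
      intro t ht
      apply hle
      rw [Submodule.mem_colon_singleton, ← Submodule.Quotient.mk_smul, hvU t ht]
      simp
    have hxQ : x ∈ Q := by
      apply hle
      rw [Submodule.mem_colon_singleton, ← Submodule.Quotient.mk_smul, Submodule.mem_bot,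
        Submodule.Quotient.mk_eq_zero]
      exact ⟨v, trivial, rfl⟩
    have h1 := ih (QuotSMulTop x M) (fun r hr => hm r (by simp [hr])) hreg Q hQ
    have h2 : Ideal.Quotient.mk P x ∈ nonZeroDivisors (R ⧸ P) := by
      rw [mem_nonZeroDivisors_iff_ne_zero, Ne, Ideal.Quotient.eq_zero_iff_mem]
      exact hxP
    have h3 := ringKrullDim_quotient_succ_le_of_nonZeroDivisor h2
    have h4 : ringKrullDim (R ⧸ Q) ≤ ringKrullDim ((R ⧸ P) ⧸ Ideal.span {Ideal.Quotient.mk P x}) := by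
      let f : ((R ⧸ P) ⧸ Ideal.span {Ideal.Quotient.mk P x}) →+* R ⧸ Q :=
        Ideal.Quotient.lift _ (Ideal.Quotient.factor hPQ) (by
          intro a ha
          have : Ideal.span {Ideal.Quotient.mk P x} ≤ RingHom.ker (Ideal.Quotient.factor hPQ) := by
            rw [Ideal.span_singleton_le_iff_mem, RingHom.mem_ker, Ideal.Quotient.factor_mk,
              Ideal.Quotient.eq_zero_iff_mem]
            exact hxQ
          exact this ha)
      apply ringKrullDim_le_of_surjective f
      intro q
      obtain ⟨r, rfl⟩ := Ideal.Quotient.mk_surjective q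
      exact ⟨Ideal.Quotient.mk _ (Ideal.Quotient.mk P r), rfl⟩
    rw [List.length_cons]
    push_cast
    refine le_trans ?_ h3
    gcongr
    exact h1.trans h4

theorem dim_le_of_prim {R : Type*} [CommRing R] [IsLocalRing R] [IsNoetherianRing R] (as : List R)
    (P : Ideal R) [P.IsPrime] (hm : ∀ r ∈ as, r ∈ maximalIdeal R) (k : ℕ)
    (h : maximalIdeal R ^ k ≤ Ideal.ofList as ⊔ P) : ringKrullDim (R ⧸ P) ≤ as.length := by
  classical
  have : IsLocalRing (R ⧸ P) := IsLocalRing.of_surjective' (Ideal.Quotient.mk P) Ideal.Quotient.mk_surjective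
  let S : Finset (R ⧸ P) := (as.map (Ideal.Quotient.mk P)).toFinset
  have hS : (S : Set (R ⧸ P)) ⊆ maximalIdeal (R ⧸ P) := by
    intro s hs
    simp only [S, List.coe_toFinset, List.mem_map, Set.mem_ofPred_eq] at hs
    obtain ⟨a, ha, rfl⟩ := hs
    have : IsLocalHom (Ideal.Quotient.mk P) := IsLocalHom.of_surjective _ Ideal.Quotient.mk_surjective
    exact fun hu => (hm a ha) (isUnit_of_map_unit (Ideal.Quotient.mk P) a hu)
  have h1 := ringKrullDim_le_ringKrullDim_quotient_add_card S
    (by rw [IsLocalRing.ringJacobson_eq_maximalIdeal]; exact hS)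
  have h2 : ringKrullDim ((R ⧸ P) ⧸ Ideal.span (S : Set (R ⧸ P))) ≤ 0 := by
    have h0 : Ring.KrullDimLE 0 ((R ⧸ P) ⧸ Ideal.span (S : Set (R ⧸ P))) := by
      rw [Ring.krullDimLE_zero_iff]
      intro Q hQ
      let f : R →+* ((R ⧸ P) ⧸ Ideal.span (S : Set (R ⧸ P))) := (Ideal.Quotient.mk _).comp (Ideal.Quotient.mk P)
      have hf : Function.Surjective f := Ideal.Quotient.mk_surjective.comp Ideal.Quotient.mk_surjective
      have hle : maximalIdeal R ≤ Q.comap f := by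
        apply (hQ.comap f).le_of_pow_le (n := k)
        refine h.trans (sup_le ?_ ?_)
        · rw [Ideal.ofList, Ideal.span_le]
          intro a ha
          have : f a = 0 := by
            simp only [f, RingHom.comp_apply]
            rw [Ideal.Quotient.eq_zero_iff_mem]
            apply Ideal.subset_span
            simp only [S, List.coe_toFinset, List.mem_map, Set.mem_ofPred_eq]
            exact ⟨a, ha, rfl⟩
          simp only [SetLike.mem_coe, Ideal.mem_comap, this, Q.zero_mem]
        · intro a ha
          have : f a = 0 := by
            simp only [f, RingHom.comp_apply]
            rw [Ideal.Quotient.eq_zero_iff_mem.mpr ha, map_zero]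
          simp only [Ideal.mem_comap, this, Q.zero_mem]
      have hmax : (Q.comap f).IsMaximal := by
        have : Q.comap f = maximalIdeal R :=
          ((maximalIdeal.isMaximal R).eq_of_le (hQ.comap f).ne_top hle).symm
        rw [this]; infer_instance
      rw [← Ideal.map_comap_of_surjective f hf Q]
      exact (Ideal.map_eq_top_or_isMaximal_of_surjective f hf hmax).resolve_left
        (by rw [Ideal.map_comap_of_surjective f hf Q]; exact hQ.ne_top)
    exact_mod_cast Ring.krullDimLE_iff.mp h0
  have h3 : (S.card : WithBot ℕ∞) ≤ as.length := by
    have : S.card ≤ as.length := by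
      simpa using List.toFinset_card_le (as.map (Ideal.Quotient.mk P))
    exact_mod_cast this
  calc ringKrullDim (R ⧸ P) ≤ _ := h1
    _ ≤ 0 + as.length := add_le_add h2 h3
    _ = _ := zero_add _

theorem depth_exchange {R : Type u} [CommRing R] [IsLocalRing R] [IsNoetherianRing R]
    (M : Type u) [AddCommGroup M] [Module R M] [Module.Finite R M] (n : ℕ)
    (h : ∃ rs : List R, rs.length = n + 1 ∧ (∀ r ∈ rs, r ∈ maximalIdeal R) ∧ IsRegular M rs)
    (y : R) (hy : y ∈ maximalIdeal R) (hreg : IsSMulRegular M y) :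
    ∃ rs : List R, rs.length = n ∧ (∀ r ∈ rs, r ∈ maximalIdeal R) ∧ IsRegular (QuotSMulTop y M) rs := by
  have hM : Nontrivial M := by obtain ⟨rs, -, -, h⟩ := h; exact h.nontrivial
  have lt1 : ∀ (N : Type u) [AddCommGroup N] [Module R N] [Module.Finite R N] [Nontrivial N],
      maximalIdeal R • (⊤ : Submodule R N) < ⊤ := by
    intro N _ _ _ _
    refine lt_top_iff_ne_top.mpr fun h => ?_
    have := Submodule.eq_bot_of_le_smul_of_le_jacobson_bot (maximalIdeal R) (⊤ : Submodule R N)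
      Module.Finite.fg_top h.ge (by rw [IsLocalRing.jacobson_eq_maximalIdeal ⊥ bot_ne_top])
    exact top_ne_bot this
  have hNt : Nontrivial (QuotSMulTop y M) := by
    rw [Submodule.Quotient.nontrivial_iff]
    intro htop
    have h1 := lt1 M
    have : y • (⊤ : Submodule R M) ≤ maximalIdeal R • (⊤ : Submodule R M) := by
      rw [← Submodule.ideal_span_singleton_smul]
      exact Submodule.smul_mono_left ((Ideal.span_singleton_le_iff_mem _).mpr hy)
    rw [htop] at this
    exact h1.not_ge this
  have e1 := ((ModuleCat.exists_isRegular_tfae (maximalIdeal R) (n + 1) (ModuleCat.of R M) (lt1 M)).out 3 1).mp h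
  refine ((ModuleCat.exists_isRegular_tfae (maximalIdeal R) n (ModuleCat.of R (QuotSMulTop y M)) (lt1 _)).out 3 1).mpr ?_
  intro i hi
  have zero1 := AddCommGrpCat.isZero_of_iff_subsingleton.mpr (e1 i (by omega))
  have zero2 := AddCommGrpCat.isZero_of_iff_subsingleton.mpr (e1 (i + 1) (by omega))
  exact AddCommGrpCat.subsingleton_of_isZero <| ShortComplex.Exact.isZero_of_both_zeros
    ((Ext.covariant_sequence_exact₃' _ (IsSMulRegular.smulShortComplex_shortExact (M := ModuleCat.of R M) hreg)) i (i + 1) rfl)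
    (zero1.eq_zero_of_src _) (zero2.eq_zero_of_tgt _)

theorem sop_regular {R : Type u} [CommRing R] [IsLocalRing R] [IsNoetherianRing R] (as : List R) :
    ∀ (M : Type u) [AddCommGroup M] [Module R M] [Module.Finite R M]
    (_ : ∃ rs : List R, rs.length = as.length ∧ (∀ r ∈ rs, r ∈ maximalIdeal R) ∧ IsRegular M rs)
    (_ : ∀ r ∈ as, r ∈ maximalIdeal R) (k : ℕ)
    (_ : maximalIdeal R ^ k ≤ Ideal.ofList as ⊔ Module.annihilator R M), IsRegular M as := by
  induction as with
  | nil =>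
    intro M _ _ _ h _ _ _
    obtain ⟨rs, -, -, h⟩ := h
    have := h.nontrivial
    exact IsRegular.nil R M
  | cons y as ih =>
    intro M _ _ _ h hm k hk
    have hy : IsSMulRegular M y := by
      by_contra hcon
      have : y ∈ ⋃ p ∈ associatedPrimes R M, (p : Set R) := by
        rw [biUnion_associatedPrimes_eq_compl_regular]; exact hcon
      simp only [Set.mem_iUnion] at this
      obtain ⟨P, hP, hyP⟩ := this
      obtain ⟨rs, hlen, hrm, hr⟩ := h
      have h1 := assoc_dim rs M hrm hr P hP
      have := hP.isPrime
      have h2 := dim_le_of_prim as P (fun r hr => hm r (by simp [hr])) k (by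
        refine hk.trans ?_
        rw [Ideal.ofList_cons]
        have ha : Module.annihilator R M ≤ P := by rw [← Submodule.annihilator_top]; exact hP.annihilator_le
        have : Ideal.span {y} ≤ P := (Ideal.span_singleton_le_iff_mem _).mpr hyP
        refine sup_le (sup_le (this.trans le_sup_right) le_sup_left) (ha.trans le_sup_right))
      rw [hlen] at h1
      have h3 : ((as.length + 1 : ℕ) : WithBot ℕ∞) ≤ (as.length : ℕ) := h1.trans h2
      have h4 : as.length + 1 ≤ as.length := by exact_mod_cast h3
      omega
    refine IsRegular.cons hy (ih _ ?_ (fun r hr => hm r (by simp [hr])) k ?_)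
    · exact depth_exchange M _ h y (hm y (by simp)) hy
    · refine hk.trans ?_
      rw [Ideal.ofList_cons]
      have h1 : Module.annihilator R M ≤ Module.annihilator R (QuotSMulTop y M) :=
        (Submodule.mkQ (y • (⊤ : Submodule R M))).annihilator_le_of_surjective (Submodule.mkQ_surjective _)
      have h2 : Ideal.span {y} ≤ Module.annihilator R (QuotSMulTop y M) := by
        rw [Ideal.span_singleton_le_iff_mem, Module.mem_annihilator]
        intro q
        obtain ⟨v, rfl⟩ := Submodule.mkQ_surjective _ q
        rw [← map_smul, Submodule.mkQ_apply, Submodule.Quotient.mk_eq_zero]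
        exact ⟨v, trivial, rfl⟩
      exact sup_le (sup_le (h2.trans le_sup_right) le_sup_left) (h1.trans le_sup_right)

end NHC

namespace NHC

section qr
variable {R : Type*} [CommRing R]

/-- The map `T_i ↦ a_i X` onto the Rees algebra. -/
noncomputable def phi {d : ℕ} (a : Fin d → R) : MvPolynomial (Fin d) R →ₐ[R] R[X] :=
  MvPolynomial.aeval (fun i => C (a i) * X)

/-- `a_i` is a nonzerodivisor modulo the later ones. -/
def RegFn : (d : ℕ) → (Fin d → R) → Prop
  | 0, _ => True
  | d + 1, a => (∀ x, a 0 * x ∈ Ideal.span (Set.range (Fin.tail a)) →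
      x ∈ Ideal.span (Set.range (Fin.tail a))) ∧ RegFn d (Fin.tail a)

theorem regFn_of_list (d : ℕ) (a : Fin d → R)
    (h : RingTheory.Sequence.IsWeaklyRegular R (List.ofFn a).reverse) : RegFn d a := by
  induction d with
  | zero => trivial
  | succ d ih =>
    rw [List.ofFn_succ, List.reverse_cons, RingTheory.Sequence.isWeaklyRegular_append_iff,
      RingTheory.Sequence.isWeaklyRegular_singleton_iff] at h
    refine ⟨?_, ih (Fin.tail a) h.1⟩
    intro x hx
    have e : Ideal.ofList (List.ofFn fun i : Fin d => a i.succ).reverse = Ideal.span (Set.range (Fin.tail a)) := by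
      unfold Ideal.ofList
      congr 1
      ext y
      simp [Fin.tail, List.mem_ofFn]
    have e2 : (Ideal.ofList (List.ofFn fun i : Fin d => a i.succ).reverse • ⊤ : Submodule R R) =
        Ideal.span (Set.range (Fin.tail a)) := by
      rw [smul_eq_mul, Ideal.mul_top, e]
    have h2 := h.2
    rw [e2] at h2
    have h3 := @h2 (Submodule.Quotient.mk x) 0 (by
      simp only [smul_zero]
      rw [← Submodule.Quotient.mk_smul, Submodule.Quotient.mk_eq_zero]
      exact hx)
    rwa [Submodule.Quotient.mk_eq_zero] at h3

variable {d : ℕ} (a : Fin d → R)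

theorem phi_X (i : Fin d) : phi a (MvPolynomial.X i) = C (a i) * X := by simp [phi]
theorem phi_C (r : R) : phi a (MvPolynomial.C r) = C r := by
  simp [phi]

theorem phi_mem_rees (f : MvPolynomial (Fin d) R) : phi a f ∈ reesAlgebra (Ideal.span (Set.range a)) := by
  induction f using MvPolynomial.induction_on with
  | C r => rw [phi_C]; exact Subalgebra.algebraMap_mem (reesAlgebra (Ideal.span (Set.range a))) r
  | add p q hp hq => rw [map_add]; exact add_mem hp hq
  | mul_X p i hp =>
    rw [map_mul, phi_X]
    refine mul_mem hp ?_
    rw [C_mul_X_eq_monomial, reesAlgebra.monomial_mem, pow_one]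
    exact Ideal.subset_span ⟨i, rfl⟩

theorem phi_mem (𝔟 : Ideal R) (f : MvPolynomial (Fin d) R) (hf : f ∈ 𝔟.map MvPolynomial.C) (n : ℕ) :
    (phi a f).coeff n ∈ 𝔟 * Ideal.span (Set.range a) ^ n := by
  revert n
  refine Submodule.span_induction (p := fun f _ => ∀ n, (phi a f).coeff n ∈ 𝔟 * Ideal.span (Set.range a) ^ n)
    ?_ ?_ ?_ ?_ hf
  · rintro _ ⟨b, hb, rfl⟩ n
    change (phi a (MvPolynomial.C b)).coeff n ∈ _
    rw [phi_C, coeff_C]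
    split_ifs with h
    · subst h; simpa using hb
    · exact zero_mem _
  · intro n; simp
  · intro x y _ _ hx hy n
    rw [map_add, coeff_add]; exact add_mem (hx n) (hy n)
  · intro c x _ hx n
    rw [smul_eq_mul, map_mul, coeff_mul]
    refine Ideal.sum_mem _ fun ij hij => ?_
    rw [← HasAntidiagonal.mem_antidiagonal.mp hij, pow_add, mul_left_comm]
    exact Ideal.mul_mem_mul (phi_mem_rees a c ij.1) (hx ij.2)

theorem phi_lift1 (n : ℕ) (x : R) (hx : x ∈ Ideal.span (Set.range a) ^ n) :
    ∃ f, phi a f = monomial n x := by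
  induction n generalizing x with
  | zero => exact ⟨MvPolynomial.C x, by rw [phi_C]; rfl⟩
  | succ n ih =>
    rw [pow_succ] at hx
    refine Submodule.mul_induction_on hx ?_ ?_
    · intro y hy z hz
      obtain ⟨f, hf⟩ := ih y hy
      have : ∃ g, phi a g = monomial 1 z := by
        refine Submodule.span_induction (p := fun z _ => ∃ g, phi a g = monomial 1 z) ?_ ?_ ?_ ?_ hz
        · rintro _ ⟨i, rfl⟩
          exact ⟨MvPolynomial.X i, by rw [phi_X, C_mul_X_eq_monomial]⟩
        · exact ⟨0, by simp⟩
        · rintro x y _ _ ⟨g, hg⟩ ⟨g', hg'⟩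
          exact ⟨g + g', by rw [map_add, hg, hg', map_add]⟩
        · rintro c x _ ⟨g, hg⟩
          exact ⟨MvPolynomial.C c * g, by rw [map_mul, phi_C, hg, C_mul_monomial, smul_eq_mul]⟩
      obtain ⟨g, hg⟩ := this
      exact ⟨f * g, by rw [map_mul, hf, hg, monomial_mul_monomial]⟩
    · rintro x y ⟨g, hg⟩ ⟨g', hg'⟩
      exact ⟨g + g', by rw [map_add, hg, hg', map_add]⟩

theorem phi_lift2 (𝔟 : Ideal R) (n : ℕ) (x : R) (hx : x ∈ 𝔟 * Ideal.span (Set.range a) ^ n) :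
    ∃ f ∈ 𝔟.map (MvPolynomial.C (σ := Fin d)), phi a f = monomial n x := by
  refine Submodule.mul_induction_on hx ?_ ?_
  · intro b hb y hy
    obtain ⟨f, hf⟩ := phi_lift1 a n y hy
    refine ⟨MvPolynomial.C b * f, Ideal.mul_mem_right _ _ (Ideal.mem_map_of_mem _ hb), ?_⟩
    rw [map_mul, phi_C, hf, C_mul_monomial]
  · rintro x y ⟨g, h, hg⟩ ⟨g', h', hg'⟩
    exact ⟨g + g', add_mem h h', by rw [map_add, hg, hg', map_add]⟩

theorem phi_lift (𝔟 : Ideal R) (q : R[X]) (hq : ∀ n, q.coeff n ∈ 𝔟 * Ideal.span (Set.range a) ^ n) :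
    ∃ f ∈ 𝔟.map (MvPolynomial.C (σ := Fin d)), phi a f = q := by
  choose f hf hq' using fun n => phi_lift2 a 𝔟 n (q.coeff n) (hq n)
  refine ⟨∑ n ∈ q.support, f n, Ideal.sum_mem _ fun n _ => hf n, ?_⟩
  rw [map_sum]
  conv_rhs => rw [q.as_sum_support]
  exact Finset.sum_congr rfl fun n _ => hq' n

theorem phi_lift_rees (q : R[X]) (hq : q ∈ reesAlgebra (Ideal.span (Set.range a))) : ∃ f, phi a f = q := by
  obtain ⟨f, -, hf⟩ := phi_lift a ⊤ q (fun n => by simpa using hq n)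
  exact ⟨f, hf⟩

/-- quasi-regularity -/
def QR : Prop := ∀ f, phi a f = 0 → f ∈ (Ideal.span (Set.range a)).map (MvPolynomial.C (σ := Fin d))

variable {a} in
theorem QR.gen (h : QR a) (𝔟 : Ideal R) (hb : Ideal.span (Set.range a) ≤ 𝔟) (f : MvPolynomial (Fin d) R)
    (hf : ∀ n, (phi a f).coeff n ∈ 𝔟 * Ideal.span (Set.range a) ^ n) : f ∈ 𝔟.map (MvPolynomial.C (σ := Fin d)) := by
  obtain ⟨g, hg, e⟩ := phi_lift a 𝔟 _ hf
  have := h (f - g) (by rw [map_sub, e, sub_self])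
  have h2 := Ideal.map_mono hb this
  simpa using add_mem h2 hg

theorem reg_pow (h : QR a) (a0 : R)
    (h0 : ∀ x, a0 * x ∈ Ideal.span (Set.range a) → x ∈ Ideal.span (Set.range a)) (m : ℕ) (x : R)
    (hx : a0 * x ∈ Ideal.span (Set.range a) ^ m) : x ∈ Ideal.span (Set.range a) ^ m := by
  induction m with
  | zero => simp
  | succ m ih =>
    obtain ⟨g, hg⟩ := phi_lift1 a m x (ih (Ideal.pow_le_pow_right (Nat.le_succ m) hx))
    have h1 := h.gen _ le_rfl (MvPolynomial.C a0 * g) (by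
      intro n
      rw [map_mul, phi_C, hg, C_mul_monomial, coeff_monomial]
      split_ifs with hn
      · subst hn; rwa [← pow_succ']
      · exact zero_mem _)
    have h2 : g ∈ (Ideal.span (Set.range a)).map (MvPolynomial.C (σ := Fin d)) := by
      rw [MvPolynomial.mem_map_C_iff] at h1 ⊢
      intro c
      have := h1 c
      rw [MvPolynomial.coeff_C_mul] at this
      exact h0 _ this
    have h3 := phi_mem a _ g h2 m
    rw [hg, coeff_monomial, if_pos rfl, ← pow_succ'] at h3
    exact h3

/-- the map in `finSuccEquiv` form -/
theorem phi_succ {d : ℕ} (a : Fin (d + 1) → R) (f : MvPolynomial (Fin (d + 1)) R) :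
    phi a f = Polynomial.eval₂ (phi (Fin.tail a) : MvPolynomial (Fin d) R →+* R[X]) (C (a 0) * X)
      (MvPolynomial.finSuccEquiv R d f) := by
  induction f using MvPolynomial.induction_on with
  | C r => rw [phi_C, MvPolynomial.finSuccEquiv_apply, MvPolynomial.eval₂Hom_C]; simp [phi_C]
  | add p q hp hq => rw [map_add, hp, hq, map_add, eval₂_add]
  | mul_X p i hp =>
    rw [map_mul, hp, map_mul, eval₂_mul, phi_X]
    congr 1
    refine Fin.cases ?_ (fun j => ?_) i
    · rw [MvPolynomial.finSuccEquiv_X_zero, eval₂_X]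
    · rw [MvPolynomial.finSuccEquiv_X_succ, eval₂_C]
      simp [phi_X, Fin.tail]

theorem qr_of_reg : ∀ (d : ℕ) (a : Fin d → R), RegFn d a → QR a := by
  intro d
  induction d with
  | zero =>
    intro a _ f hf
    obtain ⟨r, rfl⟩ := MvPolynomial.C_surjective (R := R) (Fin 0) f
    rw [phi_C, C_eq_zero] at hf
    rw [hf, map_zero]; exact zero_mem _
  | succ d ih =>
    intro a ha
    obtain ⟨h0, hr⟩ := ha
    have hQ := ih _ hr
    set a' := Fin.tail a with ha'
    set J' := Ideal.span (Set.range a') with hJ'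
    set J := Ideal.span (Set.range a) with hJ
    have hJJ : J' ≤ J := by
      apply Ideal.span_mono
      rintro _ ⟨i, rfl⟩
      exact ⟨i.succ, rfl⟩
    have h0J : a 0 ∈ J := Ideal.subset_span ⟨0, rfl⟩
    have key : ∀ (k : ℕ) (P : (MvPolynomial (Fin d) R)[X]), P.natDegree ≤ k →
        Polynomial.eval₂ (phi a' : MvPolynomial (Fin d) R →+* R[X]) (C (a 0) * X) P = 0 →
        ∀ i, P.coeff i ∈ J.map (MvPolynomial.C (σ := Fin d)) := by
      intro k
      induction k with
      | zero =>
        intro P hP h i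
        rw [eq_C_of_natDegree_le_zero hP] at h ⊢
        rw [eval₂_C] at h
        rw [coeff_C]
        split_ifs
        · exact Ideal.map_mono hJJ (hQ _ h)
        · exact zero_mem _
      | succ k ihk =>
        intro P hP h
        set H := P.divX with hH
        set G := P.coeff 0 with hG
        have hPe : P = H * X + C G := (divX_mul_X_add P).symm
        set q := Polynomial.eval₂ (phi a' : MvPolynomial (Fin d) R →+* R[X]) (C (a 0) * X) H with hq
        rw [hPe, eval₂_add, eval₂_mul, eval₂_X, eval₂_C, ← hq] at h
        have h1 : C (a 0) * (q * X) = - phi a' G := by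
          have h' : q * (C (a 0) * X) + phi a' G = 0 := h
          linear_combination h'
        have h2 : ∀ n, (q * X).coeff n ∈ J' ^ n := by
          intro n
          apply reg_pow a' hQ (a 0) h0
          rw [← coeff_C_mul, h1, coeff_neg]
          exact neg_mem (phi_mem_rees a' G n)
        obtain ⟨h, hh⟩ := phi_lift_rees a' (q * X) h2
        obtain ⟨h', hh'J, hh'⟩ := phi_lift a' J' q (by
          intro n
          have := h2 (n + 1)
          rwa [coeff_mul_X, pow_succ'] at this)
        have h3 := ihk (H - C h') (by
          refine (natDegree_sub_le _ _).trans (max_le ?_ (by simp))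
          rw [hH, natDegree_divX_eq_natDegree_tsub_one]; omega) (by
          rw [eval₂_sub, ← hq, eval₂_C]
          exact sub_eq_zero.mpr hh'.symm)
        have h4 := hQ (G + MvPolynomial.C (a 0) * h) (by
          rw [map_add, map_mul, phi_C, hh, h1]; ring)
        have h5 : G ∈ J.map (MvPolynomial.C (σ := Fin d)) := by
          have e1 := Ideal.map_mono (f := MvPolynomial.C (σ := Fin d)) hJJ h4
          have e2 : MvPolynomial.C (a 0) * h ∈ J.map (MvPolynomial.C (σ := Fin d)) :=
            Ideal.mul_mem_right _ _ (Ideal.mem_map_of_mem _ h0J)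
          simpa using sub_mem e1 e2
        intro i
        rcases i with _ | i
        · exact h5
        · have e1 := h3 i
          rw [coeff_sub, coeff_divX, coeff_C] at e1
          have e2 : (if i = 0 then h' else 0) ∈ J.map (MvPolynomial.C (σ := Fin d)) := by
            split_ifs
            · exact Ideal.map_mono hJJ hh'J
            · exact zero_mem _
          simpa using add_mem e1 e2
    intro f hf
    rw [phi_succ] at hf
    rw [MvPolynomial.mem_map_C_iff]
    intro c
    have h1 := key _ _ le_rfl hf (c 0)
    rw [MvPolynomial.mem_map_C_iff] at h1
    have h2 := h1 (Finsupp.tail c)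
    rwa [MvPolynomial.finSuccEquiv_coeff_coeff, Finsupp.cons_tail] at h2

theorem unit_coeff_nzd : ∀ (d : ℕ) (g h : MvPolynomial (Fin d) R), (∃ c, IsUnit (g.coeff c)) → g * h = 0 → h = 0 := by
  intro d
  induction d with
  | zero =>
    intro g h ⟨c, hc⟩ hgh
    obtain ⟨r, rfl⟩ := MvPolynomial.C_surjective (R := R) (Fin 0) g
    obtain ⟨s, rfl⟩ := MvPolynomial.C_surjective (R := R) (Fin 0) h
    have : c = 0 := Subsingleton.elim _ _
    subst this
    rw [MvPolynomial.coeff_C, if_pos rfl] at hc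
    rw [← map_mul] at hgh
    have h2 := MvPolynomial.C_injective _ _ (hgh.trans (map_zero _).symm)
    rw [hc.mul_right_eq_zero.mp h2, map_zero]
  | succ d ih =>
    intro g h ⟨c, hc⟩ hgh
    set P := MvPolynomial.finSuccEquiv R d g with hP
    have hnz : P ∈ nonZeroDivisors (MvPolynomial (Fin d) R)[X] := by
      by_contra hcon
      obtain ⟨b, hb0, hb⟩ := Polynomial.notMem_nonZeroDivisors_iff.mp hcon
      apply hb0
      have h1 : P.coeff (c 0) * b = 0 := by
        have := congrArg (fun Q => Q.coeff (c 0)) hb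
        simpa [mul_comm] using this
      exact ih _ b ⟨Finsupp.tail c, by rwa [MvPolynomial.finSuccEquiv_coeff_coeff, Finsupp.cons_tail]⟩ h1
    have h2 : P * MvPolynomial.finSuccEquiv R d h = 0 := by rw [hP, ← map_mul, hgh, map_zero]
    have h3 := (mul_right_mem_nonZeroDivisors_eq_zero_iff hnz).mp ((mul_comm _ _).trans h2)
    simpa using h3

end qr
end NHC

namespace NHC

theorem ai_mem {R : Type*} [CommRing R] {d : ℕ} (a : Fin d → R) (i : Fin d) : a i ∈ Ideal.span (Set.range a) :=
  Ideal.subset_span (Set.mem_range_self i)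

section loc
variable {R : Type*} [CommRing R] [IsLocalRing R] {d : ℕ}

/-- polynomials not all of whose coefficients are in the maximal ideal -/
noncomputable def WW (R : Type*) [CommRing R] [IsLocalRing R] (d : ℕ) : Submonoid (MvPolynomial (Fin d) R) :=
  (nonZeroDivisors (MvPolynomial (Fin d) (ResidueField R))).comap (MvPolynomial.map (residue R))

theorem mem_WW {g : MvPolynomial (Fin d) R} : g ∈ WW R d ↔ MvPolynomial.map (residue R) g ≠ 0 := by
  rw [WW, Submonoid.mem_comap, mem_nonZeroDivisors_iff_ne_zero]

theorem mem_WW_iff {g : MvPolynomial (Fin d) R} : g ∈ WW R d ↔ ∃ c, IsUnit (g.coeff c) := by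
  rw [mem_WW, Ne, MvPolynomial.ext_iff, not_forall]
  simp [MvPolynomial.coeff_map]

theorem X_mem_WW (i : Fin d) : (MvPolynomial.X i : MvPolynomial (Fin d) R) ∈ WW R d := by
  rw [mem_WW, MvPolynomial.map_X]; exact MvPolynomial.X_ne_zero i

theorem notMem_WW {g : MvPolynomial (Fin d) R} : g ∉ WW R d ↔ g ∈ (maximalIdeal R).map MvPolynomial.C := by
  rw [mem_WW_iff, MvPolynomial.mem_map_C_iff]; simp

theorem WW_cancel_coeff (𝔟 : Ideal R) {g : MvPolynomial (Fin d) R} (hg : g ∈ WW R d) (h : MvPolynomial (Fin d) R)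
    (hh : g * h ∈ 𝔟.map (MvPolynomial.C (σ := Fin d))) : h ∈ 𝔟.map (MvPolynomial.C (σ := Fin d)) := by
  have e : ∀ f : MvPolynomial (Fin d) R, f ∈ 𝔟.map (MvPolynomial.C (σ := Fin d)) ↔
      MvPolynomial.map (Ideal.Quotient.mk 𝔟) f = 0 := by
    intro f
    rw [MvPolynomial.mem_map_C_iff, MvPolynomial.ext_iff]
    simp [MvPolynomial.coeff_map, Ideal.Quotient.eq_zero_iff_mem]
  rw [e] at hh ⊢
  rw [map_mul] at hh
  obtain ⟨c, hc⟩ := mem_WW_iff.mp hg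
  exact unit_coeff_nzd d _ _ ⟨c, by rw [MvPolynomial.coeff_map]; exact hc.map _⟩ hh

variable {a : Fin d → R} (hQ : QR a)
include hQ

theorem WW_cancel_b (𝔟 : Ideal R) (hb : Ideal.span (Set.range a) ≤ 𝔟) {g : MvPolynomial (Fin d) R}
    (hg : g ∈ WW R d) (q : R[X]) (hq : q ∈ reesAlgebra (Ideal.span (Set.range a)))
    (h : ∀ n, (phi a g * q).coeff n ∈ 𝔟 * Ideal.span (Set.range a) ^ n) (n : ℕ) :
    q.coeff n ∈ 𝔟 * Ideal.span (Set.range a) ^ n := by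
  obtain ⟨f, rfl⟩ := phi_lift_rees a q hq
  rw [← map_mul] at h
  exact phi_mem a 𝔟 f (WW_cancel_coeff 𝔟 hg f (hQ.gen 𝔟 hb _ h)) n

theorem WW_cancel_t1 {g : MvPolynomial (Fin d) R}
    (hg : g ∈ WW R d) (q : R[X]) (hq : q ∈ reesAlgebra (Ideal.span (Set.range a))) (t : ℕ)
    (h : ∀ n, (phi a g * q).coeff n ∈ Ideal.span (Set.range a) ^ (n + t)) (n : ℕ) :
    q.coeff n ∈ Ideal.span (Set.range a) ^ (n + t) := by
  induction t generalizing n with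
  | zero => exact hq n
  | succ t ih =>
    have ih' := ih (fun n => Ideal.pow_le_pow_right (by omega) (h n))
    have := WW_cancel_b hQ _ le_rfl hg (q * X ^ t) (by
      intro n
      rw [coeff_mul_X_pow']
      split_ifs with hn
      · have := ih' (n - t)
        rwa [Nat.sub_add_cancel hn] at this
      · exact zero_mem _) (by
      intro n
      rw [← mul_assoc, coeff_mul_X_pow']
      split_ifs with hn
      · have := h (n - t)
        rw [← pow_succ']
        rwa [show n - t + (t + 1) = n + 1 by omega] at this
      · exact zero_mem _) (n + t)
    rwa [coeff_mul_X_pow, ← pow_succ'] at this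

theorem a_cancel (i : Fin d) (s t : ℕ) (x : R) (h : a i ^ s * x ∈ Ideal.span (Set.range a) ^ (s + t)) :
    x ∈ Ideal.span (Set.range a) ^ t := by
  have := WW_cancel_t1 hQ (Submonoid.pow_mem _ (X_mem_WW i) s) (C x)
    (Subalgebra.algebraMap_mem (reesAlgebra (Ideal.span (Set.range a))) x) t (by
      intro n
      rw [map_pow, phi_X, mul_pow, ← C_pow, mul_right_comm, ← C_mul, coeff_C_mul_X_pow]
      split_ifs with hn
      · subst hn; exact h
      · exact zero_mem _) 0
  simpa using this

/-- cancellation for the J-adic filtration -/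
theorem WW_cancel {g : MvPolynomial (Fin d) R}
    (hg : g ∈ WW R d) (q : R[X]) (t : ℕ) (i : Fin d)
    (h : ∀ n, (phi a g * q).coeff n ∈ Ideal.span (Set.range a) ^ (n + t)) (n : ℕ) :
    q.coeff n ∈ Ideal.span (Set.range a) ^ (n + t) := by
  set s := q.natDegree
  have hi : a i ∈ Ideal.span (Set.range a) := ai_mem a i
  have h1 : C (a i ^ s) * q ∈ reesAlgebra (Ideal.span (Set.range a)) := by
    intro n
    rw [coeff_C_mul]
    by_cases hn : n ≤ s
    · exact Ideal.mul_mem_right _ _ (Ideal.pow_le_pow_right hn (Ideal.pow_mem_pow hi s))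
    · rw [coeff_eq_zero_of_natDegree_lt (by omega), mul_zero]; exact zero_mem _
  have h2 := WW_cancel_t1 hQ hg _ h1 (s + t) (by
    intro n
    rw [mul_left_comm, coeff_C_mul, show n + (s + t) = s + (n + t) by ring, pow_add]
    exact Ideal.mul_mem_mul (Ideal.pow_mem_pow hi s) (h n)) n
  rw [coeff_C_mul, show n + (s + t) = s + (n + t) by ring] at h2
  exact a_cancel hQ i s _ _ h2

theorem WW_cancel_rees {g : MvPolynomial (Fin d) R} (hg : g ∈ WW R d) (q : R[X]) (i : Fin d)
    (h : phi a g * q ∈ reesAlgebra (Ideal.span (Set.range a))) : q ∈ reesAlgebra (Ideal.span (Set.range a)) :=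
  fun n => WW_cancel hQ hg q 0 i h n

/-- nonzerodivisor -/
theorem WW_nzd [IsNoetherianRing R] (hJ : Ideal.span (Set.range a) ≤ maximalIdeal R) {g : MvPolynomial (Fin d) R}
    (hg : g ∈ WW R d) (q : R[X]) (i : Fin d) (h : phi a g * q = 0) : q = 0 := by
  ext n
  rw [coeff_zero]
  have h1 : ∀ t, q.coeff n ∈ Ideal.span (Set.range a) ^ t := by
    intro t
    have := WW_cancel hQ hg q t i (by intro n; rw [h, coeff_zero]; exact zero_mem _) n
    exact Ideal.pow_le_pow_right (by omega) this
  have h2 := Ideal.iInf_pow_eq_bot_of_isLocalRing (Ideal.span (Set.range a))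
    (fun e => by rw [e] at hJ; exact (maximalIdeal.isMaximal R).ne_top (top_le_iff.mp hJ))
  have : q.coeff n ∈ ⨅ t, Ideal.span (Set.range a) ^ t := by simpa [Submodule.mem_iInf] using h1
  rwa [h2] at this

theorem a_nzd [IsNoetherianRing R] (hJ : Ideal.span (Set.range a) ≤ maximalIdeal R) (i : Fin d) (s : ℕ) (q : R[X])
    (h : C (a i ^ s) * q = 0) : q = 0 := by
  refine WW_nzd hQ hJ (Submonoid.pow_mem _ (X_mem_WW i) s) q i ?_
  rw [map_pow, phi_X, mul_pow, ← C_pow, mul_right_comm, h, zero_mul]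

end loc

section intcl
variable {R : Type*} [CommRing R] [IsLocalRing R] [IsNoetherianRing R] {d : ℕ} {a : Fin d → R} (hQ : QR a)
  (hJ : Ideal.span (Set.range a) ≤ maximalIdeal R) (i : Fin d)

/-- integral closure of the Rees algebra -/
noncomputable def AA (J : Ideal R) : Subalgebra (reesAlgebra J) R[X] := integralClosure (reesAlgebra J) R[X]

omit [IsLocalRing R] [IsNoetherianRing R] in
theorem mem_AA {J : Ideal R} {p : R[X]} : p ∈ AA J ↔ IsIntegral (reesAlgebra J) p := Iff.rfl

omit [IsLocalRing R] [IsNoetherianRing R] in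
theorem AA_crit0 (J : Ideal R) (x : R) (hx : x ∈ J) (s : Set R[X]) (hs : s.Finite) (hp : ∀ p ∈ s, p ∈ AA J) :
    ∃ c, ∀ q ∈ Algebra.adjoin (reesAlgebra J) s, C (x ^ c) * q ∈ reesAlgebra J := by
  have h := fg_adjoin_of_finite (R := reesAlgebra J) hs hp
  obtain ⟨S, hS⟩ := h
  -- bound degrees of generators
  let c := S.sup natDegree
  refine ⟨c, fun q hq => ?_⟩
  have hk : q ∈ Submodule.span (reesAlgebra J) (S : Set R[X]) := by
    rw [hS]
    exact hq
  refine Submodule.span_induction (p := fun q _ => C (x ^ c) * q ∈ reesAlgebra J) ?_ ?_ ?_ ?_ hk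
  · intro s hs n
    rw [coeff_C_mul]
    by_cases hn : n ≤ c
    · exact Ideal.mul_mem_right _ _ (Ideal.pow_le_pow_right hn (Ideal.pow_mem_pow hx c))
    · have : s.natDegree ≤ c := Finset.le_sup (f := natDegree) hs
      rw [coeff_eq_zero_of_natDegree_lt (by omega), mul_zero]; exact zero_mem _
  · rw [mul_zero]; exact zero_mem _
  · intro u v _ _ hu hv; rw [mul_add]; exact add_mem hu hv
  · intro r u _ hu
    rw [Algebra.smul_def, mul_left_comm]
    exact mul_mem r.2 hu

omit [IsLocalRing R] [IsNoetherianRing R] in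
theorem AA_crit1 (J : Ideal R) (x : R) (hx : x ∈ J) (p : R[X]) (hp : p ∈ AA J) :
    ∃ c, ∀ k, C (x ^ c) * p ^ k ∈ reesAlgebra J := by
  obtain ⟨c, hc⟩ := AA_crit0 J x hx {p} (Set.finite_singleton p) (by rintro _ rfl; exact hp)
  exact ⟨c, fun k => hc _ (pow_mem (Algebra.self_mem_adjoin_singleton _ p) k)⟩

include hQ hJ in
theorem AA_crit2 (p : R[X]) (c : ℕ)
    (h : ∀ k, C (a i ^ c) * p ^ k ∈ reesAlgebra (Ideal.span (Set.range a))) : p ∈ AA (Ideal.span (Set.range a)) := by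
  rw [mem_AA]
  set J := Ideal.span (Set.range a)
  let N : Submodule (reesAlgebra J) R[X] := Subalgebra.toSubmodule (Algebra.adjoin (reesAlgebra J) {p})
  have hN : ∀ q ∈ N, C (a i ^ c) * q ∈ reesAlgebra J := by
    intro q hq
    have hq : q ∈ Subalgebra.toSubmodule (Algebra.adjoin (reesAlgebra J) {p}) := hq
    rw [Algebra.adjoin_eq_span] at hq
    refine Submodule.span_induction (p := fun q _ => C (a i ^ c) * q ∈ reesAlgebra J) ?_ ?_ ?_ ?_ hq
    · intro q hq
      obtain ⟨k, rfl⟩ := Submonoid.mem_closure_singleton.mp hq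
      exact h k
    · rw [mul_zero]; exact zero_mem _
    · intro u v _ _ hu hv; rw [mul_add]; exact add_mem hu hv
    · intro r u _ hu
      rw [Algebra.smul_def, mul_left_comm]
      exact mul_mem r.2 hu
  let f : N →ₗ[reesAlgebra J] reesAlgebra J :=
    { toFun := fun q => ⟨C (a i ^ c) * q, hN q q.2⟩
      map_add' := by intro u v; apply Subtype.ext; simp [mul_add]
      map_smul' := by
        intro r u; apply Subtype.ext
        simp only [SetLike.val_smul, RingHom.id_apply, smul_eq_mul, MulMemClass.coe_mul, Algebra.smul_def]
        rw [mul_left_comm]; rfl }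
  have hf : Function.Injective f := by
    intro u v huv
    have h1 : C (a i ^ c) * (u : R[X]) = C (a i ^ c) * (v : R[X]) := congrArg Subtype.val huv
    have h2 : C (a i ^ c) * ((u : R[X]) - (v : R[X])) = 0 := by rw [mul_sub, h1, sub_self]
    exact Subtype.ext (sub_eq_zero.mp (a_nzd hQ hJ i c _ h2))
  have hNN : IsNoetherian (reesAlgebra J) N := isNoetherian_of_injective f hf
  exact isIntegral_of_submodule_noetherian _ hNN p (Algebra.self_mem_adjoin_singleton _ p)

/-- property P -/
theorem AA_cancel (hQ : QR a) (hJ : Ideal.span (Set.range a) ≤ maximalIdeal R) (i : Fin d)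
    {g : MvPolynomial (Fin d) R} (hg : g ∈ WW R d) (v : R[X]) (h : phi a g * v ∈ AA (Ideal.span (Set.range a))) :
    v ∈ AA (Ideal.span (Set.range a)) := by
  obtain ⟨c, hc⟩ := AA_crit1 _ (a i) (ai_mem a i) _ h
  refine AA_crit2 hQ hJ i v c fun k => ?_
  refine WW_cancel_rees hQ (Submonoid.pow_mem _ hg k) _ i ?_
  have := hc k
  rw [mul_pow, mul_left_comm] at this
  rwa [map_pow]

omit [IsLocalRing R] [IsNoetherianRing R] in
theorem rees_le_AA {J : Ideal R} {p : R[X]} (hp : p ∈ reesAlgebra J) : p ∈ AA J :=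
  Subalgebra.algebraMap_mem (AA J) ⟨p, hp⟩

/-- The normal filtration. -/
noncomputable def FF (J : Ideal R) (n : ℕ) : Ideal R where
  carrier := {x | monomial n x ∈ AA J}
  zero_mem' := by simp [zero_mem]
  add_mem' := by intro x y hx hy; simp only [Set.mem_ofPred_eq, map_add] at *; exact add_mem hx hy
  smul_mem' := by
    intro c x hx
    have h1 : (C c : R[X]) ∈ AA J := rees_le_AA (Subalgebra.algebraMap_mem (reesAlgebra J) c)
    have := mul_mem h1 hx
    rwa [C_mul_monomial] at this

omit [IsLocalRing R] [IsNoetherianRing R] in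
theorem mem_FF {J : Ideal R} {n : ℕ} {x : R} : x ∈ FF J n ↔ monomial n x ∈ AA J := Iff.rfl

omit [IsLocalRing R] [IsNoetherianRing R] in
theorem mul_mem_FF {J : Ideal R} {m n : ℕ} {x y : R} (hx : x ∈ FF J m) (hy : y ∈ FF J n) : x * y ∈ FF J (m + n) := by
  rw [mem_FF, ← monomial_mul_monomial]; exact mul_mem hx hy

omit [IsLocalRing R] [IsNoetherianRing R] in
theorem pow_mem_FF {J : Ideal R} {n : ℕ} {x : R} (hx : x ∈ FF J n) (k : ℕ) : x ^ k ∈ FF J (n * k) := by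
  rw [mem_FF, ← monomial_pow]; exact Subalgebra.pow_mem (AA J) (mem_FF.mp hx) k

omit [IsLocalRing R] [IsNoetherianRing R] in
theorem of_pow_mem_FF {J : Ideal R} {n k : ℕ} (hk : 0 < k) {x : R} (hx : x ^ k ∈ FF J (n * k)) : x ∈ FF J n := by
  rw [mem_FF, ← monomial_pow] at hx
  exact IsIntegral.of_pow hk hx

omit [IsLocalRing R] [IsNoetherianRing R] in
theorem pow_le_FF (J : Ideal R) (n : ℕ) : J ^ n ≤ FF J n := fun _ hx =>
  rees_le_AA (reesAlgebra.monomial_mem.mpr hx)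

omit [IsLocalRing R] [IsNoetherianRing R] in
theorem FF_mul_le (J : Ideal R) (m n : ℕ) : FF J m * FF J n ≤ FF J (m + n) :=
  Ideal.mul_le.mpr fun _ hx _ hy => mul_mem_FF hx hy

omit [IsLocalRing R] [IsNoetherianRing R] in
theorem FF_zero (J : Ideal R) : FF J 0 = ⊤ := top_le_iff.mp (by simpa using pow_le_FF J 0)

omit [IsLocalRing R] [IsNoetherianRing R] in
theorem FF_crit1 (J : Ideal R) (x : R) (hx : x ∈ J) {n : ℕ} {y : R} (hy : y ∈ FF J n) :
    ∃ c, ∀ k, x ^ c * y ^ k ∈ J ^ (n * k) := by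
  obtain ⟨c, hc⟩ := AA_crit1 J x hx _ hy
  refine ⟨c, fun k => ?_⟩
  have := hc k
  rwa [monomial_pow, C_mul_monomial, reesAlgebra.monomial_mem] at this

include hQ hJ in
theorem FF_crit2 {n : ℕ} {y : R} (c : ℕ) (h : ∀ k, a i ^ c * y ^ k ∈ Ideal.span (Set.range a) ^ (n * k)) :
    y ∈ FF (Ideal.span (Set.range a)) n := by
  refine AA_crit2 hQ hJ i _ c fun k => ?_
  rw [monomial_pow, C_mul_monomial, reesAlgebra.monomial_mem]
  exact h k

include hQ hJ i in
theorem FF_anti : Antitone (FF (Ideal.span (Set.range a))) := by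
  intro m n hmn y hy
  obtain ⟨c, hc⟩ := FF_crit1 _ (a i) (ai_mem a i) hy
  exact FF_crit2 hQ hJ i c fun k => Ideal.pow_le_pow_right (Nat.mul_le_mul_right k hmn) (hc k)

include hQ hJ i in
theorem AA_coeff (p : R[X]) (hp : p ∈ AA (Ideal.span (Set.range a))) (n : ℕ) :
    p.coeff n ∈ FF (Ideal.span (Set.range a)) n := by
  induction hs : p.support.card using Nat.strong_induction_on generalizing p with
  | _ N ih =>
    by_cases h0 : p = 0
    · subst h0; simp
    have hlead : p.leadingCoeff ∈ FF (Ideal.span (Set.range a)) p.natDegree := by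
      obtain ⟨c, hc⟩ := AA_crit1 _ (a i) (ai_mem a i) _ hp
      refine FF_crit2 hQ hJ i c fun k => ?_
      have := hc k (k * p.natDegree)
      rwa [coeff_C_mul, coeff_pow_mul_natDegree, mul_comm k] at this
    have h2 : p.eraseLead ∈ AA (Ideal.span (Set.range a)) := by
      have e : p.eraseLead = p - monomial p.natDegree p.leadingCoeff := by
        rw [eq_sub_iff_add_eq, eraseLead_add_monomial_natDegree_leadingCoeff]
      rw [e]; exact sub_mem hp hlead
    have h3 := ih _ (by rw [← hs]; exact eraseLead_support_card_lt h0) _ h2 rfl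
    by_cases hn : n = p.natDegree
    · subst hn; exact hlead
    · rwa [eraseLead_coeff_of_ne n hn] at h3

include hQ hJ i in
theorem AA_iff (p : R[X]) : p ∈ AA (Ideal.span (Set.range a)) ↔ ∀ n, p.coeff n ∈ FF (Ideal.span (Set.range a)) n := by
  refine ⟨fun h n => AA_coeff hQ hJ i p h n, fun h => ?_⟩
  rw [p.as_sum_support]
  exact sum_mem fun n _ => h n

include hQ hJ i in
/-- uniform bound -/
theorem FF_pow_bound (l : ℕ) : ∃ c, ∀ k, FF (Ideal.span (Set.range a)) l ^ k ≤ Ideal.span (Set.range a) ^ (l * k - c) := by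
  set J := Ideal.span (Set.range a)
  obtain ⟨S, hS⟩ := IsNoetherian.noetherian (FF J l)
  obtain ⟨c, hc⟩ := AA_crit0 J (a i) (ai_mem a i) (monomial l '' (S : Set R))
    (S.finite_toSet.image _) (by
      rintro _ ⟨s, hs, rfl⟩
      have : s ∈ FF J l := hS ▸ Submodule.subset_span hs
      exact this)
  have h1 : ∀ y ∈ FF J l, monomial l y ∈ Algebra.adjoin (reesAlgebra J) (monomial l '' (S : Set R)) := by
    intro y hy
    rw [← hS] at hy
    refine Submodule.span_induction (p := fun y _ => monomial l y ∈ Algebra.adjoin (reesAlgebra J) (monomial l '' (S : Set R))) ?_ ?_ ?_ ?_ hy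
    · intro s hs; exact Algebra.subset_adjoin ⟨s, hs, rfl⟩
    · rw [map_zero]; exact zero_mem _
    · intro u v _ _ hu hv; rw [map_add]; exact add_mem hu hv
    · intro r u _ hu
      have hr : (C r : R[X]) ∈ reesAlgebra J := Subalgebra.algebraMap_mem (reesAlgebra J) r
      have := mul_mem (Subalgebra.algebraMap_mem (Algebra.adjoin (reesAlgebra J) (monomial l '' (S : Set R))) ⟨_, hr⟩) hu
      rw [smul_eq_mul, ← C_mul_monomial]
      exact this
  have h2 : ∀ k, ∀ y ∈ FF J l ^ k, monomial (l * k) y ∈ Algebra.adjoin (reesAlgebra J) (monomial l '' (S : Set R)) := by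
    intro k
    induction k with
    | zero =>
      intro y _
      have hr : (C y : R[X]) ∈ reesAlgebra J := Subalgebra.algebraMap_mem (reesAlgebra J) y
      exact Subalgebra.algebraMap_mem (Algebra.adjoin (reesAlgebra J) (monomial l '' (S : Set R))) ⟨_, hr⟩
    | succ k ih =>
      intro y hy
      rw [pow_succ] at hy
      refine Submodule.mul_induction_on hy ?_ ?_
      · intro u hu v hv
        rw [mul_add, mul_one, ← monomial_mul_monomial]
        exact mul_mem (ih u hu) (h1 v hv)
      · intro u v hu hv; rw [map_add]; exact add_mem hu hv
  refine ⟨c, fun k y hy => ?_⟩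
  have h3 := hc _ (h2 k y hy)
  rw [C_mul_monomial, reesAlgebra.monomial_mem] at h3
  by_cases hk : c ≤ l * k
  · exact a_cancel hQ i c _ y (by rwa [Nat.add_sub_cancel' hk])
  · rw [Nat.sub_eq_zero_of_le (by omega)]; simp

end intcl
end NHC

namespace NHC
section
variable {R : Type*} [CommRing R]

theorem intg_AA (J : Ideal R) (p : R[X]) (m : ℕ) (c : ℕ → R[X]) (hc : ∀ j, c j ∈ AA J)
    (h : p ^ m = ∑ j ∈ range m, c j * p ^ j) : p ∈ AA J := by
  have h1 : IsIntegral (integralClosure (reesAlgebra J) R[X]) p :=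
    isIntegral_of_pow_eq p m (fun j => (⟨c j, hc j⟩ : integralClosure (reesAlgebra J) R[X])) h
  exact isIntegral_trans (R := reesAlgebra J) (A := integralClosure (reesAlgebra J) R[X]) _ h1

theorem intCl_le_FF (I J : Ideal R) (n : ℕ) (hI : ∀ m, I ^ m ≤ FF J m) : intCl (I ^ n) ≤ FF J n := by
  unfold intCl
  rw [Ideal.span_le]
  rintro x ⟨m, hm, b, hb, hx⟩
  refine intg_AA J (monomial n x : R[X]) m
    (fun j => monomial (n * (m - j)) (if (m - j) ∈ Finset.Icc 1 m then -b (m - j) else 0)) ?_ ?_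
  · intro j
    split_ifs with h
    · have := hb _ h
      rw [← pow_mul] at this
      exact hI _ (neg_mem this)
    · rw [map_zero]; exact zero_mem _
  · rw [monomial_pow]
    have e1 : ∀ j ∈ range m, monomial (n * (m - j)) (if (m - j) ∈ Finset.Icc 1 m then -b (m - j) else 0) * (monomial n x : R[X]) ^ j =
        monomial (n * m) (-(b (m - j) * x ^ j)) := by
      intro j hj
      have hj' := Finset.mem_range.mp hj
      rw [monomial_pow, if_pos (by rw [Finset.mem_Icc]; omega), monomial_mul_monomial, ← mul_add,
        Nat.sub_add_cancel hj'.le, neg_mul]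
    rw [Finset.sum_congr rfl e1, ← map_sum, Finset.sum_neg_distrib]
    congr 1
    rw [eq_neg_iff_add_eq_zero, ← hx]
    congr 1
    refine Finset.sum_bij' (fun j _ => m - j) (fun j _ => m - j) ?_ ?_ ?_ ?_ ?_
    · intro j hj; have := Finset.mem_range.mp hj; rw [Finset.mem_Icc]; omega
    · intro j hj; have := Finset.mem_Icc.mp hj; rw [Finset.mem_range]; omega
    · intro j hj; have := Finset.mem_range.mp hj; omega
    · intro j hj; have := Finset.mem_Icc.mp hj; omega
    · intro j hj; have := Finset.mem_range.mp hj; rw [show m - (m - j) = j by omega]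

theorem FF_integral (I J : Ideal R) (hJI : J ≤ I) (n : ℕ) (x : R) (hx : x ∈ FF J n) : IsIntegralOverIdeal (I ^ n) x := by
  obtain ⟨P, hP, hPx⟩ : IsIntegral (reesAlgebra J) (monomial n x : R[X]) := hx
  -- multiply by X to ensure positive degree
  set m := P.natDegree with hm
  have h1 : ∀ j ≤ m, ((algebraMap (reesAlgebra J) R[X] (P.coeff j)) * (monomial n x : R[X]) ^ j).coeff (n * m) =
      ((P.coeff j : reesAlgebra J) : R[X]).coeff (n * (m - j)) * x ^ j := by
    intro j hj
    rw [monomial_pow, show n * m = n * (m - j) + n * j by rw [← mul_add, Nat.sub_add_cancel hj], coeff_mul_monomial]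
    rfl
  rw [eval₂_eq_sum_range] at hPx
  have h2 := congrArg (fun q => q.coeff (n * m)) hPx
  simp only [finsetSum_coeff, coeff_zero] at h2
  rw [Finset.sum_congr rfl (fun j hj => h1 j (by have := Finset.mem_range.mp hj; omega)), Finset.sum_range_succ] at h2
  have h3 : (P.coeff m : reesAlgebra J) = 1 := hP
  rw [h3, Nat.sub_self, mul_zero] at h2
  have h4 : x ^ m + ∑ j ∈ range m, ((P.coeff j : reesAlgebra J) : R[X]).coeff (n * (m - j)) * x ^ j = 0 := by
    rw [← h2, add_comm]; simp; rfl
  have hc : ∀ j, ((P.coeff j : reesAlgebra J) : R[X]).coeff (n * (m - j)) ∈ (I ^ n) ^ (m - j) := by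
    intro j
    rw [← pow_mul]
    exact Ideal.pow_right_mono hJI _ ((P.coeff j).2 _)
  refine ⟨m + 1, by omega, fun j => if j = m + 1 then 0 else ((P.coeff (m - j) : reesAlgebra J) : R[X]).coeff (n * (m - (m - j))), ?_, ?_⟩
  · intro j hj
    have hj' := Finset.mem_Icc.mp hj
    simp only
    split_ifs with h
    · exact zero_mem _
    · have := hc (m - j)
      rwa [show m - (m - j) = j by omega] at this ⊢
  · rw [Finset.sum_Icc_succ_top (by omega)]
    beta_reduce
    rw [if_pos rfl, zero_mul, add_zero]
    have e3 : ∑ j ∈ range m, ((P.coeff j : reesAlgebra J) : R[X]).coeff (n * (m - j)) * x ^ j * x =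
        ∑ j ∈ Finset.Icc 1 m, (if j = m + 1 then 0 else ((P.coeff (m - j) : reesAlgebra J) : R[X]).coeff (n * (m - (m - j)))) * x ^ (m + 1 - j) := by
      refine Finset.sum_bij' (fun j _ => m - j) (fun j _ => m - j) ?_ ?_ ?_ ?_ ?_
      · intro j hj; have := Finset.mem_range.mp hj; rw [Finset.mem_Icc]; omega
      · intro j hj; have := Finset.mem_Icc.mp hj; rw [Finset.mem_range]; omega
      · intro j hj; have := Finset.mem_range.mp hj; omega
      · intro j hj; have := Finset.mem_Icc.mp hj; omega
      · intro j hj; have := Finset.mem_range.mp hj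
        rw [if_neg (by omega), show m - (m - j) = j by omega, show m + 1 - (m - j) = j + 1 by omega, pow_succ, mul_assoc]
    rw [← e3, ← Finset.sum_mul, pow_succ, ← add_mul, h4, zero_mul]

theorem FF_le_intCl (I J : Ideal R) (hJI : J ≤ I) (n : ℕ) : FF J n ≤ intCl (I ^ n) :=
  fun x hx => Ideal.subset_span (FF_integral I J hJI n x hx)

theorem intCl_eq_FF [IsLocalRing R] [IsNoetherianRing R] {d : ℕ} {a : Fin d → R} (hQ : QR a)
    (hJ : Ideal.span (Set.range a) ≤ maximalIdeal R) (i : Fin d)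
    (I : Ideal R) (hJI : Ideal.span (Set.range a) ≤ I) (N : ℕ)
    (hN : ∀ n ≥ N, I ^ (n + 1) = Ideal.span (Set.range a) * I ^ n) (n : ℕ) :
    intCl (I ^ n) = FF (Ideal.span (Set.range a)) n := by
  have hIN : ∀ k, I ^ (N + k) = Ideal.span (Set.range a) ^ k * I ^ N := by
    intro k
    induction k with
    | zero => simp
    | succ k ih => rw [← add_assoc, hN (N + k) (by omega), ih, pow_succ', mul_assoc]
  refine le_antisymm (intCl_le_FF I _ n ?_) (FF_le_intCl I _ hJI n)
  intro m y hy
  refine FF_crit2 hQ hJ i N fun k => ?_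
  have h1 : y ^ k ∈ I ^ (m * k) := by rw [pow_mul]; exact Ideal.pow_mem_pow hy k
  have ha : a i ^ N ∈ Ideal.span (Set.range a) ^ N := Ideal.pow_mem_pow (ai_mem a i) N
  by_cases hk : N ≤ m * k
  · obtain ⟨t, ht⟩ := Nat.exists_eq_add_of_le hk
    rw [ht, hIN] at h1
    rw [ht, pow_add]
    have h2 : y ^ k ∈ Ideal.span (Set.range a) ^ t := Ideal.mul_le_left h1
    exact Ideal.mul_mem_mul ha h2
  · exact Ideal.mul_mem_right _ _ (Ideal.pow_le_pow_right (by omega) ha)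
end
end NHC

namespace NHC
section
variable {R : Type*} [CommRing R] (I : Ideal R)

/-- an abstract completion -/
structure IsCompl (S : Type*) [CommRing S] [Algebra R S] (P : ℕ → Ideal S) : Prop where
  mem_iff : ∀ n (r : R), algebraMap R S r ∈ P n ↔ r ∈ I ^ n
  approx : ∀ (s : S) n, ∃ r : R, s - algebraMap R S r ∈ P n
  anti : Antitone P
  sep : ∀ s : S, (∀ n, s ∈ P n) → s = 0
  lim : ∀ r : ℕ → R, (∀ n, r (n + 1) - r n ∈ I ^ n) → ∃ s : S, ∀ n, s - algebraMap R S (r n) ∈ P n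

theorem isCompl_adic : IsCompl I (AdicCompletion I R) (fun n => RingHom.ker (AdicCompletion.evalₐ I n)) where
  mem_iff n r := by
    rw [RingHom.mem_ker, AdicCompletion.algebraMap_apply]
    simp only [Algebra.algebraMap_self, RingHom.id_apply]
    have : AdicCompletion.evalₐ I n (AdicCompletion.of I R r) = Ideal.Quotient.mk (I ^ n) r := by simp
    change AdicCompletion.evalₐ I n (AdicCompletion.of I R r) = 0 ↔ _
    rw [this, Ideal.Quotient.eq_zero_iff_mem]
  approx s n := by
    obtain ⟨r, hr⟩ := Ideal.Quotient.mk_surjective (AdicCompletion.evalₐ I n s)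
    refine ⟨r, ?_⟩
    rw [RingHom.mem_ker, map_sub, sub_eq_zero, ← hr, AlgHom.commutes]; rfl
  anti := by
    intro m n hmn s hs
    rw [RingHom.mem_ker] at hs ⊢
    obtain ⟨f, rfl⟩ := AdicCompletion.mk_surjective I R s
    rw [AdicCompletion.evalₐ_mk, Ideal.Quotient.eq_zero_iff_mem] at hs ⊢
    have := AdicCompletion.Ideal.mk_eq_mk I hmn f
    rw [Ideal.Quotient.eq] at this
    have h2 : f.1 n - f.1 m ∈ I ^ m := this
    have := sub_mem (Ideal.pow_le_pow_right hmn hs) h2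
    simpa using this
  sep s hs := by
    apply AdicCompletion.ext_evalₐ
    intro n
    rw [map_zero]
    exact hs n
  lim r hr := by
    refine ⟨AdicCompletion.mk I R (AdicCompletion.AdicCauchySequence.mk I R r ?_), ?_⟩
    · intro n
      rw [SModEq.sub_mem, smul_eq_mul, Ideal.mul_top, ← neg_mem_iff, neg_sub]
      exact hr n
    · intro n
      rw [RingHom.mem_ker, map_sub, AdicCompletion.evalₐ_mk, AlgHom.commutes, sub_eq_zero]
      rfl

variable {I} {S : Type*} [CommRing S] [Algebra R S] {P : ℕ → Ideal S} (h : IsCompl I S P)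
include h

theorem IsCompl.mul_mem {i j : ℕ} {s t : S} (hs : s ∈ P i) (ht : t ∈ P j) : s * t ∈ P (i + j) := by
  obtain ⟨r, hr⟩ := h.approx s (i + j)
  obtain ⟨r', hr'⟩ := h.approx t (i + j)
  have h1 : r ∈ I ^ i := by
    rw [← h.mem_iff]
    have := sub_mem hs (h.anti (Nat.le_add_right i j) hr)
    simpa using this
  have h2 : r' ∈ I ^ j := by
    rw [← h.mem_iff]
    have := sub_mem ht (h.anti (Nat.le_add_left j i) hr')
    simpa using this
  have h3 : algebraMap R S (r * r') ∈ P (i + j) := by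
    rw [h.mem_iff, pow_add]; exact Ideal.mul_mem_mul h1 h2
  have e : s * t = (s - algebraMap R S r) * t + algebraMap R S r * (t - algebraMap R S r') + algebraMap R S (r * r') := by
    rw [map_mul]; ring
  rw [e]
  exact add_mem (add_mem (Ideal.mul_mem_right _ _ hr) (Ideal.mul_mem_left _ _ hr')) h3

theorem IsCompl.lim' (s : ℕ → S) (hs : ∀ n, s (n + 1) - s n ∈ P n) : ∃ t : S, ∀ n, t - s n ∈ P n := by
  choose r hr using fun n => h.approx (s n) n
  obtain ⟨t, ht⟩ := h.lim r (by
    intro n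
    rw [← h.mem_iff, map_sub]
    have := sub_mem (add_mem (hs n) (hr n)) (h.anti (Nat.le_succ n) (hr (n + 1)))
    have e : s (n + 1) - s n + (s n - algebraMap R S (r n)) - (s (n + 1) - algebraMap R S (r (n + 1))) =
      algebraMap R S (r (n + 1)) - algebraMap R S (r n) := by ring
    rwa [← e])
  refine ⟨t, fun n => ?_⟩
  have := sub_mem (ht n) (hr n)
  have e : t - algebraMap R S (r n) - (s n - algebraMap R S (r n)) = t - s n := by ring
  rwa [e] at this

/-- Artin-Rees for a principal ideal of the completion. -/
theorem IsCompl.artinRees [IsNoetherianRing R] (y : S) :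
    ∃ c, ∀ n, ∀ s, y * s ∈ P n → ∃ t ∈ P (n - c), y * s = y * t := by
  let lead : I.Filtration R :=
    { N := fun n =>
        { carrier := {r | r ∈ I ^ n ∧ ∃ s, y * s - algebraMap R S r ∈ P (n + 1)}
          zero_mem' := ⟨zero_mem _, 0, by simp⟩
          add_mem' := by
            rintro r r' ⟨h1, s, hs⟩ ⟨h2, s', hs'⟩
            refine ⟨add_mem h1 h2, s + s', ?_⟩
            have := add_mem hs hs'
            rw [map_add]
            have e : y * (s + s') - (algebraMap R S r + algebraMap R S r') =
              y * s - algebraMap R S r + (y * s' - algebraMap R S r') := by ring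
            rwa [e]
          smul_mem' := by
            rintro c r ⟨h1, s, hs⟩
            refine ⟨Ideal.mul_mem_left _ _ h1, algebraMap R S c * s, ?_⟩
            have := Ideal.mul_mem_left _ (algebraMap R S c) hs
            rw [smul_eq_mul, map_mul]
            have e : y * (algebraMap R S c * s) - algebraMap R S c * algebraMap R S r =
              algebraMap R S c * (y * s - algebraMap R S r) := by ring
            rwa [e] }
      mono := by
        rintro n r ⟨h1, _⟩
        refine ⟨Ideal.pow_le_pow_right (Nat.le_succ n) h1, 0, ?_⟩
        rw [mul_zero, zero_sub, neg_mem_iff, h.mem_iff]; exact h1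
      smul_le := by
        intro n
        rw [Submodule.smul_le]
        rintro j hj r ⟨h1, s, hs⟩
        refine ⟨by rw [smul_eq_mul, pow_succ']; exact Ideal.mul_mem_mul hj h1, algebraMap R S j * s, ?_⟩
        have hj' : algebraMap R S j ∈ P 1 := by rw [h.mem_iff, pow_one]; exact hj
        have := h.mul_mem hj' hs
        rw [smul_eq_mul, map_mul]
        have e : y * (algebraMap R S j * s) - algebraMap R S j * algebraMap R S r =
          algebraMap R S j * (y * s - algebraMap R S r) := by ring
        rw [e]
        rwa [add_comm 1] at this }
  have hst : lead.Stable := by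
    refine Ideal.Filtration.Stable.of_le (I.stableFiltration_stable ⊤) ?_
    intro n r hr
    have : r ∈ I ^ n := hr.1
    change r ∈ I ^ n • (⊤ : Submodule R R)
    rw [smul_eq_mul, Ideal.mul_top]; exact this
  obtain ⟨c, hc⟩ := hst.exists_pow_smul_eq
  -- one step
  have step : ∀ k s, y * s ∈ P (c + k) → ∃ t ∈ P k, y * (s - t) ∈ P (c + k + 1) := by
    intro k s hs
    obtain ⟨r, hr⟩ := h.approx (y * s) (c + k + 1)
    have hr1 : r ∈ I ^ (c + k) := by
      rw [← h.mem_iff]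
      have := sub_mem hs (h.anti (Nat.le_succ _) hr)
      simpa using this
    have hrl : r ∈ lead.N (c + k) := ⟨hr1, s, hr⟩
    rw [hc] at hrl
    have key : ∀ r ∈ I ^ k • lead.N c, ∃ t ∈ P k, y * t - algebraMap R S r ∈ P (c + k + 1) := by
      intro r hr
      refine Submodule.smul_induction_on hr ?_ ?_
      · rintro j hj r ⟨_, s, hs⟩
        have hj' : algebraMap R S j ∈ P k := by rw [h.mem_iff]; exact hj
        refine ⟨algebraMap R S j * s, Ideal.mul_mem_right _ _ hj', ?_⟩
        have := h.mul_mem hj' hs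
        rw [smul_eq_mul, map_mul]
        have e : y * (algebraMap R S j * s) - algebraMap R S j * algebraMap R S r =
          algebraMap R S j * (y * s - algebraMap R S r) := by ring
        rw [e, show c + k + 1 = k + (c + 1) by ring]
        exact this
      · rintro r r' ⟨t, ht, h1⟩ ⟨t', ht', h2⟩
        refine ⟨t + t', add_mem ht ht', ?_⟩
        have := add_mem h1 h2
        rw [map_add]
        have e : y * (t + t') - (algebraMap R S r + algebraMap R S r') =
          y * t - algebraMap R S r + (y * t' - algebraMap R S r') := by ring
        rwa [e]
    obtain ⟨t, ht, h1⟩ := key r hrl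
    refine ⟨t, ht, ?_⟩
    have := sub_mem hr h1
    have e : y * (s - t) = y * s - algebraMap R S r - (y * t - algebraMap R S r) := by ring
    rwa [e]
  refine ⟨c, fun n s hs => ?_⟩
  by_cases hn : n ≤ c
  · refine ⟨s, ?_, rfl⟩
    rw [Nat.sub_eq_zero_of_le hn]
    obtain ⟨r, hr⟩ := h.approx s 0
    have h2 : algebraMap R S r ∈ P 0 := by rw [h.mem_iff]; simp
    simpa using add_mem hr h2
  obtain ⟨k, rfl⟩ := Nat.exists_eq_add_of_le (not_le.mp hn).le
  rw [Nat.add_sub_cancel_left]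
  choose! t ht hts using step
  -- remainders
  let rem : ℕ → S := fun i => Nat.rec s (fun i u => u - t (k + i) u) i
  have hrem0 : rem 0 = s := rfl
  have hremS : ∀ i, rem (i + 1) = rem i - t (k + i) (rem i) := fun i => rfl
  have hrem : ∀ i, y * rem i ∈ P (c + k + i) := by
    intro i
    induction i with
    | zero => exact hs
    | succ i ih =>
      rw [hremS]
      have := hts (k + i) (rem i) (by rw [← add_assoc]; exact ih)
      rwa [show c + (k + i) + 1 = c + k + (i + 1) by ring] at this
  have hd : ∀ i, rem i - rem (i + 1) ∈ P (k + i) := by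
    intro i
    rw [hremS, sub_sub_cancel]
    exact ht (k + i) (rem i) (by rw [← add_assoc]; exact hrem i)
  obtain ⟨z, hz⟩ := h.lim' rem (by
    intro n
    have := h.anti (show n ≤ k + n by omega) (hd n)
    rw [← neg_mem_iff, neg_sub]; exact this)
  refine ⟨s - z, ?_, ?_⟩
  · have h1 : ∀ i, s - rem i ∈ P k := by
      intro i
      induction i with
      | zero => rw [hrem0, sub_self]; exact zero_mem _
      | succ i ih =>
        have := add_mem ih (h.anti (show k ≤ k + i by omega) (hd i))
        simpa using this
    have := sub_mem (h1 k) (hz k)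
    simpa using this
  · have : y * z = 0 := by
      apply h.sep
      intro n
      have h1 := Ideal.mul_mem_left _ y (hz n)
      have h2 := h.anti (show n ≤ c + k + n by omega) (hrem n)
      have := add_mem h1 h2
      have e : y * (z - rem n) + y * rem n = y * z := by ring
      rwa [e] at this
    rw [mul_sub, this, sub_zero]

theorem IsCompl.eq_zero [IsNoetherianRing R] [IsReduced S] (x : S)
    (hx : ∀ l, ∃ C, ∀ k, x ^ k ∈ P (l * k - C)) : x = 0 := by
  obtain ⟨c, hc⟩ := h.artinRees (x ^ 2)
  have h1 : ∀ k n, x ^ (k + 2) ∈ P n → x ^ (k + 1) ∈ P (n - c) := by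
    intro k n hk
    obtain ⟨t, ht, e⟩ := hc n (x ^ k) (by rwa [← pow_add, add_comm])
    have e2 : x * (x ^ k - t) = 0 := by
      have : IsNilpotent (x * (x ^ k - t)) := ⟨2, by
        have : (x * (x ^ k - t)) ^ 2 = (x ^ 2 * x ^ k - x ^ 2 * t) * (x ^ k - t) := by ring
        rw [this, e, sub_self, zero_mul]⟩
      exact this.eq_zero
    have e3 : x ^ (k + 1) = x * t := by
      rw [pow_succ']; rw [mul_sub, sub_eq_zero] at e2; exact e2
    rw [e3]; exact Ideal.mul_mem_left _ _ ht
  have h2 : ∀ k n, x ^ (k + 1) ∈ P n → x ∈ P (n - k * c) := by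
    intro k
    induction k with
    | zero => intro n hn; simpa using hn
    | succ k ih =>
      intro n hn
      have := ih _ (h1 k n hn)
      rwa [Nat.sub_sub, show c + k * c = (k + 1) * c by ring] at this
  obtain ⟨C, hC⟩ := hx (c + 1)
  apply h.sep
  intro n
  have := h2 _ _ (hC (n + C + 1))
  refine h.anti ?_ this
  have e : (c + 1) * (n + C + 1) = (n + C) * c + (n + C) + c + 1 := by ring
  omega

end

theorem artin_of_pow_le {R : Type*} [CommRing R] [IsLocalRing R] [IsNoetherianRing R] (𝔟 : Ideal R) (k : ℕ)
    (h : maximalIdeal R ^ k ≤ 𝔟) : IsArtinianRing (R ⧸ 𝔟) :=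
  have : Ring.KrullDimLE 0 (R ⧸ 𝔟) := Ring.krullDimLE_zero_iff.mpr fun J prime ↦
    Ideal.isMaximal_of_isIntegral_of_isMaximal_comap (R := R) _ <| by
      have h1 : (J.comap (algebraMap R (R ⧸ 𝔟))).IsPrime := prime.comap _
      have h2 : 𝔟 ≤ J.comap (algebraMap R (R ⧸ 𝔟)) := fun x hx => by
        have : algebraMap R (R ⧸ 𝔟) x = 0 := Ideal.Quotient.eq_zero_iff_mem.mpr hx
        rw [Ideal.mem_comap, this]; exact zero_mem _
      have h3 := h1.le_of_pow_le (h.trans h2)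
      rw [← (maximalIdeal.isMaximal R).eq_of_le h1.ne_top h3]
      exact maximalIdeal.isMaximal R
  IsNoetherianRing.isArtinianRing_of_krullDimLE_zero

theorem chevalley {R : Type*} [CommRing R] [IsLocalRing R] [IsNoetherianRing R] (hAU : AnalyticallyUnramified R)
    (F : ℕ → Ideal R) (hF : Antitone F) (hb : ∀ l, ∃ C, ∀ k, F l ^ k ≤ maximalIdeal R ^ (l * k - C)) (n : ℕ) :
    ∃ l, F l ≤ maximalIdeal R ^ n := by
  set m := maximalIdeal R
  by_contra hcon
  push Not at hcon
  -- stabilization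
  have hst : ∀ k, ∃ l, ∀ l' ≥ l, F l ⊔ m ^ k = F l' ⊔ m ^ k := by
    intro k
    have hA : IsArtinianRing (R ⧸ m ^ k) := artin_of_pow_le _ k le_rfl
    let f : ℕ →o (Submodule (R ⧸ m ^ k) (R ⧸ m ^ k))ᵒᵈ :=
      ⟨fun l => OrderDual.toDual ((F l).map (Ideal.Quotient.mk (m ^ k))), fun i j hij => Ideal.map_mono (hF hij)⟩
    obtain ⟨l, hl⟩ := IsArtinian.monotone_stabilizes f
    refine ⟨l, fun l' hl' => ?_⟩
    have h1 : (F l).map (Ideal.Quotient.mk (m ^ k)) = (F l').map (Ideal.Quotient.mk (m ^ k)) := hl l' hl'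
    have h2 := congrArg (Ideal.comap (Ideal.Quotient.mk (m ^ k))) h1
    rw [Ideal.comap_map_of_surjective _ Ideal.Quotient.mk_surjective, Ideal.comap_map_of_surjective _ Ideal.Quotient.mk_surjective] at h2
    simpa [← RingHom.ker_eq_comap_bot, Ideal.mk_ker] using h2
  choose l hl using hst
  have hlall : ∀ k l', F (l k) ⊔ m ^ k ≤ F l' ⊔ m ^ k := by
    intro k l'
    by_cases h : l k ≤ l'
    · exact (hl k l' h).le
    · exact sup_le_sup_right (hF (not_le.mp h).le) _
  have hlift : ∀ k, ∀ x ∈ F (l k) ⊔ m ^ k, ∃ y ∈ F (l (k + 1)) ⊔ m ^ (k + 1), y - x ∈ m ^ k := by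
    intro k x hx
    have := hlall k (l (k + 1)) hx
    obtain ⟨y, hy, z, hz, rfl⟩ := Submodule.mem_sup.mp this
    exact ⟨y, Submodule.mem_sup_left hy, by simpa using hz⟩
  obtain ⟨x0, hx0, hx0n⟩ := SetLike.not_le_iff_exists.mp (hcon (l n))
  choose! g hg hg' using hlift
  let x : ℕ → R := fun i => Nat.rec x0 (fun i u => g (n + i) u) i
  have hx : ∀ i, x i ∈ F (l (n + i)) ⊔ m ^ (n + i) := by
    intro i
    induction i with
    | zero => exact Submodule.mem_sup_left hx0
    | succ i ih => exact hg _ _ ih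
  have hxd : ∀ i, x (i + 1) - x i ∈ m ^ (n + i) := fun i => hg' _ _ (hx i)
  have hcomp := isCompl_adic m
  have : IsReduced (AdicCompletion m R) := hAU
  obtain ⟨s, hs⟩ := hcomp.lim x (fun i => Ideal.pow_le_pow_right (by omega) (hxd i))
  have hs0 : s = 0 := by
    refine hcomp.eq_zero s fun L => ?_
    obtain ⟨C, hC⟩ := hb L
    refine ⟨C, fun k => ?_⟩
    have h1 := hs (L * k - C)
    set N := L * k - C
    have h2 : x N ∈ F L ⊔ m ^ N := by
      have := hlall _ L (hx N)
      have h6 : F L ⊔ m ^ (n + N) ≤ F L ⊔ m ^ N := sup_le_sup_left (Ideal.pow_le_pow_right (show N ≤ n + N by omega)) (F L)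
      exact h6 this
    have h3 : x N ^ k ∈ m ^ N := by
      obtain ⟨y, hy, z, hz, e⟩ := Submodule.mem_sup.mp h2
      have h4 : y ^ k ∈ m ^ N := hC k (Ideal.pow_mem_pow hy k)
      have h5 : x N ^ k - y ^ k ∈ m ^ N := by
        refine Ideal.mem_of_dvd _ (sub_dvd_pow_sub_pow _ _ k) ?_
        rw [← e]; simpa using hz
      simpa using add_mem h5 h4
    have h4 := (hcomp.mem_iff N _).mpr h3
    have h5 := Ideal.mem_of_dvd _ (sub_dvd_pow_sub_pow s (algebraMap R _ (x N)) k) h1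
    rw [map_pow] at h4
    simpa using add_mem h5 h4
  have h1 := hs n
  rw [hs0, zero_sub, neg_mem_iff, hcomp.mem_iff] at h1
  have h2 : ∀ i, x i - x0 ∈ m ^ n := by
    intro i
    induction i with
    | zero => change x0 - x0 ∈ _; simp
    | succ i ih =>
      have := add_mem ih (Ideal.pow_le_pow_right (show n ≤ n + i by omega) (hxd i))
      simpa using this
  exact hx0n (by simpa using sub_mem h1 (h2 n))

end NHC

namespace NHC
section
variable {R : Type*} [CommRing R] {M : Type*} [AddCommGroup M] [Module R M]

theorem length_add_one_le (N : Submodule R M) (v : M) (hv : v ∉ N) (P : Submodule R M) (hN : N ≤ P) (hvP : v ∈ P) :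
    Module.length R N + 1 ≤ Module.length R P := by
  have h := Module.length_eq_add_of_exact (Submodule.inclusion hN) (LinearMap.range (Submodule.inclusion hN)).mkQ
    (Submodule.inclusion_injective hN) (Submodule.mkQ_surjective _) (LinearMap.exact_map_mkQ_range _)
  rw [h]
  gcongr
  rw [Order.one_le_iff_pos, Module.length_pos_iff]
  refine Submodule.Quotient.nontrivial_iff.mpr ?_
  intro e
  have : (⟨v, hvP⟩ : P) ∈ LinearMap.range (Submodule.inclusion hN) := by rw [e]; trivial
  obtain ⟨⟨w, hw⟩, e⟩ := this
  have : w = v := congrArg Subtype.val e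
  exact hv (this ▸ hw)

theorem indep_card {ι : Type*} [LinearOrder ι] (s : Finset ι) (v : ι → M)
    (h : ∀ l ∈ s, v l ∉ Submodule.span R (v '' {j | j ∈ s ∧ j < l})) :
    (s.card : ℕ∞) ≤ Module.length R (Submodule.span R (v '' s)) := by
  induction s using Finset.induction_on_max with
  | empty => simp
  | insert l s hl ih =>
    have hls : l ∉ s := fun h => lt_irrefl _ (hl l h)
    rw [Finset.card_insert_of_notMem hls]
    push_cast
    have ih' := ih (fun j hj hc => h j (Finset.mem_insert_of_mem hj) (Submodule.span_mono (Set.image_mono (by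
      rintro i ⟨h1, h2⟩; exact ⟨Finset.mem_insert_of_mem h1, h2⟩)) hc))
    refine (add_le_add_left ih' 1).trans ?_
    refine length_add_one_le _ (v l) ?_ _ (Submodule.span_mono (Set.image_mono (by simp))) (Submodule.subset_span ⟨l, by simp, rfl⟩)
    intro hc
    refine h l (Finset.mem_insert_self _ _) (Submodule.span_mono (Set.image_mono ?_) hc)
    intro i hi
    exact ⟨Finset.mem_insert_of_mem hi, hl i hi⟩

theorem indep_card' {ι : Type*} [LinearOrder ι] (s : Finset ι) (v : ι → M)
    (h : ∀ l ∈ s, v l ∉ Submodule.span R (v '' {j | j ∈ s ∧ j < l})) :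
    (s.card : ℕ∞) ≤ Module.length R M :=
  (indep_card s v h).trans (Module.length_le_of_injective _ (Submodule.subtype_injective _))

theorem length_quot {K N : Submodule R M} (h : K ≤ N) :
    Module.length R (M ⧸ K) = Module.length R (N.map K.mkQ) + Module.length R (M ⧸ N) := by
  refine Module.length_eq_add_of_exact (N.map K.mkQ).subtype (Submodule.factor h) (Submodule.subtype_injective _)
    (Submodule.factor_surjective h) ?_
  rw [LinearMap.exact_iff, Submodule.range_subtype, Submodule.factor, Submodule.ker_mapQ, Submodule.comap_id]

theorem length_sum (F : ℕ → Submodule R M) (hF : Antitone F) (n : ℕ) :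
    Module.length R (M ⧸ F n) = ∑ j ∈ range n, Module.length R ((F j).map (F (j + 1)).mkQ) + Module.length R (M ⧸ F 0) := by
  induction n with
  | zero => simp
  | succ n ih => rw [length_quot (hF (Nat.le_succ n)), ih, Finset.sum_range_succ]; ring

theorem length_eq_of_ker {N P : Type*} [AddCommGroup N] [Module R N] [AddCommGroup P] [Module R P]
    (f : M →ₗ[R] N) (g : M →ₗ[R] P) (hf : Function.Surjective f) (hg : Function.Surjective g)
    (h : LinearMap.ker f = LinearMap.ker g) : Module.length R N = Module.length R P := by
  have e1 := (f.quotKerEquivOfSurjective hf).length_eq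
  have e2 := (g.quotKerEquivOfSurjective hg).length_eq
  rw [← e1, ← e2, h]
end

section
variable {R : Type*} [CommRing R] {d : ℕ} (a : Fin d → R)

theorem phi_homog {n : ℕ} {f : MvPolynomial (Fin d) R} (hf : f.IsHomogeneous n) :
    phi a f = monomial n (MvPolynomial.eval a f) := by
  rw [f.as_sum, map_sum, map_sum, map_sum]
  refine Finset.sum_congr rfl fun c hc => ?_
  rw [phi, MvPolynomial.aeval_monomial, MvPolynomial.eval_monomial]
  have hd : c.sum (fun _ e => e) = n := by
    have := hf (MvPolynomial.mem_support_iff.mp hc)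
    rw [← this]; simp [Finsupp.weight_apply]
  simp only [mul_pow, Finsupp.prod_mul]
  rw [← C_mul_X_pow_eq_monomial, map_mul, ← hd]
  simp only [Finsupp.prod, Finsupp.sum, map_prod, map_pow, Finset.prod_pow_eq_pow_sum, mul_assoc]
  rfl

theorem phi_coeff (n : ℕ) (f : MvPolynomial (Fin d) R) :
    (phi a f).coeff n = MvPolynomial.eval a (MvPolynomial.homogeneousComponent n f) := by
  conv_lhs => rw [← MvPolynomial.sum_homogeneousComponent f]
  rw [map_sum, finsetSum_coeff]
  simp_rw [phi_homog a (MvPolynomial.homogeneousComponent_isHomogeneous _ f), coeff_monomial]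
  rw [Finset.sum_ite_eq']
  split_ifs with h
  · rfl
  · have h' : f.totalDegree < n := by
      rw [Finset.mem_range] at h; omega
    rw [MvPolynomial.homogeneousComponent_eq_zero _ _ h', map_zero]

theorem homogComp_mem (𝔟 : Ideal R) (n : ℕ) (f : MvPolynomial (Fin d) R)
    (hf : f ∈ 𝔟.map (MvPolynomial.C (σ := Fin d))) :
    MvPolynomial.homogeneousComponent n f ∈ 𝔟.map (MvPolynomial.C (σ := Fin d)) := by
  rw [MvPolynomial.mem_map_C_iff] at hf ⊢
  intro c
  rw [MvPolynomial.coeff_homogeneousComponent]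
  split_ifs
  · exact hf c
  · exact zero_mem _

theorem lift_homog (𝔟 : Ideal R) (n : ℕ) (x : R) (hx : x ∈ 𝔟 * Ideal.span (Set.range a) ^ n) :
    ∃ f : MvPolynomial (Fin d) R, f.IsHomogeneous n ∧ f ∈ 𝔟.map (MvPolynomial.C (σ := Fin d)) ∧ MvPolynomial.eval a f = x := by
  obtain ⟨f, hf, e⟩ := phi_lift2 a 𝔟 n x hx
  refine ⟨MvPolynomial.homogeneousComponent n f, MvPolynomial.homogeneousComponent_isHomogeneous _ f, homogComp_mem 𝔟 n f hf, ?_⟩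
  rw [← phi_coeff, e, coeff_monomial_same]

theorem lift_homog1 (n : ℕ) (x : R) (hx : x ∈ Ideal.span (Set.range a) ^ n) :
    ∃ f : MvPolynomial (Fin d) R, f.IsHomogeneous n ∧ MvPolynomial.eval a f = x := by
  obtain ⟨f, h1, -, h2⟩ := lift_homog a ⊤ n x (by simpa using hx)
  exact ⟨f, h1, h2⟩

theorem eval_homog_mem {n : ℕ} {f : MvPolynomial (Fin d) R} (hf : f.IsHomogeneous n) :
    MvPolynomial.eval a f ∈ Ideal.span (Set.range a) ^ n := by
  have := phi_mem_rees a f n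
  rwa [phi_homog a hf, coeff_monomial_same] at this

variable {a} (hQ : QR a)
include hQ

theorem homog_mem (𝔟 : Ideal R) (hb : Ideal.span (Set.range a) ≤ 𝔟) {n : ℕ} {f : MvPolynomial (Fin d) R} (hf : f.IsHomogeneous n)
    (h : MvPolynomial.eval a f ∈ 𝔟 * Ideal.span (Set.range a) ^ n) : f ∈ 𝔟.map (MvPolynomial.C (σ := Fin d)) := by
  refine hQ.gen 𝔟 hb f fun k => ?_
  rw [phi_homog a hf, coeff_monomial]
  split_ifs with e
  · rw [← e]; exact h
  · exact zero_mem _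

theorem length_gr (𝔟 : Ideal R) (hb : Ideal.span (Set.range a) ≤ 𝔟) (n : ℕ) :
    Module.length R (Submodule.map (Submodule.mkQ (𝔟 * Ideal.span (Set.range a) ^ n)) (Ideal.span (Set.range a) ^ n)) =
      ((d + n - 1).choose n : ℕ) * Module.length R (R ⧸ 𝔟) := by
  set J := Ideal.span (Set.range a)
  let ι := {c // c ∈ (Finset.univ : Finset (Fin d)).finsuppAntidiag n}
  have hι : ENat.card ι = ((d + n - 1).choose n : ℕ) := by
    rw [ENat.card_eq_coe_fintype_card, Fintype.card_coe, Finset.card_finsuppAntidiag_nat_eq_choose]; simp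
  have hdeg : ∀ c : Fin d →₀ ℕ, c ∈ (Finset.univ : Finset (Fin d)).finsuppAntidiag n ↔ c.degree = n := by
    intro c
    rw [Finset.mem_finsuppAntidiag, Finsupp.degree_eq_sum]; simp
  rw [← hι, ← Module.length_pi]
  let poly : (ι → R) →ₗ[R] MvPolynomial (Fin d) R := ∑ c : ι, (MvPolynomial.monomial c.1).comp (LinearMap.proj c)
  have hpoly : ∀ r, poly r = ∑ c : ι, MvPolynomial.monomial c.1 (r c) := by
    intro r; simp [poly, LinearMap.sum_apply]
  have hhom : ∀ r, (poly r).IsHomogeneous n := by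
    intro r
    rw [hpoly]
    refine MvPolynomial.IsHomogeneous.sum _ _ _ fun c _ => ?_
    exact MvPolynomial.isHomogeneous_monomial _ ((hdeg _).mp c.2)
  have hcoeff : ∀ r (c : ι), (poly r).coeff c.1 = r c := by
    intro r c
    rw [hpoly, MvPolynomial.coeff_sum]
    simp only [MvPolynomial.coeff_monomial]
    rw [Finset.sum_eq_single c]
    · simp
    · intro b _ hbc; rw [if_neg]; intro e; exact hbc (Subtype.ext e)
    · simp
  let ev : MvPolynomial (Fin d) R →ₗ[R] R := (MvPolynomial.aeval a).toLinearMap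
  have hev : ∀ f, ev f = MvPolynomial.eval a f := fun f => by
    change MvPolynomial.aeval a f = _
    rw [MvPolynomial.aeval_def, MvPolynomial.eval₂_eq_eval_map]; exact congrArg _ (MvPolynomial.map_id f)
  let Θ : (ι → R) →ₗ[R] (Submodule.map (Submodule.mkQ (𝔟 * J ^ n)) (J ^ n)) :=
    LinearMap.codRestrict (Submodule.map (Submodule.mkQ (𝔟 * J ^ n)) (J ^ n)) ((Submodule.mkQ (𝔟 * J ^ n)).comp (ev.comp poly)) (fun r => by
      refine Submodule.mem_map_of_mem (f := Submodule.mkQ (𝔟 * J ^ n)) ?_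
      rw [LinearMap.comp_apply, hev]
      exact eval_homog_mem a (hhom r))
  let Ξ : (ι → R) →ₗ[R] (ι → R ⧸ 𝔟) := LinearMap.pi fun c => (Submodule.mkQ 𝔟).comp (LinearMap.proj c)
  refine length_eq_of_ker Θ Ξ ?_ ?_ ?_
  · rintro ⟨_, x, hx, rfl⟩
    obtain ⟨f, hf, rfl⟩ := lift_homog1 a n x hx
    refine ⟨fun c => f.coeff c.1, Subtype.ext ?_⟩
    change Submodule.mkQ (𝔟 * J ^ n) (ev (poly _)) = Submodule.mkQ (𝔟 * J ^ n) (MvPolynomial.eval a f)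
    rw [hev]
    have hpf : poly (fun c => f.coeff c.1) = f := ?_
    · rw [hpf]
    ext c
    by_cases hc : c ∈ (Finset.univ : Finset (Fin d)).finsuppAntidiag n
    · exact hcoeff _ ⟨c, hc⟩
    · rw [hdeg] at hc
      rw [(hhom _).coeff_eq_zero hc, hf.coeff_eq_zero hc]
  · intro y
    choose r hr using fun c => Submodule.mkQ_surjective 𝔟 (y c)
    exact ⟨r, funext hr⟩
  · ext r
    rw [LinearMap.mem_ker, LinearMap.mem_ker]
    have h1 : Θ r = 0 ↔ MvPolynomial.eval a (poly r) ∈ 𝔟 * J ^ n := by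
      rw [← hev, Subtype.ext_iff]
      change Submodule.mkQ _ (ev (poly _)) = 0 ↔ _
      rw [Submodule.mkQ_apply, Submodule.Quotient.mk_eq_zero]
    have h2 : Ξ r = 0 ↔ ∀ c, r c ∈ 𝔟 := by
      rw [funext_iff]
      refine forall_congr' fun c => ?_
      change Submodule.mkQ _ (r c) = 0 ↔ _
      rw [Submodule.mkQ_apply, Submodule.Quotient.mk_eq_zero]
    rw [h1, h2]
    constructor
    · intro h c
      have := homog_mem hQ 𝔟 hb (hhom r) h
      rw [MvPolynomial.mem_map_C_iff] at this
      rw [← hcoeff r c]; exact this _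
    · intro h
      have : poly r ∈ 𝔟.map (MvPolynomial.C (σ := Fin d)) := by
        rw [hpoly]
        refine sum_mem fun c _ => ?_
        rw [MvPolynomial.mem_map_C_iff]
        intro c'
        rw [MvPolynomial.coeff_monomial]
        split_ifs
        · exact h c
        · exact zero_mem _
      have := phi_mem a 𝔟 _ this n
      rwa [phi_homog a (hhom r), coeff_monomial_same] at this

end
end NHC

namespace NHC
section
variable {R : Type*} [CommRing R] [IsLocalRing R] [IsNoetherianRing R] {d : ℕ} {a : Fin d → R} (hQ : QR a)
  (hJ : Ideal.span (Set.range a) ≤ maximalIdeal R) (i : Fin d)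

/-- polynomials with coefficients in the filtration -/
def filtPoly {R : Type*} [CommRing R] (F : ℕ → Ideal R) : Submodule R R[X] where
  carrier := {p | ∀ n, p.coeff n ∈ F n}
  zero_mem' := by intro n; simp
  add_mem' := by intro p q hp hq n; rw [coeff_add]; exact add_mem (hp n) (hq n)
  smul_mem' := by intro r p hp n; rw [coeff_smul, smul_eq_mul]; exact Ideal.mul_mem_left _ _ (hp n)

/-- the map to the truncated associated graded -/
noncomputable def grMap {R : Type*} [CommRing R] (F : ℕ → Ideal R) (n : ℕ) :
    filtPoly F →ₗ[R] ((j : Fin (n + 1)) → Submodule.map (Submodule.mkQ (F (j + 1))) (F j)) :=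
  LinearMap.pi fun j => LinearMap.codRestrict (Submodule.map (Submodule.mkQ (F (j + 1))) (F j))
    ((Submodule.mkQ (F (j + 1))).comp ((Polynomial.lcoeff R j).comp (filtPoly F).subtype))
    (fun p => Submodule.mem_map_of_mem (f := Submodule.mkQ (F (j + 1))) (p.2 j))

theorem grMap_eq_zero {R : Type*} [CommRing R] (F : ℕ → Ideal R) (n : ℕ) (p : filtPoly F) (h : grMap F n p = 0) (j : ℕ) (hj : j ≤ n) :
    (p : R[X]).coeff j ∈ F (j + 1) := by
  have := congrArg Subtype.val (congrFun h ⟨j, Nat.lt_succ_of_le hj⟩)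
  change Submodule.mkQ (F (j + 1)) ((p : R[X]).coeff j) = 0 at this
  rwa [Submodule.mkQ_apply, Submodule.Quotient.mk_eq_zero] at this

theorem length_gr_trunc {R : Type*} [CommRing R] (F : ℕ → Ideal R) (hF : Antitone F) (h0 : F 0 = ⊤) (n : ℕ) :
    Module.length R ((j : Fin (n + 1)) → Submodule.map (Submodule.mkQ (F (j + 1))) (F j)) = Module.length R (R ⧸ F (n + 1)) := by
  rw [Module.length_pi_of_fintype, length_sum (M := R) F hF (n + 1)]
  have : Subsingleton (R ⧸ F 0) := by rw [h0]; exact Submodule.Quotient.subsingleton_iff.mpr rfl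
  rw [Module.length_eq_zero (M := R ⧸ F 0), add_zero]
  exact Fin.sum_univ_eq_sum_range (fun j => Module.length R (Submodule.map (Submodule.mkQ (F (j + 1))) (F j))) (n + 1)

include hQ hJ i in
theorem growth (C : ℕ) (hC : ∀ n, Module.length R (R ⧸ FF (Ideal.span (Set.range a)) (n + 1)) ≤ ((C * (n + 1) ^ d : ℕ) : ℕ∞))
    (y : ℕ → R[X]) (hy : ∀ j, y j ∈ AA (Ideal.span (Set.range a))) :
    ∃ k ≤ C * (d + 1) ^ d, ∃ g ∈ WW R d, ∃ r : ℕ → MvPolynomial (Fin d) R,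
      ∀ n, (phi a g * y k - ∑ j ∈ range k, phi a (r j) * y j).coeff n ∈ FF (Ideal.span (Set.range a)) (n + 1) := by
  classical
  set J := Ideal.span (Set.range a) with hJdef
  set e := C * (d + 1) ^ d with he
  by_contra hcon
  push Not at hcon
  let B := (range (e + 1)).sup fun j => (y j).natDegree
  have hB : ∀ j ≤ e, (y j).natDegree ≤ B := fun j hj => Finset.le_sup (f := fun j => (y j).natDegree) (by simp; omega)
  let n := B + d * B
  let ex : Fin ((B + 1) ^ d) → (Fin d →₀ ℕ) := fun c => Finsupp.equivFunOnFinite.symm (fun i => (finFunctionFinEquiv.symm c i : ℕ))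
  have hexinj : Function.Injective ex := by
    intro c c' h
    have h1 := Finsupp.equivFunOnFinite.symm.injective h
    apply finFunctionFinEquiv.symm.injective
    funext i
    exact Fin.ext (congrFun h1 i)
  have hexdeg : ∀ c, (ex c).degree ≤ d * B := by
    intro c
    rw [Finsupp.degree_eq_sum]
    calc ∑ i, ex c i ≤ ∑ i : Fin d, B := Finset.sum_le_sum fun i _ => Nat.lt_succ_iff.mp (finFunctionFinEquiv.symm c i).2
      _ = d * B := by simp
  let mon : Fin ((B + 1) ^ d) → MvPolynomial (Fin d) R := fun c => MvPolynomial.monomial (ex c) 1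
  have hmonh : ∀ c, (mon c).IsHomogeneous (ex c).degree := fun c => MvPolynomial.isHomogeneous_monomial _ rfl
  have hphideg : ∀ c, (phi a (mon c)).natDegree ≤ d * B := by
    intro c
    rw [phi_homog a (hmonh c)]
    exact (natDegree_monomial_le _).trans (hexdeg c)
  have hphiA : ∀ g, phi a g ∈ AA J := fun g => rees_le_AA (phi_mem_rees a g)
  let ι := Fin (e + 1) ×ₗ Fin ((B + 1) ^ d)
  let x : ι → R[X] := fun l => phi a (mon (ofLex l).2) * y (ofLex l).1
  have hxA : ∀ l, x l ∈ AA J := fun l => mul_mem (hphiA _) (hy _)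
  have hxF : ∀ l, x l ∈ filtPoly (FF J) := fun l n => (AA_iff hQ hJ i _).mp (hxA l) n
  have hxdeg : ∀ l, (x l).natDegree ≤ n := by
    intro l
    refine natDegree_mul_le.trans ?_
    have := hB (ofLex l).1 (Nat.lt_succ_iff.mp (ofLex l).1.2)
    have := hphideg (ofLex l).2
    omega
  let v := fun l => grMap (FF J) n ⟨x l, hxF l⟩
  have key := indep_card' (R := R) (Finset.univ : Finset ι) v (by
    intro l _ hl
    rw [Finsupp.mem_span_image_iff_linearCombination] at hl
    obtain ⟨c, hc, hcl⟩ := hl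
    rw [Finsupp.linearCombination_apply, Finsupp.sum_fintype _ _ (by simp)] at hcl
    have hcz : ∀ j, ¬ j < l → c j = 0 := by
      intro j hj
      by_contra h
      exact hj (hc (Finsupp.mem_support_iff.mpr h)).2
    -- relation
    let z : filtPoly (FF J) := ⟨x l, hxF l⟩ - ∑ j, c j • ⟨x j, hxF j⟩
    have hz : grMap (FF J) n z = 0 := by
      simp only [z, map_sub, map_sum, map_smul]
      rw [sub_eq_zero]; exact hcl.symm
    have hzval : (z : R[X]) = x l - ∑ j, c j • x j := by
      simp [z]
    have hzdeg : (z : R[X]).natDegree ≤ n := by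
      rw [hzval]
      refine (natDegree_sub_le _ _).trans (max_le (hxdeg l) ?_)
      exact natDegree_sum_le_of_forall_le _ _ fun j _ => (natDegree_smul_le _ _).trans (hxdeg j)
    have hzF : ∀ m, (z : R[X]).coeff m ∈ FF J (m + 1) := by
      intro m
      by_cases hm : m ≤ n
      · exact grMap_eq_zero _ n z hz m hm
      · rw [coeff_eq_zero_of_natDegree_lt (by omega)]; exact zero_mem _
    let r : ℕ → MvPolynomial (Fin d) R := fun j => if h : j < e + 1 then
      ∑ b, MvPolynomial.C (c (toLex (⟨j, h⟩, b))) * mon b else 0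
    set k := (ofLex l).1 with hk
    set cl := (ofLex l).2 with hcl'
    have hk' : (k : ℕ) ≤ e := Nat.lt_succ_iff.mp k.2
    have hsum : ∑ j, c j • x j = ∑ j ∈ range (k + 1), phi a (r j) * y j := by
      have e1 : ∑ j, c j • x j = ∑ p : Fin (e + 1) × Fin ((B + 1) ^ d), c (toLex p) • x (toLex p) :=
        (Fintype.sum_equiv toLex _ _ (fun p => rfl)).symm
      rw [e1, Fintype.sum_prod_type]
      have e2 : ∀ j : Fin (e + 1), ∑ b, c (toLex (j, b)) • x (toLex (j, b)) = phi a (r j) * y j := by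
        intro j
        simp only [r, dif_pos j.2, map_sum, map_mul, phi_C, Finset.sum_mul]
        refine Finset.sum_congr rfl fun b _ => ?_
        change c (toLex (j, b)) • (phi a (mon b) * y j) = _
        rw [smul_eq_C_mul]; ring
      rw [Finset.sum_congr rfl fun j _ => e2 j, Fin.sum_univ_eq_sum_range (fun j => phi a (r j) * y j)]
      symm
      refine Finset.sum_subset (by intro q; simp; omega) ?_
      intro j hj hj'
      have hj1 : j < e + 1 := by simpa using hj
      have hj2 : (k : ℕ) < j := by simp at hj'; omega
      have : r j = 0 := by
        simp only [r, dif_pos hj1]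
        refine Finset.sum_eq_zero fun b _ => ?_
        rw [hcz, map_zero, zero_mul]
        rw [Prod.Lex.lt_iff]
        rintro (h | ⟨h, _⟩)
        · have : j < k := h
          omega
        · have : j = k := congrArg Fin.val h
          omega
      rw [this, map_zero, zero_mul]
    have hg : mon cl - r k ∈ WW R d := by
      rw [mem_WW_iff]
      refine ⟨ex cl, ?_⟩
      have : (r k).coeff (ex cl) = 0 := by
        simp only [r, dif_pos k.2, MvPolynomial.coeff_sum, MvPolynomial.coeff_C_mul, mon, MvPolynomial.coeff_monomial]
        refine Finset.sum_eq_zero fun b _ => ?_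
        split_ifs with h
        · have hb : b = cl := hexinj h
          rw [hcz, zero_mul]
          rw [hb]
          exact lt_irrefl l
        · rw [mul_zero]
      rw [MvPolynomial.coeff_sub, this, sub_zero]
      simp [mon]
    obtain ⟨m, hm⟩ := hcon k hk' _ hg r
    apply hm
    have := hzF m
    rw [hzval, hsum, Finset.sum_range_succ] at this
    convert this using 2
    simp only [x, map_sub]
    ring)
  rw [length_gr_trunc _ (FF_anti hQ hJ i) (FF_zero J)] at key
  have h2 := key.trans (hC n)
  have hcard : (Finset.univ : Finset ι).card = (e + 1) * (B + 1) ^ d := by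
    rw [Finset.card_univ]
    change Fintype.card (Fin (e + 1) × Fin ((B + 1) ^ d)) = _
    simp
  rw [hcard] at h2
  have h3 : (e + 1) * (B + 1) ^ d ≤ C * (n + 1) ^ d := by exact_mod_cast h2
  have h4 : n + 1 ≤ (d + 1) * (B + 1) := by simp only [n]; nlinarith
  have h5 : C * (n + 1) ^ d ≤ e * (B + 1) ^ d := by
    rw [he, mul_assoc, ← mul_pow]
    gcongr
  have h6 : 0 < (B + 1) ^ d := by positivity
  nlinarith
end
end NHC

namespace NHC
section
variable {R : Type*} [CommRing R] [IsLocalRing R] {d : ℕ} {a : Fin d → R}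
  [Algebra (MvPolynomial (Fin d) R) R[X]] (hal : ∀ g, algebraMap (MvPolynomial (Fin d) R) R[X] g = phi a g)
  (A : Subalgebra (MvPolynomial (Fin d) R) R[X]) (hA : ∀ p, p ∈ A ↔ p ∈ AA (Ideal.span (Set.range a)))
  (K : Ideal A) (hK : ∀ p : A, p ∈ K ↔ ∀ n, (p : R[X]).coeff n ∈ FF (Ideal.span (Set.range a)) (n + 1))
  (hm : ∃ k, maximalIdeal R ^ k ≤ Ideal.span (Set.range a))
  (𝔭 : Ideal A)

include hal in
theorem algMapA (g : MvPolynomial (Fin d) R) : ((algebraMap (MvPolynomial (Fin d) R) A g : A) : R[X]) = phi a g := hal g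

include hal hK hm in
theorem C_mem_prime [𝔭.IsPrime] (hKp : K ≤ 𝔭) (r : R) (hr : r ∈ maximalIdeal R) :
    algebraMap (MvPolynomial (Fin d) R) A (MvPolynomial.C r) ∈ 𝔭 := by
  obtain ⟨k, hk⟩ := hm
  refine Ideal.IsPrime.mem_of_pow_mem ‹_› k (hKp ?_)
  rw [hK, ← map_pow, algMapA hal, ← map_pow, phi_C]
  intro n
  rw [coeff_C]
  split_ifs with h
  · subst h
    refine pow_le_FF _ 1 ?_
    rw [pow_one]
    exact hk (Ideal.pow_mem_pow hr k)
  · exact zero_mem _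

include hal hK hm in
theorem exists_psi [𝔭.IsPrime] (hKp : K ≤ 𝔭) : ∃ ψ : MvPolynomial (Fin d) (ResidueField R) →+* A ⧸ 𝔭,
    ∀ g, ψ (MvPolynomial.map (residue R) g) = Ideal.Quotient.mk 𝔭 (algebraMap _ A g) := by
  let ψ0 : ResidueField R →+* A ⧸ 𝔭 := Ideal.Quotient.lift (maximalIdeal R)
    ((Ideal.Quotient.mk 𝔭).comp ((algebraMap (MvPolynomial (Fin d) R) A).comp MvPolynomial.C)) (by
      intro r hr
      exact Ideal.Quotient.eq_zero_iff_mem.mpr (C_mem_prime hal A K hK hm 𝔭 hKp r hr))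
  refine ⟨MvPolynomial.eval₂Hom ψ0 (fun i => Ideal.Quotient.mk 𝔭 (algebraMap (MvPolynomial (Fin d) R) A (MvPolynomial.X i))), fun g => ?_⟩
  have : ((MvPolynomial.eval₂Hom ψ0 (fun i => Ideal.Quotient.mk 𝔭 (algebraMap (MvPolynomial (Fin d) R) A (MvPolynomial.X i)))).comp
      (MvPolynomial.map (residue R))) = (Ideal.Quotient.mk 𝔭).comp (algebraMap (MvPolynomial (Fin d) R) A) := by
    apply MvPolynomial.ringHom_ext
    · intro r
      simp only [RingHom.comp_apply, MvPolynomial.map_C, MvPolynomial.coe_eval₂Hom, MvPolynomial.eval₂_C]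
      rfl
    · intro i
      simp
  exact DFunLike.congr_fun this g

theorem psi_inj (hW : ∀ w ∈ WW R d, algebraMap (MvPolynomial (Fin d) R) A w ∉ 𝔭) (ψ : MvPolynomial (Fin d) (ResidueField R) →+* A ⧸ 𝔭)
    (hψ : ∀ g, ψ (MvPolynomial.map (residue R) g) = Ideal.Quotient.mk 𝔭 (algebraMap _ A g)) : Function.Injective ψ := by
  rw [injective_iff_map_eq_zero]
  intro h hh
  obtain ⟨g, rfl⟩ := MvPolynomial.map_surjective (residue R) residue_surjective h
  by_contra h0
  refine hW g (mem_WW.mpr h0) ?_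
  rwa [hψ, Ideal.Quotient.eq_zero_iff_mem] at hh

include hal hA in
theorem psi_int (ψ : MvPolynomial (Fin d) (ResidueField R) →+* A ⧸ 𝔭)
    (hψ : ∀ g, ψ (MvPolynomial.map (residue R) g) = Ideal.Quotient.mk 𝔭 (algebraMap _ A g)) : ψ.IsIntegral := by
  intro y
  obtain ⟨⟨p, hp⟩, rfl⟩ := Ideal.Quotient.mk_surjective y
  obtain ⟨P, hP, hPx⟩ := (hA p).mp hp
  choose g hg using fun q : reesAlgebra (Ideal.span (Set.range a)) => phi_lift_rees a q.1 q.2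
  letI : Algebra (MvPolynomial (Fin d) (ResidueField R)) (A ⧸ 𝔭) := @RingHom.toAlgebra _ (A ⧸ 𝔭) _ (Ideal.Quotient.commRing 𝔭).toCommSemiring ψ
  change IsIntegral (MvPolynomial (Fin d) (ResidueField R)) _
  refine isIntegral_of_pow_eq _ P.natDegree (fun j => MvPolynomial.map (residue R) (- g (P.coeff j))) ?_
  change _ = ∑ j ∈ range P.natDegree, ψ _ * _
  simp only [hψ, ← map_pow, ← map_mul, ← map_sum]
  congr 1
  apply Subtype.ext
  rw [eval₂_eq_sum_range, Finset.sum_range_succ, hP.coeff_natDegree, map_one, one_mul] at hPx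
  push_cast
  change p ^ P.natDegree = _
  rw [eq_neg_of_add_eq_zero_right hPx, ← Finset.sum_neg_distrib]
  refine Finset.sum_congr rfl fun j _ => ?_
  rw [hal, hg, neg_mul]
  rfl

include hal hA hK hm in
theorem h5_noeth [IsNoetherianRing R] [𝔭.IsPrime] (hKp : K ≤ 𝔭) (hW : ∀ w ∈ WW R d, algebraMap (MvPolynomial (Fin d) R) A w ∉ 𝔭) (e : ℕ)
    (h3 : ∀ y : ℕ → A, ∃ k ≤ e, ∃ g ∈ WW R d, ∃ r : ℕ → MvPolynomial (Fin d) R, g • y k - ∑ i ∈ range k, r i • y i ∈ K) :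
    IsNoetherian (MvPolynomial (Fin d) R) (A ⧸ 𝔭) := by
  obtain ⟨ψ, hψ⟩ := exists_psi hal A K hK hm 𝔭 hKp
  letI : Algebra (MvPolynomial (Fin d) (ResidueField R)) (A ⧸ 𝔭) := @RingHom.toAlgebra _ (A ⧸ 𝔭) _ (Ideal.Quotient.commRing 𝔭).toCommSemiring ψ
  haveI : Algebra.IsIntegral (MvPolynomial (Fin d) (ResidueField R)) (A ⧸ 𝔭) := ⟨psi_int hal A hA 𝔭 ψ hψ⟩
  have hN := N2dom (Fin d) (A ⧸ 𝔭) (psi_inj A 𝔭 hW ψ hψ) e (by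
    intro s hs
    by_contra hcard
    push Not at hcard
    let y : ℕ → A := fun j => if h : j < s.card then (Ideal.Quotient.mk_surjective (s.equivFin.symm ⟨j, h⟩ : A ⧸ 𝔭)).choose else 0
    have hy : ∀ j (h : j < s.card), Ideal.Quotient.mk 𝔭 (y j) = s.equivFin.symm ⟨j, h⟩ := by
      intro j h
      simp only [y, dif_pos h]
      exact (Ideal.Quotient.mk_surjective (s.equivFin.symm ⟨j, h⟩ : A ⧸ 𝔭)).choose_spec
    obtain ⟨k, hk, g, hg, r, hr⟩ := h3 y
    have h0 := Ideal.Quotient.eq_zero_iff_mem.mpr (hKp hr)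
    have hs' : LinearIndependent (MvPolynomial (Fin d) (ResidueField R)) (fun j : Fin s.card => (s.equivFin.symm j : A ⧸ 𝔭)) :=
      hs.comp s.equivFin.symm s.equivFin.symm.injective
    have hkc : k < s.card := lt_of_le_of_lt hk hcard
    rw [Fintype.linearIndependent_iff] at hs'
    have := hs' (fun j => if (j : ℕ) = k then MvPolynomial.map (residue R) g else if (j : ℕ) < k then - MvPolynomial.map (residue R) (r j) else 0) (by
      have e1 : ∀ j : Fin s.card, (if (j : ℕ) = k then MvPolynomial.map (residue R) g else if (j : ℕ) < k then - MvPolynomial.map (residue R) (r j) else 0) •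
          (s.equivFin.symm j : A ⧸ 𝔭) = (fun j : ℕ => ψ (if j = k then MvPolynomial.map (residue R) g else if j < k then - MvPolynomial.map (residue R) (r j) else 0) *
            Ideal.Quotient.mk 𝔭 (y j)) j := by
        intro j
        simp only
        rw [hy j j.2]; rfl
      refine (Finset.sum_congr rfl fun j _ => e1 j).trans ?_
      refine (Fin.sum_univ_eq_sum_range (α := A ⧸ 𝔭) (fun j : ℕ => ψ (if j = k then MvPolynomial.map (residue R) g else if j < k then - MvPolynomial.map (residue R) (r j) else 0) *
            Ideal.Quotient.mk 𝔭 (y j)) s.card).trans ?_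
      rw [← Finset.sum_subset (s₁ := range (k + 1)) (by intro q; simp; omega)]
      · rw [Finset.sum_range_succ, if_pos rfl, hψ]
        rw [map_sub, map_sum, sub_eq_zero] at h0
        simp only [Algebra.smul_def, map_mul] at h0
        rw [h0, ← Finset.sum_add_distrib]
        refine Finset.sum_eq_zero fun j hj => ?_
        have hj' : j < k := by simpa using hj
        rw [if_neg (by omega), if_pos hj', map_neg, hψ]
        ring
      · intro j hj hj'
        have : k < j := by simp at hj'; omega
        rw [if_neg (by omega), if_neg (by omega), map_zero, zero_mul]) ⟨k, hkc⟩
    rw [if_pos rfl] at this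
    exact mem_WW.mp hg this)
  letI : Algebra (MvPolynomial (Fin d) R) (MvPolynomial (Fin d) (ResidueField R)) := (MvPolynomial.map (residue R)).toAlgebra
  haveI : IsScalarTower (MvPolynomial (Fin d) R) (MvPolynomial (Fin d) (ResidueField R)) (A ⧸ 𝔭) :=
    IsScalarTower.of_algebraMap_eq fun g => (hψ g).symm
  haveI : Module.Finite (MvPolynomial (Fin d) R) (MvPolynomial (Fin d) (ResidueField R)) :=
    Module.Finite.of_surjective (Algebra.linearMap (MvPolynomial (Fin d) R) (MvPolynomial (Fin d) (ResidueField R)))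
      (MvPolynomial.map_surjective (residue R) residue_surjective)
  haveI : Module.Finite (MvPolynomial (Fin d) R) (A ⧸ 𝔭) := Module.Finite.trans (MvPolynomial (Fin d) (ResidueField R)) _
  exact isNoetherian_of_isNoetherianRing_of_finite _ _

include hal hA hK hm in
theorem noethG [IsNoetherianRing R] (hQ : QR a) (hJ : Ideal.span (Set.range a) ≤ maximalIdeal R) (i : Fin d)
    (C0 : ℕ) (hC : ∀ n, Module.length R (R ⧸ FF (Ideal.span (Set.range a)) (n + 1)) ≤ ((C0 * (n + 1) ^ d : ℕ) : ℕ∞)) :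
    IsNoetherian (MvPolynomial (Fin d) R) (A ⧸ K) := by
  have h3 : ∀ y : ℕ → A, ∃ k ≤ C0 * (d + 1) ^ d, ∃ g ∈ WW R d, ∃ r : ℕ → MvPolynomial (Fin d) R, g • y k - ∑ i ∈ range k, r i • y i ∈ K := by
    intro y
    obtain ⟨k, hk, g, hg, r, hr⟩ := growth hQ hJ i C0 hC (fun j => (y j : R[X])) (fun j => (hA _).mp (y j).2)
    refine ⟨k, hk, g, hg, r, ?_⟩
    rw [hK]
    intro n
    convert hr n using 2
    push_cast
    simp only [Algebra.smul_def, hal]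
  have hK' : ∀ p : A, p ∈ K ↔ X * (p : R[X]) ∈ A := by
    intro p
    rw [hK, hA, AA_iff hQ hJ i]
    constructor
    · intro h n
      cases n with
      | zero => rw [mul_coeff_zero, coeff_X_zero, zero_mul]; exact zero_mem _
      | succ n => rw [coeff_X_mul]; exact h n
    · intro h n
      have := h (n + 1)
      rwa [coeff_X_mul] at this
  have hai : C (a i) ∈ A := by
    rw [hA]; exact rees_le_AA (Subalgebra.algebraMap_mem (reesAlgebra (Ideal.span (Set.range a))) (a i))
  refine absNoeth A X K hK' (WW R d) ?_ ?_ (C0 * (d + 1) ^ d) h3 ⟨C (a i), hai⟩ ?_ (MvPolynomial.X i) (X_mem_WW i) ?_ ?_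
  · intro b hb
    obtain ⟨P, hP, hPx⟩ := hb
    rw [hA]
    refine intg_AA _ b P.natDegree (fun j => - ((P.coeff j : A) : R[X])) (fun j => neg_mem ((hA _).mp (P.coeff j).2)) ?_
    rw [eval₂_eq_sum_range, Finset.sum_range_succ, hP.coeff_natDegree, map_one, one_mul] at hPx
    rw [eq_neg_of_add_eq_zero_right hPx, ← Finset.sum_neg_distrib]
    refine Finset.sum_congr rfl fun j _ => ?_
    rw [neg_mul]; rfl
  · intro w hw b hb
    rw [Algebra.smul_def, hal, hA] at hb
    rw [hA]
    exact AA_cancel hQ hJ i hw b hb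
  · rw [hK]
    intro n
    change (C (a i)).coeff n ∈ _
    rw [coeff_C]
    split_ifs with h
    · subst h; exact pow_le_FF _ 1 (by rw [pow_one]; exact ai_mem a i)
    · exact zero_mem _
  · rw [hal, phi_X, mul_comm]
  · intro 𝔭 h𝔭 hKp hW
    exact h5_noeth hal A hA K hK hm 𝔭 hKp hW _ h3
end
end NHC

namespace NHC
section
variable {R : Type*} [CommRing R] [IsLocalRing R] [IsNoetherianRing R] {d : ℕ} {a : Fin d → R}
  (hQ : QR a) (hJ : Ideal.span (Set.range a) ≤ maximalIdeal R) (i : Fin d)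
  (hm : ∃ k, maximalIdeal R ^ k ≤ Ideal.span (Set.range a))
  (C0 : ℕ) (hC : ∀ n, Module.length R (R ⧸ FF (Ideal.span (Set.range a)) (n + 1)) ≤ ((C0 * (n + 1) ^ d : ℕ) : ℕ∞))

/-- the integral closure of the Rees algebra as a subalgebra over the polynomial ring -/
noncomputable def mkA {R : Type*} [CommRing R] {d : ℕ} {a : Fin d → R} [Algebra (MvPolynomial (Fin d) R) R[X]] (hal : ∀ g, algebraMap (MvPolynomial (Fin d) R) R[X] g = phi a g) :
    Subalgebra (MvPolynomial (Fin d) R) R[X] where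
  carrier := {p | p ∈ AA (Ideal.span (Set.range a))}
  mul_mem' := by intro p q hp hq; exact mul_mem (S := Subalgebra _ _) (s := AA (Ideal.span (Set.range a))) hp hq
  add_mem' := by intro p q hp hq; exact add_mem (S := Subalgebra _ _) (s := AA (Ideal.span (Set.range a))) hp hq
  algebraMap_mem' := by
    intro g
    change algebraMap _ _ g ∈ AA (Ideal.span (Set.range a))
    rw [hal]
    exact rees_le_AA (phi_mem_rees a g)

theorem mem_mkA {R : Type*} [CommRing R] {d : ℕ} {a : Fin d → R} [Algebra (MvPolynomial (Fin d) R) R[X]] (hal : ∀ g, algebraMap (MvPolynomial (Fin d) R) R[X] g = phi a g) (p : R[X]) :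
    p ∈ mkA hal ↔ p ∈ AA (Ideal.span (Set.range a)) := Iff.rfl

include hQ hJ i in
theorem exists_K [Algebra (MvPolynomial (Fin d) R) R[X]] (A : Subalgebra (MvPolynomial (Fin d) R) R[X]) (hA : ∀ p, p ∈ A ↔ p ∈ AA (Ideal.span (Set.range a))) :
    ∃ K : Ideal A, ∀ p : A, p ∈ K ↔ ∀ n, (p : R[X]).coeff n ∈ FF (Ideal.span (Set.range a)) (n + 1) := by
  refine ⟨{ carrier := {p | ∀ n, (p : R[X]).coeff n ∈ FF (Ideal.span (Set.range a)) (n + 1)}, add_mem' := ?_, zero_mem' := ?_, smul_mem' := ?_}, fun p => Iff.rfl⟩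
  · intro p q hp hq n
    push_cast
    rw [coeff_add]; exact add_mem (hp n) (hq n)
  · intro n; simp
  · intro c p hp n
    change ((c : R[X]) * (p : R[X])).coeff n ∈ _
    rw [coeff_mul]
    refine sum_mem fun x hx => ?_
    rw [HasAntidiagonal.mem_antidiagonal] at hx
    rw [← hx, add_assoc]
    exact mul_mem_FF (AA_coeff hQ hJ i _ ((hA _).mp c.2) _) (hp _)

include hQ hJ i hm C0 hC in
theorem FF_step1 : ∃ N, ∀ n > N, FF (Ideal.span (Set.range a)) n ≤
    Ideal.span (Set.range a) * FF (Ideal.span (Set.range a)) (n - 1) ⊔ FF (Ideal.span (Set.range a)) (n + 1) := by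
  set J := Ideal.span (Set.range a)
  letI : Algebra (MvPolynomial (Fin d) R) R[X] := (phi a).toRingHom.toAlgebra
  have hal : ∀ g, algebraMap (MvPolynomial (Fin d) R) R[X] g = phi a g := fun g => rfl
  obtain ⟨K, hK⟩ := exists_K hQ hJ i (mkA hal) (mem_mkA hal)
  have hN := noethG hal (mkA hal) (mem_mkA hal) K hK hm hQ hJ i C0 hC
  obtain ⟨T, hT⟩ := hN.noetherian ⊤
  choose lf hlf using fun y : (mkA hal) ⧸ K => Ideal.Quotient.mk_surjective y
  let N := T.sup fun y => ((lf y : mkA hal) : R[X]).natDegree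
  refine ⟨N, fun n hn x hx => ?_⟩
  have hxA : monomial n x ∈ mkA hal := hx
  have hmem : Ideal.Quotient.mk K ⟨monomial n x, hxA⟩ ∈ Submodule.span (MvPolynomial (Fin d) R) (T : Set ((mkA hal) ⧸ K)) := by
    rw [hT]; trivial
  rw [Submodule.mem_span_finset] at hmem
  obtain ⟨g, -, hg⟩ := hmem
  have h1 : (⟨monomial n x, hxA⟩ : mkA hal) - ∑ y ∈ T, g y • lf y ∈ K := by
    rw [← Ideal.Quotient.eq_zero_iff_mem, map_sub, sub_eq_zero, ← hg, map_sum]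
    refine Finset.sum_congr rfl fun y _ => ?_
    have e0 : ∀ s : MvPolynomial (Fin d) R, s • Ideal.Quotient.mk K (lf y) = Ideal.Quotient.mk K (s • lf y) := fun s => rfl
    rw [← e0, hlf]
  rw [hK] at h1
  have h2 := h1 n
  push_cast at h2
  rw [coeff_sub, coeff_monomial_same, finsetSum_coeff] at h2
  have h3 : ∑ y ∈ T, (g y • ((lf y : mkA hal) : R[X])).coeff n ∈ J * FF J (n - 1) := by
    refine sum_mem fun y hy => ?_
    rw [Algebra.smul_def, hal, coeff_mul]
    refine sum_mem fun p hp => ?_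
    rw [HasAntidiagonal.mem_antidiagonal] at hp
    by_cases hd : p.2 ≤ N
    · have e1 : J ^ p.1 ≤ J * FF J (p.1 - 1) := by
        have : p.1 = (p.1 - 1) + 1 := by omega
        conv_lhs => rw [this, pow_succ']
        exact Ideal.mul_mono_right (pow_le_FF J _)
      have e2 := Ideal.mul_mem_mul (e1 (phi_mem_rees a (g y) p.1)) (AA_coeff hQ hJ i _ (lf y).2 p.2)
      rw [mul_assoc] at e2
      refine Ideal.mul_mono_right ((FF_mul_le J _ _).trans (le_of_eq ?_)) e2
      congr 1; omega
    · rw [coeff_eq_zero_of_natDegree_lt (p := ((lf y : mkA hal) : R[X])), mul_zero]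
      · exact zero_mem _
      · have : ((lf y : mkA hal) : R[X]).natDegree ≤ N := Finset.le_sup (f := fun y => ((lf y : mkA hal) : R[X]).natDegree) hy
        omega
  have h4 : x = (∑ y ∈ T, (g y • ((lf y : mkA hal) : R[X])).coeff n) + (x - ∑ y ∈ T, (g y • ((lf y : mkA hal) : R[X])).coeff n) := by ring
  rw [h4]
  exact add_mem (Ideal.mem_sup_left h3) (Ideal.mem_sup_right h2)

include hQ hJ i in
theorem FF_chev (hAU : AnalyticallyUnramified R) (n : ℕ) : ∃ l, FF (Ideal.span (Set.range a)) l ≤ maximalIdeal R ^ n := by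
  refine chevalley hAU _ (FF_anti hQ hJ i) (fun l => ?_) n
  obtain ⟨c, hc⟩ := FF_pow_bound hQ hJ i l
  exact ⟨c, fun k => (hc k).trans (Ideal.pow_right_mono hJ _)⟩

include hQ hJ i hm C0 hC in
theorem FF_rees (hAU : AnalyticallyUnramified R) : ∃ N, ∀ n > N, FF (Ideal.span (Set.range a)) n =
    Ideal.span (Set.range a) * FF (Ideal.span (Set.range a)) (n - 1) := by
  obtain ⟨N, hN⟩ := FF_step1 hQ hJ i hm C0 hC
  set J := Ideal.span (Set.range a)
  refine ⟨N, fun n hn => le_antisymm ?_ ?_⟩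
  · have h1 : ∀ t, FF J n ≤ J * FF J (n - 1) ⊔ FF J (n + t) := by
      intro t
      induction t with
      | zero => exact le_sup_right
      | succ t ih =>
        refine ih.trans (sup_le le_sup_left ((hN (n + t) (by omega)).trans (sup_le ?_ le_sup_right)))
        refine le_sup_of_le_left (Ideal.mul_mono_right (FF_anti hQ hJ i (by omega)))
    obtain ⟨k, hk⟩ := hm
    obtain ⟨l, hl⟩ := FF_chev hQ hJ i hAU (k * n)
    have h2 : FF J (n + l) ≤ J * FF J (n - 1) := by
      refine (FF_anti hQ hJ i (Nat.le_add_left l n)).trans (hl.trans ?_)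
      rw [pow_mul]
      refine (Ideal.pow_right_mono hk n).trans ?_
      have : n = (n - 1) + 1 := by omega
      conv_lhs => rw [this, pow_succ']
      exact Ideal.mul_mono_right (pow_le_FF J _)
    exact (h1 l).trans (sup_le le_rfl h2)
  · calc J * FF J (n - 1) ≤ FF J 1 * FF J (n - 1) := Ideal.mul_mono_left (by simpa using pow_le_FF J 1)
      _ ≤ FF J (1 + (n - 1)) := FF_mul_le J _ _
      _ = FF J n := by congr 1; omega
end
end NHC

namespace NHC

/-- binomial-basis polynomial -/
def PB (D : ℕ) (c : ℕ → ℤ) (n : ℕ) : ℤ := ∑ i ∈ range (D + 1), c i * ((n + D - i).choose (D - i) : ℤ)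

theorem PB_diff (D : ℕ) (c : ℕ → ℤ) (n : ℕ) : PB (D + 1) c (n + 1) - PB (D + 1) c n = PB D c (n + 1) := by
  unfold PB
  rw [Finset.sum_range_succ, Finset.sum_range_succ _ (D + 1)]
  have : ∀ i ∈ range (D + 1), c i * ((n + 1 + (D + 1) - i).choose (D + 1 - i) : ℤ) =
      c i * ((n + (D + 1) - i).choose (D + 1 - i) : ℤ) + c i * ((n + 1 + D - i).choose (D - i) : ℤ) := by
    intro i hi
    have hi' : i ≤ D := by simpa [Nat.lt_succ_iff] using hi
    obtain ⟨k, rfl⟩ := Nat.exists_eq_add_of_le hi'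
    have e1 : n + 1 + (i + k + 1) - i = (n + k + 1) + 1 := by omega
    have e2 : i + k + 1 - i = k + 1 := by omega
    have e3 : n + (i + k + 1) - i = n + k + 1 := by omega
    have e4 : n + 1 + (i + k) - i = n + k + 1 := by omega
    have e5 : i + k - i = k := by omega
    rw [e1, e2, e3, e4, e5, Nat.choose_succ_succ]
    push_cast; ring
  rw [Finset.sum_congr rfl this, Finset.sum_add_distrib]
  simp

theorem PB_zero (c : ℕ → ℤ) (n : ℕ) : PB 0 c n = c 0 := by simp [PB]

theorem PB_neg (D : ℕ) (c : ℕ → ℤ) (hc : c 0 < 0) : ∃ N, ∀ n ≥ N, PB D c n < 0 := by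
  induction D with
  | zero => exact ⟨0, fun n _ => by rw [PB_zero]; exact hc⟩
  | succ D ih =>
    obtain ⟨N, hN⟩ := ih
    have h : ∀ k : ℕ, PB (D + 1) c (N + k) ≤ PB (D + 1) c N - k := by
      intro k
      induction k with
      | zero => simp
      | succ k ih =>
        have := PB_diff D c (N + k)
        have h2 := hN (N + k + 1) (by omega)
        rw [← add_assoc]; push_cast; omega
    refine ⟨N + (PB (D + 1) c N).toNat + 1, fun n hn => ?_⟩
    obtain ⟨k, rfl⟩ := Nat.exists_eq_add_of_le (show N ≤ n by omega)
    have := h k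
    omega

theorem PB_uniq (D : ℕ) (c : ℕ → ℤ) (N : ℕ) (h : ∀ n ≥ N, PB D c n = 0) : ∀ i ≤ D, c i = 0 := by
  induction D generalizing N with
  | zero => intro i hi; obtain rfl : i = 0 := by omega
            rw [← PB_zero c N]; exact h N le_rfl
  | succ D ih =>
    have h1 := ih (N + 1) (fun n hn => by
      obtain ⟨m, rfl⟩ : ∃ m, n = m + 1 := ⟨n - 1, by omega⟩
      rw [← PB_diff, h _ (by omega), h _ (by omega)]; rfl)
    intro i hi
    rcases Nat.lt_or_ge D i with h2 | h2
    · obtain rfl : i = D + 1 := by omega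
      have h3 := h N le_rfl
      unfold PB at h3
      rw [Finset.sum_range_succ, Finset.sum_eq_zero] at h3
      · simpa using h3
      · intro j hj; rw [h1 j (by simpa [Nat.lt_succ_iff] using hj)]; simp
    · exact h1 i h2

/-- shift of coefficients -/
def shc (c : ℕ → ℤ) (i : ℕ) : ℤ := if i = 0 then c 0 else c i - c (i - 1)

theorem PB_congr {D : ℕ} {c c' : ℕ → ℤ} (h : ∀ i ≤ D, c i = c' i) (n : ℕ) : PB D c n = PB D c' n := by
  unfold PB
  exact Finset.sum_congr rfl fun i hi => by rw [h i (by simpa [Nat.lt_succ_iff] using hi)]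

theorem PB_sub (D : ℕ) (c c' : ℕ → ℤ) (n : ℕ) : PB D (fun i => c i - c' i) n = PB D c n - PB D c' n := by
  simp [PB, sub_mul]

theorem PB_add (D : ℕ) (c c' : ℕ → ℤ) (n : ℕ) : PB D (fun i => c i + c' i) n = PB D c n + PB D c' n := by
  simp [PB, add_mul, Finset.sum_add_distrib]

theorem PB_shc (D : ℕ) (c : ℕ → ℤ) (n : ℕ) : PB D (shc c) (n + 1) = PB D c n := by
  cases D with
  | zero => simp [PB, shc]
  | succ D =>
  have h : PB (D + 1) (shc c) (n + 1) = PB (D + 1) c (n + 1) - PB D c (n + 1) := by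
    unfold PB
    rw [Finset.sum_range_succ', Finset.sum_range_succ' _ (D + 1)]
    have : ∀ i ∈ range (D + 1), shc c (i + 1) * ((n + 1 + (D + 1) - (i + 1)).choose (D + 1 - (i + 1)) : ℤ) =
      c (i + 1) * ((n + 1 + (D + 1) - (i + 1)).choose (D + 1 - (i + 1)) : ℤ) - c i * ((n + 1 + D - i).choose (D - i) : ℤ) := by
      intro i hi
      have e1 : n + 1 + (D + 1) - (i + 1) = n + 1 + D - i := by omega
      have e2 : D + 1 - (i + 1) = D - i := by omega
      rw [e1, e2]; simp [shc]; ring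
    rw [Finset.sum_congr rfl this, Finset.sum_sub_distrib]
    simp [shc]; ring
  have := PB_diff D c n
  linarith

theorem PB_shc_iter (D : ℕ) (c : ℕ → ℤ) (q n : ℕ) : PB D (shc^[q] c) (n + q) = PB D c n := by
  induction q with
  | zero => simp
  | succ q ih => rw [Function.iterate_succ_apply', ← add_assoc, PB_shc, ih]

theorem shc_iter_zero (c : ℕ → ℤ) (q : ℕ) : (shc^[q] c) 0 = c 0 := by
  induction q with
  | zero => simp
  | succ q ih => rw [Function.iterate_succ_apply', ← ih]; simp [shc]

/-- delta -/
def dl (i : ℕ) : ℤ := if i = 0 then 1 else 0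

theorem shc_iter_dl (q i : ℕ) : (shc^[q] dl) i = (-1) ^ i * (q.choose i : ℤ) := by
  induction q generalizing i with
  | zero => cases i <;> simp [dl]
  | succ q ih =>
    rw [Function.iterate_succ_apply']
    cases i with
    | zero => simp [shc, ih]
    | succ i => simp [shc, ih, Nat.choose_succ_succ, pow_succ]; ring

theorem PB_dl (D n : ℕ) (e : ℤ) : PB D (fun i => e * dl i) n = e * ((n + D).choose D : ℤ) := by
  unfold PB
  rw [Finset.sum_eq_single 0]
  · simp [dl]
  · intro i _ hi; simp [dl, hi]
  · simp

theorem PB_dl' (D n : ℕ) : PB D dl n = ((n + D).choose D : ℤ) := by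
  simpa using PB_dl D n 1

theorem PB_nonneg {D : ℕ} {c : ℕ → ℤ} (N : ℕ) (h : ∀ n ≥ N, 0 ≤ PB D c n) : 0 ≤ c 0 := by
  by_contra h1
  obtain ⟨M, hM⟩ := PB_neg D c (by omega)
  have := h (max N M) (le_max_left ..)
  have := hM (max N M) (le_max_right ..)
  omega

end NHC

namespace NHC

section BBs
variable {R : Type*} [CommRing R] {d : ℕ} (a : Fin d → R)

/-- polynomials with coefficients in `𝔟 J^n` -/
noncomputable def BB (𝔟 : Ideal R) : AddSubgroup R[X] where
  carrier := {p | ∀ n, p.coeff n ∈ 𝔟 * Ideal.span (Set.range a) ^ n}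
  zero_mem' := by intro n; simp
  add_mem' := by intro x y hx hy n; rw [coeff_add]; exact add_mem (hx n) (hy n)
  neg_mem' := by intro x hx n; rw [coeff_neg]; exact neg_mem (hx n)

theorem mem_BB {𝔟 : Ideal R} {p : R[X]} : p ∈ BB a 𝔟 ↔ ∀ n, p.coeff n ∈ 𝔟 * Ideal.span (Set.range a) ^ n := Iff.rfl

theorem BB_mul {𝔟 : Ideal R} {p q : R[X]} (hp : p ∈ reesAlgebra (Ideal.span (Set.range a))) (hq : q ∈ BB a 𝔟) : p * q ∈ BB a 𝔟 := by
  intro n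
  rw [coeff_mul]
  refine sum_mem fun x hx => ?_
  rw [HasAntidiagonal.mem_antidiagonal] at hx
  rw [← hx, pow_add, mul_left_comm]
  exact Ideal.mul_mem_mul (hp x.1) (hq x.2)

theorem phi_mul_BB {𝔟 : Ideal R} (f : MvPolynomial (Fin d) R) {q : R[X]} (hq : q ∈ BB a 𝔟) : phi a f * q ∈ BB a 𝔟 :=
  BB_mul a (phi_mem_rees a f) hq

theorem BB_le_rees {𝔟 : Ideal R} {q : R[X]} (hq : q ∈ BB a 𝔟) : q ∈ reesAlgebra (Ideal.span (Set.range a)) :=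
  fun n => Ideal.mul_le_right (hq n)

end BBs

section S2
variable {R : Type*} [CommRing R] [IsLocalRing R] [IsNoetherianRing R] {d : ℕ}

theorem exists_lift_res (f : MvPolynomial (Fin d) (ResidueField R)) : ∃ g : MvPolynomial (Fin d) R, MvPolynomial.map (residue R) g = f :=
  MvPolynomial.map_surjective _ residue_surjective f

theorem sub_mem_mC {f g : MvPolynomial (Fin d) R} (h : MvPolynomial.map (residue R) f = MvPolynomial.map (residue R) g) :
    f - g ∈ (maximalIdeal R).map (MvPolynomial.C (σ := Fin d)) := by
  rw [← notMem_WW, mem_WW]; simp [h]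

theorem S2_res {f g : MvPolynomial (Fin d) R} (hg : g ∈ WW R d)
    (hfg : IsRelPrime (MvPolynomial.map (residue R) f) (MvPolynomial.map (residue R) g))
    (U V : MvPolynomial (Fin d) R) (h : f * U - g * V ∈ (maximalIdeal R).map (MvPolynomial.C (σ := Fin d))) :
    ∃ Z, U - g * Z ∈ (maximalIdeal R).map (MvPolynomial.C (σ := Fin d)) ∧ V - f * Z ∈ (maximalIdeal R).map (MvPolynomial.C (σ := Fin d)) := by
  rw [mem_WW] at hg
  rw [← notMem_WW, mem_WW, not_not, map_sub, map_mul, map_mul, sub_eq_zero] at h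
  have h1 : MvPolynomial.map (residue R) g ∣ MvPolynomial.map (residue R) U :=
    hfg.symm.dvd_of_dvd_mul_left ⟨_, h⟩
  obtain ⟨Z', hZ'⟩ := h1
  obtain ⟨Z, rfl⟩ := exists_lift_res Z'
  refine ⟨Z, ?_, ?_⟩
  · exact sub_mem_mC (by rw [map_mul, hZ'])
  · refine sub_mem_mC (mul_left_cancel₀ hg ?_)
    rw [← h, hZ', map_mul]; ring

theorem S2_art {f g : MvPolynomial (Fin d) R} (hg : g ∈ WW R d)
    (hfg : IsRelPrime (MvPolynomial.map (residue R) f) (MvPolynomial.map (residue R) g)) (k : ℕ)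
    (𝔟 : Ideal R) : maximalIdeal R ^ k ≤ 𝔟 → 
    ∀ (U V : MvPolynomial (Fin d) R), f * U - g * V ∈ Ideal.map (MvPolynomial.C (σ := Fin d)) 𝔟 →
    ∃ Z, U - g * Z ∈ Ideal.map (MvPolynomial.C (σ := Fin d)) 𝔟 ∧ V - f * Z ∈ Ideal.map (MvPolynomial.C (σ := Fin d)) 𝔟 := by
  induction 𝔟 using IsNoetherian.induction with
  | hgt 𝔟 ih =>
  intro hk U V h
  by_cases htop : 𝔟 = ⊤
  · subst htop; exact ⟨0, by simp [Ideal.map_top], by simp [Ideal.map_top]⟩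
  -- socle element
  have hex : ∃ x, x ∉ 𝔟 ∧ ∀ r ∈ maximalIdeal R, r * x ∈ 𝔟 := by
    classical
    have hP : ∃ j, maximalIdeal R ^ j ≤ 𝔟 := ⟨k, hk⟩
    have h0 : Nat.find hP ≠ 0 := by
      intro e
      have := Nat.find_spec hP
      rw [e, pow_zero, Ideal.one_eq_top] at this
      exact htop (top_le_iff.mp this)
    obtain ⟨j, hj⟩ := Nat.exists_eq_succ_of_ne_zero h0
    have h1 := Nat.find_min hP (m := j) (by omega)
    have h2 := Nat.find_spec hP
    rw [hj] at h2
    obtain ⟨x, hx, hxb⟩ := SetLike.not_le_iff_exists.mp h1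
    refine ⟨x, hxb, fun r hr => h2 ?_⟩
    rw [pow_succ']
    exact Ideal.mul_mem_mul hr hx
  obtain ⟨x, hx, hmx⟩ := hex
  have hlt : 𝔟 < 𝔟 ⊔ Ideal.span {x} := by
    refine lt_of_le_of_ne le_sup_left fun e => hx ?_
    rw [e]; exact Ideal.mem_sup_right (Ideal.mem_span_singleton_self x)
  obtain ⟨Z, hZ1, hZ2⟩ := ih _ hlt (hk.trans le_sup_left) U V (Ideal.map_mono le_sup_left h)
  have hdec : ∀ p ∈ Ideal.map (MvPolynomial.C (σ := Fin d)) (𝔟 ⊔ Ideal.span {x}), ∃ q, p - MvPolynomial.C x * q ∈ Ideal.map (MvPolynomial.C (σ := Fin d)) 𝔟 := by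
    intro p hp
    rw [Ideal.map_sup, Ideal.map_span, Set.image_singleton] at hp
    obtain ⟨y, hy, z, hz, rfl⟩ := Submodule.mem_sup.mp hp
    obtain ⟨q, rfl⟩ := Ideal.mem_span_singleton'.mp hz
    exact ⟨q, by convert hy using 1; ring⟩
  obtain ⟨U', hU'⟩ := hdec _ hZ1
  obtain ⟨V', hV'⟩ := hdec _ hZ2
  have h3 : MvPolynomial.C x * (f * U' - g * V') ∈ Ideal.map (MvPolynomial.C (σ := Fin d)) 𝔟 := by
    have := sub_mem (sub_mem h (Ideal.mul_mem_left _ f hU')) (neg_mem (Ideal.mul_mem_left _ g hV'))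
    convert this using 1; ring
  have h4 : f * U' - g * V' ∈ (maximalIdeal R).map (MvPolynomial.C (σ := Fin d)) := by
    rw [MvPolynomial.mem_map_C_iff] at h3 ⊢
    intro c
    have := h3 c
    rw [MvPolynomial.coeff_C_mul] at this
    by_contra hc
    rw [mem_maximalIdeal, mem_nonunits_iff, not_not] at hc
    exact hx ((Ideal.mul_unit_mem_iff_mem _ hc).mp this)
  obtain ⟨Z', hZ'1, hZ'2⟩ := S2_res hg hfg U' V' h4
  have hxm : ∀ p ∈ (maximalIdeal R).map (MvPolynomial.C (σ := Fin d)), MvPolynomial.C x * p ∈ Ideal.map (MvPolynomial.C (σ := Fin d)) 𝔟 := by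
    intro p hp
    rw [MvPolynomial.mem_map_C_iff] at hp ⊢
    intro c
    rw [MvPolynomial.coeff_C_mul, mul_comm]
    exact hmx _ (hp c)
  refine ⟨Z + MvPolynomial.C x * Z', ?_, ?_⟩
  · convert add_mem hU' (hxm _ hZ'1) using 1; ring
  · convert add_mem hV' (hxm _ hZ'2) using 1; ring

variable {a : Fin d → R} (hQ : QR a) (i : Fin d) (hm : ∃ k, maximalIdeal R ^ k ≤ Ideal.span (Set.range a))
include hQ

theorem BB_cancel (i : Fin d) (𝔟 : Ideal R) (hb : Ideal.span (Set.range a) ≤ 𝔟) {g : MvPolynomial (Fin d) R}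
    (hg : g ∈ WW R d) (q : R[X]) (h : phi a g * q ∈ BB a 𝔟) : q ∈ BB a 𝔟 :=
  fun n => WW_cancel_b hQ 𝔟 hb hg q (WW_cancel_rees hQ hg q i (BB_le_rees a h)) h n

include hm

theorem S2_rees {f g : MvPolynomial (Fin d) R} (hg : g ∈ WW R d)
    (hfg : IsRelPrime (MvPolynomial.map (residue R) f) (MvPolynomial.map (residue R) g))
    (𝔟 : Ideal R) (hb : Ideal.span (Set.range a) ≤ 𝔟) (u v : R[X])
    (hu : u ∈ reesAlgebra (Ideal.span (Set.range a))) (hv : v ∈ reesAlgebra (Ideal.span (Set.range a)))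
    (h : phi a f * u - phi a g * v ∈ BB a 𝔟) :
    ∃ z, u - phi a g * z ∈ BB a 𝔟 ∧ v - phi a f * z ∈ BB a 𝔟 := by
  obtain ⟨U, rfl⟩ := phi_lift_rees a u hu
  obtain ⟨V, rfl⟩ := phi_lift_rees a v hv
  rw [← map_mul, ← map_mul, ← map_sub] at h
  obtain ⟨k, hk⟩ := hm
  obtain ⟨Z, h1, h2⟩ := S2_art hg hfg k 𝔟 (hk.trans hb) U V (hQ.gen 𝔟 hb _ h)
  refine ⟨phi a Z, ?_, ?_⟩
  · rw [← map_mul, ← map_sub]; exact phi_mem a 𝔟 _ h1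
  · rw [← map_mul, ← map_sub]; exact phi_mem a 𝔟 _ h2

theorem S2_main {f g : MvPolynomial (Fin d) R} (hg : g ∈ WW R d)
    (hfg : IsRelPrime (MvPolynomial.map (residue R) f) (MvPolynomial.map (residue R) g))
    (𝔟 : Ideal R) (hb : Ideal.span (Set.range a) ≤ 𝔟) (u v : R[X])
    (h : phi a f * u - phi a g * v ∈ BB a 𝔟) :
    ∃ z, u - phi a g * z ∈ BB a 𝔟 ∧ v - phi a f * z ∈ BB a 𝔟 := by
  set J := Ideal.span (Set.range a) with hJdef
  have key : ∀ s : ℕ, ∀ u v : R[X], (∀ n, u.coeff n ∈ J ^ (n - s)) → (∀ n, v.coeff n ∈ J ^ (n - s)) → 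
      phi a f * u - phi a g * v ∈ BB a 𝔟 → ∃ z, u - phi a g * z ∈ BB a 𝔟 ∧ v - phi a f * z ∈ BB a 𝔟 := by
    intro s
    induction s with
    | zero => intro u v hu hv h; exact S2_rees hQ hm hg hfg 𝔟 hb u v (fun n => hu n) (fun n => hv n) h
    | succ s ih =>
      intro u v hu hv h
      have hsplit : ∀ w : R[X], (∀ n, w.coeff n ∈ J ^ (n - (s + 1))) → ∃ w1 w2 : R[X], w = X ^ (s + 1) * w1 + w2 ∧
          (∀ n, w1.coeff n ∈ J ^ n) ∧ (∀ n, w2.coeff n ∈ J ^ (n - s)) := by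
        intro w hw
        refine ⟨∑ n ∈ range (w.natDegree + 1), monomial n (w.coeff (n + (s + 1))), w - X ^ (s + 1) * ∑ n ∈ range (w.natDegree + 1), monomial n (w.coeff (n + (s + 1))), by ring, ?_, ?_⟩
        · intro n
          rw [finsetSum_coeff]
          refine sum_mem fun j _ => ?_
          rw [coeff_monomial]
          split_ifs with e
          · rw [← e]; simpa using hw (j + (s + 1))
          · exact zero_mem _
        · intro n
          rcases Nat.lt_or_ge n (s + 1) with hn | hn
          · rw [show n - s = 0 by omega]; simp
          · obtain ⟨m, rfl⟩ := Nat.exists_eq_add_of_le' hn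
            rw [coeff_sub, coeff_X_pow_mul, finsetSum_coeff]
            have : ∑ b ∈ range (w.natDegree + 1), (monomial b (w.coeff (b + (s + 1)))).coeff m = w.coeff (m + (s + 1)) := by
              rw [Finset.sum_congr rfl fun b _ => coeff_monomial]
              rw [Finset.sum_ite_eq']
              split_ifs with hmm
              · rfl
              · rw [coeff_eq_zero_of_natDegree_lt]; simp at hmm; omega
            rw [this, sub_self]; exact zero_mem _
      obtain ⟨u1, u2, hue, hu1, hu2⟩ := hsplit u hu
      obtain ⟨v1, v2, hve, hv1, hv2⟩ := hsplit v hv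
      have hph : ∀ (F : MvPolynomial (Fin d) R) (w : R[X]), (∀ n, w.coeff n ∈ J ^ (n - s)) → ∀ n, (phi a F * w).coeff n ∈ J ^ (n - s) := by
        intro F w hw n
        rw [coeff_mul]
        refine sum_mem fun x hx => ?_
        rw [HasAntidiagonal.mem_antidiagonal] at hx
        refine Ideal.pow_le_pow_right (show n - s ≤ x.1 + (x.2 - s) by omega) ?_
        rw [pow_add]
        exact Ideal.mul_mem_mul (phi_mem_rees a F x.1) (hw x.2)
      have h1 : phi a f * u1 - phi a g * v1 ∈ BB a J := by
        intro n
        have e : (phi a f * u1 - phi a g * v1).coeff n = (phi a f * u - phi a g * v - phi a f * u2 + phi a g * v2).coeff (n + (s + 1)) := by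
          rw [← coeff_X_pow_mul _ (s + 1) n, hue, hve]; congr 1; ring
        rw [e, ← pow_succ']
        have e2 : n + (s + 1) - s = n + 1 := by omega
        rw [coeff_add, coeff_sub]
        have := hph f u2 hu2 (n + (s + 1))
        have := hph g v2 hv2 (n + (s + 1))
        rw [e2] at *
        refine add_mem (sub_mem ?_ ‹_›) ‹_›
        exact Ideal.pow_le_pow_right (by omega) (Ideal.mul_le_right (h (n + (s + 1))))
      obtain ⟨z1, hz1, hz2⟩ := S2_rees hQ hm hg hfg J le_rfl u1 v1 (fun n => hu1 n) (fun n => hv1 n) h1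
      have hXB : ∀ w ∈ BB a J, ∀ n, (X ^ (s + 1) * w).coeff n ∈ J ^ (n - s) := by
        intro w hw n
        rw [coeff_X_pow_mul']
        split_ifs with hn
        · have := hw (n - (s + 1))
          rw [← pow_succ'] at this
          rwa [show n - s = n - (s + 1) + 1 by omega]
        · exact zero_mem _
      obtain ⟨z, hz, hz'⟩ := ih (u - phi a g * (X ^ (s + 1) * z1)) (v - phi a f * (X ^ (s + 1) * z1)) (by
          intro n
          have := add_mem (hXB _ hz1 n) (hu2 n)
          rw [← coeff_add] at this
          convert this using 2; rw [hue]; ring) (by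
          intro n
          have := add_mem (hXB _ hz2 n) (hv2 n)
          rw [← coeff_add] at this
          convert this using 2; rw [hve]; ring) (by convert h using 1; ring)
      refine ⟨X ^ (s + 1) * z1 + z, ?_, ?_⟩
      · convert hz using 1; ring
      · convert hz' using 1; ring
  refine key (max u.natDegree v.natDegree) u v ?_ ?_ h
  · intro n
    rcases Nat.lt_or_ge u.natDegree n with hn | hn
    · rw [coeff_eq_zero_of_natDegree_lt hn]; exact zero_mem _
    · rw [show n - max u.natDegree v.natDegree = 0 by omega]; simp
  · intro n
    rcases Nat.lt_or_ge v.natDegree n with hn | hn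
    · rw [coeff_eq_zero_of_natDegree_lt hn]; exact zero_mem _
    · rw [show n - max u.natDegree v.natDegree = 0 by omega]; simp

end S2
end NHC

namespace NHC

theorem PB_split (D : ℕ) (c : ℕ → ℤ) (n : ℕ) : PB (D + 1) c n = c 0 * ((n + (D + 1)).choose (D + 1) : ℤ) + PB D (fun i => c (i + 1)) n := by
  unfold PB
  rw [Finset.sum_range_succ', add_comm]
  congr 1
  exact Finset.sum_congr rfl fun i _ => by
    rw [show n + (D + 1) - (i + 1) = n + D - i by omega, show D + 1 - (i + 1) = D - i by omega]

theorem hockey (D n : ℕ) : ∑ j ∈ range n, ((D + 1) + j - 1).choose j = (n + D).choose (D + 1) := by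
  induction n with
  | zero => simp
  | succ n ih =>
    rw [Finset.sum_range_succ, ih, show D + 1 + n - 1 = n + D by omega, show n + 1 + D = (n + D) + 1 by ring, Nat.choose_succ_succ,
      add_comm, Nat.choose_symm_add]

section
variable {R : Type*} [CommRing R] [IsLocalRing R] [IsNoetherianRing R] {D : ℕ} {a : Fin (D + 1) → R} (hQ : QR a)
include hQ

omit [IsLocalRing R] [IsNoetherianRing R] in
theorem length_Jpow (e0 : ℕ) (he : Module.length R (R ⧸ Ideal.span (Set.range a)) = e0) (n : ℕ) :
    Module.length R (R ⧸ Ideal.span (Set.range a) ^ n) = (((n + D).choose (D + 1) * e0 : ℕ) : ℕ∞) := by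
  rw [length_sum (fun n => Ideal.span (Set.range a) ^ n) (fun i j h => Ideal.pow_le_pow_right h) n]
  have h0 : Module.length R (R ⧸ Ideal.span (Set.range a) ^ 0) = 0 := by
    rw [Module.length_eq_zero_iff, pow_zero, Ideal.one_eq_top]
    exact Submodule.Quotient.subsingleton_iff.mpr rfl
  have h1 : ∀ j, Module.length R (Submodule.map (Submodule.mkQ (Ideal.span (Set.range a) ^ (j + 1))) (Ideal.span (Set.range a) ^ j)) = 
      ((D + 1 + j - 1).choose j : ℕ) * (e0 : ℕ∞) := by
    intro j
    rw [pow_succ', length_gr hQ _ le_rfl j, he]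
  rw [h0, Finset.sum_congr rfl fun j _ => h1 j, ← Finset.sum_mul, add_zero, ← hockey]
  push_cast; rfl

omit [IsLocalRing R] [IsNoetherianRing R] in
theorem length_BJpow (e0 l0 : ℕ) (he : Module.length R (R ⧸ Ideal.span (Set.range a)) = e0)
    (𝔟 : Ideal R) (hb : Ideal.span (Set.range a) ≤ 𝔟) (hl : Module.length R (R ⧸ 𝔟) = l0) (n : ℕ) :
    Module.length R (R ⧸ (𝔟 * Ideal.span (Set.range a) ^ n)) = (((n + D).choose D * l0 + (n + D).choose (D + 1) * e0 : ℕ) : ℕ∞) := by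
  rw [length_quot (N := Ideal.span (Set.range a) ^ n) Ideal.mul_le_right, length_Jpow hQ e0 he, length_gr hQ 𝔟 hb, hl,
    show D + 1 + n - 1 = n + D by omega, Nat.choose_symm_add]
  push_cast; rfl

theorem mn_poly (hJ : Ideal.span (Set.range a) ≤ maximalIdeal R) (i : Fin (D + 1))
    (hm : ∃ k, maximalIdeal R ^ k ≤ Ideal.span (Set.range a)) (hAU : AnalyticallyUnramified R)
    (L : ℕ → ℕ) (e : ℕ → ℤ) (hL : ∀ n, Module.length R (R ⧸ FF (Ideal.span (Set.range a)) (n + 1)) = L n)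
    (C0 : ℕ) (hC : ∀ n, Module.length R (R ⧸ FF (Ideal.span (Set.range a)) (n + 1)) ≤ ((C0 * (n + 1) ^ (D + 1) : ℕ) : ℕ∞))
    (N0 : ℕ) (hLe : ∀ n ≥ N0, (L n : ℤ) = PB (D + 1) (fun i => (-1) ^ i * e i) n)
    (he1 : e 1 = e 0 - L 0 + 1) (he3 : e 3 = 0) :
    ∃ (mn : ℕ → ℕ) (b : ℕ → ℤ) (N : ℕ), (∀ n, Module.length R (Submodule.map (Submodule.mkQ (FF (Ideal.span (Set.range a)) 1 * Ideal.span (Set.range a) ^ n)) (FF (Ideal.span (Set.range a)) (n + 1))) = mn n) ∧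
      (∀ n ≥ N, (mn n : ℤ) = PB D b n) ∧ b 0 = 1 ∧ b 2 = 0 := by
  set J := Ideal.span (Set.range a) with hJdef
  have hJ1 : J ≤ FF J 1 := by simpa using pow_le_FF J 1
  obtain ⟨e0', he0'⟩ : ∃ e0' : ℕ, Module.length R (R ⧸ J) = e0' := by
    obtain ⟨k, hk⟩ := hm
    have := artin_of_pow_le J k hk
    have : IsArtinian R (R ⧸ J) := by
      exact isArtinian_of_surjective_algebraMap (S := R) (R := R ⧸ J) (M := R ⧸ J) Ideal.Quotient.mk_surjective
    have h : Module.length R (R ⧸ J) ≠ ⊤ := Module.length_ne_top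
    exact ⟨_, (ENat.coe_toNat h).symm⟩
  have hB := length_BJpow hQ e0' (L 0) he0' (FF J 1) hJ1 (hL 0)
  have hle : ∀ n, FF J 1 * J ^ n ≤ FF J (n + 1) := fun n =>
    (Ideal.mul_mono_right (pow_le_FF J n)).trans (by rw [add_comm]; exact FF_mul_le J 1 n)
  have hMN : ∀ n, Module.length R (Submodule.map (Submodule.mkQ (FF J 1 * J ^ n)) (FF J (n + 1))) + (L n : ℕ∞) = 
      (((n + D).choose D * L 0 + (n + D).choose (D + 1) * e0' : ℕ) : ℕ∞) := by
    intro n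
    rw [← hB n, length_quot (hle n), hL n]
  have hfin : ∀ n, ∃ m : ℕ, Module.length R (Submodule.map (Submodule.mkQ (FF J 1 * J ^ n)) (FF J (n + 1))) = m := by
    intro n
    have h : Module.length R (Submodule.map (Submodule.mkQ (FF J 1 * J ^ n)) (FF J (n + 1))) ≠ ⊤ := by
      intro h
      have := hMN n
      rw [h, top_add] at this
      exact ENat.coe_ne_top _ this.symm
    exact ⟨_, (ENat.coe_toNat h).symm⟩
  choose mn hmn using hfin
  have hMN' : ∀ n, (mn n : ℤ) + L n = ((n + D).choose D : ℤ) * L 0 + ((n + D).choose (D + 1) : ℤ) * e0' := by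
    intro n
    have := hMN n
    rw [hmn] at this
    exact_mod_cast this
  have hpas : ∀ n, ((n + D).choose (D + 1) : ℤ) = ((n + (D + 1)).choose (D + 1) : ℤ) - ((n + D).choose D : ℤ) := by
    intro n
    rw [show n + (D + 1) = n + D + 1 by ring, Nat.choose_succ_succ]; push_cast; ring
  have hmnf : ∀ n ≥ N0, (mn n : ℤ) = (e0' - e 0) * ((n + (D + 1)).choose (D + 1) : ℤ) + PB D (fun i => ((L 0 : ℤ) - e0') * dl i - (-1) ^ (i + 1) * e (i + 1)) n := by
    intro n hn
    have h1 := hMN' n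
    rw [hpas, hLe n hn, PB_split] at h1
    rw [PB_sub, PB_dl]
    simp only [pow_zero, one_mul] at h1
    linarith
  have hge : e 0 ≤ e0' := by
    have := PB_nonneg (D := D + 1) (c := fun i => if i = 0 then (e0' : ℤ) - e 0 else ((L 0 : ℤ) - e0') * dl (i - 1) - (-1) ^ i * e i) N0 (by
      intro n hn
      rw [PB_split]
      simp only [↓reduceIte, Nat.add_eq_zero_iff, one_ne_zero, and_false, Nat.add_sub_cancel]
      rw [← hmnf n hn]; positivity)
    simpa using this
  have hle2 : (e0' : ℤ) ≤ e 0 := by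
    obtain ⟨N, hN⟩ := FF_rees hQ hJ i hm C0 hC hAU
    have hk : ∀ k, FF J (N + k) ≤ J ^ k := by
      intro k
      induction k with
      | zero => simp
      | succ k ih =>
        rw [hN (N + (k + 1)) (by omega), pow_succ', show N + (k + 1) - 1 = N + k by omega]
        exact Ideal.mul_mono_right ih
    have := PB_nonneg (D := D + 1) (c := fun i => (-1) ^ i * e i - (shc^[N] (fun i => e0' * dl i)) i) (max N N0) (by
      intro n hn
      obtain ⟨m, rfl⟩ := Nat.exists_eq_add_of_le' (le_trans (le_max_left _ _) hn)
      rw [PB_sub, PB_shc_iter, ← hLe _ (le_trans (le_max_right _ _) hn), PB_dl]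
      have h1 : Module.length R (R ⧸ J ^ (m + 1)) ≤ Module.length R (R ⧸ FF J (m + N + 1)) := by
        have : FF J (m + N + 1) ≤ J ^ (m + 1) := by
          have := hk (m + 1); rwa [show m + N + 1 = N + (m + 1) by ring]
        exact Module.length_le_of_surjective (Submodule.factor this) (Submodule.factor_surjective this)
      rw [hL, length_Jpow hQ e0' he0', show m + 1 + D = m + (D + 1) by ring] at h1
      have h2 : (m + (D + 1)).choose (D + 1) * e0' ≤ L (m + N) := by exact_mod_cast h1
      have h3 : (((m + (D + 1)).choose (D + 1) : ℕ) : ℤ) * (e0' : ℤ) ≤ (L (m + N) : ℤ) := by exact_mod_cast h2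
      linarith)
    simp only [pow_zero, one_mul, shc_iter_zero] at this
    simp [dl] at this
    exact this
  have heq : (e0' : ℤ) = e 0 := le_antisymm hle2 hge
  refine ⟨mn, fun i => ((L 0 : ℤ) - e0') * dl i - (-1) ^ (i + 1) * e (i + 1), N0, hmn, fun n hn => ?_, ?_, ?_⟩
  · rw [hmnf n hn, heq, sub_self, zero_mul, zero_add]
  · simp [dl, heq, he1]
  · simp [dl, he3]

end
end NHC

namespace NHC

section
variable {R : Type*} [CommRing R] {M : Type*} [AddCommGroup M] [Module R M]
theorem length_le_of_ker {N P : Type*} [AddCommGroup N] [Module R N] [AddCommGroup P] [Module R P]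
    (f : M →ₗ[R] N) (g : M →ₗ[R] P) (hg : Function.Surjective g)
    (h : LinearMap.ker f ≤ LinearMap.ker g) : Module.length R P ≤ Module.length R N := by
  have e1 := (f.quotKerEquivRange).length_eq
  have e2 := (g.quotKerEquivOfSurjective hg).length_eq
  rw [← e2]
  refine (Module.length_le_of_surjective (Submodule.factor h) (Submodule.factor_surjective h)).trans ?_
  rw [e1]
  exact Module.length_le_of_injective _ (Submodule.subtype_injective _)
end

section
variable {R : Type*} [CommRing R] [IsLocalRing R] [IsNoetherianRing R] {D : ℕ} {a : Fin (D + 1) → R}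

omit [IsLocalRing R] [IsNoetherianRing R] in
theorem mono_BB {𝔟 : Ideal R} {n : ℕ} {x : R} : monomial n x ∈ BB a 𝔟 ↔ x ∈ 𝔟 * Ideal.span (Set.range a) ^ n := by
  constructor
  · intro h; have := h n; rwa [coeff_monomial, if_pos rfl] at this
  · intro h k
    rw [coeff_monomial]
    split_ifs with e
    · rw [← e]; exact h
    · exact zero_mem _

omit [IsNoetherianRing R] in
theorem length_res : Module.length R (R ⧸ maximalIdeal R) = 1 := by
  have : IsSimpleModule R (R ⧸ maximalIdeal R) := isSimpleModule_iff_quot_maximal.mpr ⟨_, inferInstance, ⟨LinearEquiv.refl _ _⟩⟩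
  exact Module.length_eq_one R _

/-- multiplication map -/
noncomputable def thm (K N P : Ideal R) (y : R) (h1 : ∀ x ∈ P, x * y ∈ N) : P →ₗ[R] Submodule.map (Submodule.mkQ K) N :=
  LinearMap.codRestrict _ ((Submodule.mkQ K).comp ((LinearMap.mulRight R y).comp P.subtype)) (fun x => 
    Submodule.mem_map_of_mem (f := Submodule.mkQ K) (h1 _ x.2))

omit [IsLocalRing R] [IsNoetherianRing R] in
theorem mem_ker_thm (K N P : Ideal R) (y : R) (h1 : ∀ x ∈ P, x * y ∈ N) (x : P) : x ∈ LinearMap.ker (thm K N P y h1) ↔ (x : R) * y ∈ K := by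
  rw [LinearMap.mem_ker, ← Submodule.coe_eq_zero]
  exact Submodule.Quotient.mk_eq_zero K

/-- quotient map -/
noncomputable def zem (K P : Ideal R) : P →ₗ[R] Submodule.map (Submodule.mkQ K) P :=
  LinearMap.codRestrict _ ((Submodule.mkQ K).comp P.subtype) (fun x => Submodule.mem_map_of_mem (f := Submodule.mkQ K) x.2)

omit [IsLocalRing R] [IsNoetherianRing R] in
theorem mem_ker_zem (K P : Ideal R) (x : P) : x ∈ LinearMap.ker (zem K P) ↔ (x : R) ∈ K := by
  rw [LinearMap.mem_ker, ← Submodule.coe_eq_zero]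
  exact Submodule.Quotient.mk_eq_zero K

omit [IsLocalRing R] [IsNoetherianRing R] in
theorem zem_surj (K P : Ideal R) : Function.Surjective (zem K P) := by
  rintro ⟨_, x, hx, rfl⟩
  exact ⟨⟨x, hx⟩, rfl⟩

variable (hQ : QR a) (hJ : Ideal.span (Set.range a) ≤ maximalIdeal R) (i : Fin (D + 1))
    (hm : ∃ k, maximalIdeal R ^ k ≤ Ideal.span (Set.range a))

include hQ hJ in
omit [IsNoetherianRing R] in
theorem len_J_mJ (s : ℕ) : Module.length R (Submodule.map (Submodule.mkQ (maximalIdeal R * Ideal.span (Set.range a) ^ s)) (Ideal.span (Set.range a) ^ s)) = ((s + D).choose D : ℕ) := by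
  rw [length_gr hQ _ hJ, length_res, mul_one, show D + 1 + s - 1 = s + D by omega, Nat.choose_symm_add]

include hQ hJ in
omit [IsNoetherianRing R] in
theorem len_ge (K N : Ideal R) (y : R) (s : ℕ) (h1 : ∀ x ∈ Ideal.span (Set.range a) ^ s, x * y ∈ N)
    (h2 : ∀ x ∈ Ideal.span (Set.range a) ^ s, x * y ∈ K → x ∈ maximalIdeal R * Ideal.span (Set.range a) ^ s) :
    (((s + D).choose D : ℕ) : ℕ∞) ≤ Module.length R (Submodule.map (Submodule.mkQ K) N) := by
  rw [← len_J_mJ hQ hJ s]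
  refine length_le_of_ker (thm K N _ y h1) (zem _ _) (zem_surj _ _) fun x hx => ?_
  rw [mem_ker_thm] at hx
  rw [mem_ker_zem]
  exact h2 _ x.2 hx

omit [IsNoetherianRing R] in
theorem eval_notWW {s : ℕ} {g : MvPolynomial (Fin (D + 1)) R} (hg : g.IsHomogeneous s) (h : g ∉ WW R (D + 1)) :
    MvPolynomial.eval a g ∈ maximalIdeal R * Ideal.span (Set.range a) ^ s := by
  have := phi_mem a _ g (notMem_WW.mp h) s
  rwa [phi_homog a hg, coeff_monomial, if_pos rfl] at this

variable (𝔟 : Ideal R) (hb : Ideal.span (Set.range a) ≤ 𝔟) (F : ℕ → Ideal R)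
    (hbF : ∀ n, 𝔟 * Ideal.span (Set.range a) ^ n ≤ F n) (hJF : ∀ m n, Ideal.span (Set.range a) ^ m * F n ≤ F (m + n))
    (mn : ℕ → ℕ) (b : ℕ → ℤ) (N : ℕ)
    (hmn : ∀ n, Module.length R (Submodule.map (Submodule.mkQ (𝔟 * Ideal.span (Set.range a) ^ n)) (F n)) = mn n)
    (hfin : ∀ n, Module.length R (R ⧸ F n) ≠ ⊤)
    (hmb : ∀ n ≥ N, (mn n : ℤ) = PB D b n) (hb0 : b 0 = 1)

include hQ hJ i hb hbF hJF hmn hfin hmb hb0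

theorem Rk (m n : ℕ) (u v : R) (hu : u ∈ F m) (hu' : u ∉ 𝔟 * Ideal.span (Set.range a) ^ m) (hv : v ∈ F n) :
    ∃ g ∈ WW R (D + 1), ∃ f, phi a g * monomial n v - phi a f * monomial m u ∈ BB a 𝔟 := by
  set J := Ideal.span (Set.range a) with hJdef
  by_contra H
  push Not at H
  have key : ∀ t, ((t + n + D).choose D) + ((t + m + D).choose D) ≤ mn (t + m + n) := by
    intro t
    set K := 𝔟 * J ^ (t + m + n) with hK
    set U := K ⊔ J ^ (t + n) * Ideal.span {u} with hU
    have hUF : U ≤ F (t + m + n) := by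
      refine sup_le (hbF _) ?_
      refine (Ideal.mul_mono_right ((Ideal.span_singleton_le_iff_mem _).mpr hu)).trans ?_
      have := hJF (t + n) m
      rwa [show t + n + m = t + m + n by ring] at this
    have h1 : (((t + n + D).choose D : ℕ) : ℕ∞) ≤ Module.length R (Submodule.map (Submodule.mkQ K) U) := by
      refine len_ge hQ hJ K U u (t + n) (fun x hx => Ideal.mem_sup_right (Ideal.mul_mem_mul hx (Ideal.mem_span_singleton_self u))) ?_
      intro x hx hxu
      obtain ⟨g, hg, rfl⟩ := lift_homog1 a _ x hx
      refine eval_notWW hg fun hgW => hu' ?_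
      refine mono_BB.mp (BB_cancel hQ i 𝔟 hb hgW _ ?_)
      rw [phi_homog a hg, monomial_mul_monomial, mono_BB]
      rwa [show t + n + m = t + m + n by ring]
    have h2 : (((t + m + D).choose D : ℕ) : ℕ∞) ≤ Module.length R (Submodule.map (Submodule.mkQ U) (F (t + m + n))) := by
      refine len_ge hQ hJ U _ v (t + m) (fun x hx => hJF _ _ (Ideal.mul_mem_mul hx hv)) ?_
      intro x hx hxv
      obtain ⟨g, hg, rfl⟩ := lift_homog1 a _ x hx
      refine eval_notWW hg fun hgW => ?_
      obtain ⟨y, hy, z, hz, e⟩ := Submodule.mem_sup.mp hxv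
      obtain ⟨w, hw, rfl⟩ := Ideal.mem_mul_span_singleton.mp hz
      obtain ⟨f, hf, rfl⟩ := lift_homog1 a _ w hw
      refine H g hgW f ?_
      rw [phi_homog a hg, phi_homog a hf, monomial_mul_monomial, monomial_mul_monomial, ← e,
        show t + n + m = t + m + n by ring, ← map_sub, add_sub_cancel_right, mono_BB]
      exact hy
    have h3 := length_quot (hbF (t + m + n))
    have h4 := length_quot (M := R) (K := K) (N := U) le_sup_left
    have h5 := length_quot hUF
    rw [h4, h5, ← add_assoc] at h3
    have h6 := ((ENat.add_left_injective_of_ne_top (hfin (t + m + n))) h3)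
    rw [hmn] at h6
    have h7 := add_le_add h1 h2
    rw [h6] at h7
    exact_mod_cast h7
  have := PB_nonneg (D := D) (c := fun i => b i - ((shc^[m] dl) i + (shc^[n] dl) i)) (N + m + n) (by
    intro l hl
    obtain ⟨t, rfl⟩ : ∃ t, l = t + m + n := ⟨l - m - n, by omega⟩
    rw [PB_sub, PB_add, ← hmb _ (by omega)]
    have e1 : PB D (shc^[m] dl) (t + m + n) = ((t + n + D).choose D : ℤ) := by
      rw [show t + m + n = t + n + m by ring, PB_shc_iter, PB_dl']
    have e2 : PB D (shc^[n] dl) (t + m + n) = ((t + m + D).choose D : ℤ) := by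
      rw [PB_shc_iter, PB_dl']
    rw [e1, e2]
    have := key t
    have : (((t + n + D).choose D : ℕ) : ℤ) + ((t + m + D).choose D : ℕ) ≤ mn (t + m + n) := by exact_mod_cast this
    linarith)
  simp [shc_iter_zero, hb0, dl] at this

theorem mM (n : ℕ) (u r : R) (hu : u ∈ F n) (hr : r ∈ maximalIdeal R) : r * u ∈ 𝔟 * Ideal.span (Set.range a) ^ n := by
  by_contra h
  obtain ⟨g, hg, f, hf⟩ := Rk hQ hJ i 𝔟 hb F hbF hJF mn b N hmn hfin hmb hb0 n n (r * u) u (Ideal.mul_mem_left _ _ hu) h hu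
  have e : phi a g * monomial n u - phi a f * monomial n (r * u) = phi a (g - MvPolynomial.C r * f) * monomial n u := by
    rw [map_sub, ← C_mul_monomial, map_mul (phi a), phi_C]; ring
  rw [e] at hf
  have hW : g - MvPolynomial.C r * f ∈ WW R (D + 1) := by
    rw [mem_WW] at hg ⊢
    rw [map_sub, map_mul, MvPolynomial.map_C, (residue_eq_zero_iff r).mpr hr]
    simpa using hg
  exact h (Ideal.mul_mem_left _ _ (mono_BB.mp (BB_cancel hQ i 𝔟 hb hW _ hf)))

theorem mC_BB (f : MvPolynomial (Fin (D + 1)) R) (hf : f ∈ (maximalIdeal R).map (MvPolynomial.C (σ := Fin (D + 1)))) (p : R[X]) (hp : ∀ n, p.coeff n ∈ F n) :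
    phi a f * p ∈ BB a 𝔟 := by
  intro n
  rw [coeff_mul]
  refine sum_mem fun x hx => ?_
  rw [HasAntidiagonal.mem_antidiagonal] at hx
  have h1 := phi_mem a _ f hf x.1
  refine Submodule.mul_induction_on h1 ?_ ?_
  · intro r hr y hy
    have := mM hQ hJ i 𝔟 hb F hbF hJF mn b N hmn hfin hmb hb0 x.2 _ r (hp x.2) hr
    rw [← hx, pow_add, mul_left_comm, mul_comm r y, mul_assoc]
    exact Ideal.mul_mem_mul hy this
  · intro y z hy hz; rw [add_mul]; exact add_mem hy hz

end
end NHC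

namespace NHC

section
variable {R : Type*} [CommRing R] [IsLocalRing R] [IsNoetherianRing R] {D : ℕ} {a : Fin (D + 1) → R}
  (hQ : QR a) (hJ : Ideal.span (Set.range a) ≤ maximalIdeal R) (i : Fin (D + 1))
    (hm : ∃ k, maximalIdeal R ^ k ≤ Ideal.span (Set.range a))
variable (𝔟 : Ideal R) (hb : Ideal.span (Set.range a) ≤ 𝔟) (F : ℕ → Ideal R)
    (hbF : ∀ n, 𝔟 * Ideal.span (Set.range a) ^ n ≤ F n) (hJF : ∀ m n, Ideal.span (Set.range a) ^ m * F n ≤ F (m + n))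
    (mn : ℕ → ℕ) (b : ℕ → ℤ) (N : ℕ)
    (hmn : ∀ n, Module.length R (Submodule.map (Submodule.mkQ (𝔟 * Ideal.span (Set.range a) ^ n)) (F n)) = mn n)
    (hfin : ∀ n, Module.length R (R ⧸ F n) ≠ ⊤)
    (hmb : ∀ n ≥ N, (mn n : ℤ) = PB D b n) (hb0 : b 0 = 1)
    (hcan : ∀ g ∈ WW R (D + 1), ∀ z : R[X], (∀ n, (phi a g * z).coeff n ∈ F n) → ∀ n, z.coeff n ∈ F n)

include hQ hJ i hm hb hbF hJF hmn hfin hmb hb0 hcan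

theorem cyc (q : ℕ) (u v : R) (hu : u ∈ F q) (hu' : u ∉ 𝔟 * Ideal.span (Set.range a) ^ q)
    (hmin : ∀ n < q, F n ≤ 𝔟 * Ideal.span (Set.range a) ^ n) (n : ℕ) (hv : v ∈ F n) :
    ∃ f, monomial n v - phi a f * monomial q u ∈ BB a 𝔟 := by
  set J := Ideal.span (Set.range a) with hJdef
  have mc := mC_BB hQ hJ i 𝔟 hb F hbF hJF mn b N hmn hfin hmb hb0
  obtain ⟨g0, hg0, f0, hgf0⟩ := Rk hQ hJ i 𝔟 hb F hbF hJF mn b N hmn hfin hmb hb0 q n u v hu hu' hv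
  have hmono : ∀ {n x}, x ∈ F n → ∀ k, (monomial n x : R[X]).coeff k ∈ F k := by
    intro n x hx k
    rw [coeff_monomial]; split_ifs with e
    · rw [← e]; exact hx
    · exact zero_mem _
  set uu : R[X] := monomial q u with huu
  set vv : R[X] := monomial n v with hvv
  have huN := hmono hu
  have hvN := hmono hv
  obtain ⟨g1, f1, c1, hrp, hg1, hf1⟩ := UniqueFactorizationMonoid.exists_reduced_factors (MvPolynomial.map (residue R) g0) (mem_WW.mp hg0) (MvPolynomial.map (residue R) f0)
  obtain ⟨g, rfl⟩ := exists_lift_res g1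
  obtain ⟨f, rfl⟩ := exists_lift_res f1
  obtain ⟨c, rfl⟩ := exists_lift_res c1
  have hcg : MvPolynomial.map (residue R) (c * g) ≠ 0 := by rw [map_mul, hg1]; exact mem_WW.mp hg0
  rw [map_mul] at hcg
  have hc : c ∈ WW R (D + 1) := mem_WW.mpr (left_ne_zero_of_mul hcg)
  have hg : g ∈ WW R (D + 1) := mem_WW.mpr (right_ne_zero_of_mul hcg)
  have h1 : phi a f * uu - phi a g * vv ∈ BB a 𝔟 := by
    refine BB_cancel hQ i 𝔟 hb hc _ ?_
    have e1 := mc (c * g - g0) (sub_mem_mC (by rw [map_mul, hg1])) vv hvN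
    have e2 := mc (c * f - f0) (sub_mem_mC (by rw [map_mul, hf1])) uu huN
    have := sub_mem (sub_mem e2 e1) hgf0
    convert this using 1
    simp only [map_sub, map_mul]; ring
  obtain ⟨z, hz1, hz2⟩ := S2_main hQ hm hg hrp.symm 𝔟 hb uu vv h1
  have hzN : ∀ n, z.coeff n ∈ F n := by
    refine hcan g hg z fun n => ?_
    have e : phi a g * z = uu - (uu - phi a g * z) := by ring
    rw [e, coeff_sub]
    exact sub_mem (huN n) (hbF n (hz1 n))
  -- the top degree of `z`
  have hzB : z ∉ BB a 𝔟 := by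
    intro h
    apply hu'
    rw [← mono_BB]
    have := add_mem hz1 (phi_mul_BB a g h)
    simpa using this
  have hdeg : (MvPolynomial.map (residue R) g).totalDegree = 0 := by
    set m := (MvPolynomial.map (residue R) g).totalDegree with hmdef
    -- largest bad index
    have hex : ∃ n, z.coeff n ∉ 𝔟 * J ^ n := by
      by_contra h; push Not at h; exact hzB h
    have hlarge : ∃ n0, z.coeff n0 ∉ 𝔟 * J ^ n0 ∧ ∀ k > n0, z.coeff k ∈ 𝔟 * J ^ k := by
      classical
      have hbd : ∀ k, z.coeff k ∉ 𝔟 * J ^ k → k ≤ z.natDegree := by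
        intro k hk
        by_contra h
        exact hk (by rw [coeff_eq_zero_of_natDegree_lt (by omega)]; exact zero_mem _)
      obtain ⟨n1, hn1⟩ := hex
      refine ⟨Nat.findGreatest (fun k => z.coeff k ∉ 𝔟 * J ^ k) z.natDegree, Nat.findGreatest_spec (P := fun k => z.coeff k ∉ 𝔟 * J ^ k) (hbd _ hn1) hn1, ?_⟩
      intro k hk
      by_contra hk2
      exact Nat.findGreatest_is_greatest hk (hbd k hk2) hk2
    obtain ⟨n0, hn0, hn0'⟩ := hlarge
    have hq : q ≤ n0 := by
      by_contra h
      exact hn0 (hmin n0 (by omega) (hzN n0))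
    by_contra hm0
    have h3 : (phi a g * z).coeff (m + n0) ∈ 𝔟 * J ^ (m + n0) := by
      have := hz1 (m + n0)
      rw [coeff_sub, huu, coeff_monomial, if_neg (by omega), zero_sub] at this
      exact neg_mem_iff.mp this
    rw [coeff_mul, ← Finset.add_sum_erase _ _ (a := (m, n0)) (by simp)] at h3
    have h4 : ∑ x ∈ (antidiagonal (m + n0)).erase (m, n0), (phi a g).coeff x.1 * z.coeff x.2 ∈ 𝔟 * J ^ (m + n0) := by
      refine sum_mem fun x hx => ?_
      rw [Finset.mem_erase, HasAntidiagonal.mem_antidiagonal] at hx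
      obtain ⟨hx1, hx2⟩ := hx
      rcases Nat.lt_or_ge m x.1 with h5 | h5
      · have h6 : MvPolynomial.homogeneousComponent x.1 g ∈ (maximalIdeal R).map (MvPolynomial.C (σ := Fin (D + 1))) := by
          rw [MvPolynomial.mem_map_C_iff]
          intro c
          rw [MvPolynomial.coeff_homogeneousComponent]
          split_ifs with hc
          · rw [← residue_eq_zero_iff, ← MvPolynomial.coeff_map]
            apply MvPolynomial.coeff_eq_zero_of_totalDegree_lt
            rw [← Finsupp.degree_apply, hc]; exact h5
          · exact zero_mem _
        have h7 := mc _ h6 (monomial x.2 (z.coeff x.2)) (hmono (hzN x.2))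
        rw [phi_homog a (MvPolynomial.homogeneousComponent_isHomogeneous x.1 g), monomial_mul_monomial, mono_BB, hx2] at h7
        rwa [phi_coeff]
      · have h6 : n0 < x.2 := by
          by_contra h6
          exact hx1 (Prod.ext (by simp; omega) (by simp; omega))
        rw [← hx2, pow_add, mul_left_comm]
        exact Ideal.mul_mem_mul (phi_mem_rees a g x.1) (hn0' _ h6)
    have h5 := (Submodule.add_mem_iff_left _ h4).mp h3
    simp only at h5
    rw [phi_coeff] at h5
    have hW : MvPolynomial.homogeneousComponent m g ∈ WW R (D + 1) := by
      rw [mem_WW_iff]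
      obtain ⟨c, hc, hcm⟩ := Finset.exists_mem_eq_sup (MvPolynomial.map (residue R) g).support
        (MvPolynomial.support_nonempty.mpr (mem_WW.mp hg)) (fun s => s.sum fun _ e => e)
      refine ⟨c, ?_⟩
      rw [MvPolynomial.coeff_homogeneousComponent, if_pos]
      · rw [MvPolynomial.mem_support_iff, MvPolynomial.coeff_map] at hc
        exact (residue_ne_zero_iff_isUnit _).mp hc
      · rw [hmdef, MvPolynomial.totalDegree, hcm]; rfl
    apply hn0
    rw [← mono_BB]
    refine BB_cancel hQ i 𝔟 hb hW _ ?_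
    rwa [phi_homog a (MvPolynomial.homogeneousComponent_isHomogeneous m g), monomial_mul_monomial, mono_BB]
  rw [MvPolynomial.totalDegree_eq_zero_iff_eq_C] at hdeg
  set c0 := MvPolynomial.coeff 0 (MvPolynomial.map (residue R) g) with hc0
  have hc0' : c0 ≠ 0 := by
    intro h; rw [h, map_zero] at hdeg; exact mem_WW.mp hg hdeg
  obtain ⟨r, hr⟩ := residue_surjective (R := R) (c0⁻¹)
  have h6 : MvPolynomial.C r * g - 1 ∈ (maximalIdeal R).map (MvPolynomial.C (σ := Fin (D + 1))) := by
    refine sub_mem_mC ?_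
    rw [map_mul, MvPolynomial.map_C, hr, hdeg, ← map_mul, inv_mul_cancel₀ hc0', map_one, map_one]
  have h7 := mc _ h6 vv hvN
  refine ⟨MvPolynomial.C r * f, ?_⟩
  have h8 := phi_mul_BB a (MvPolynomial.C r) h1
  have := sub_mem (neg_mem h7) h8
  convert this using 1
  simp only [map_sub, map_mul, map_one]; ring


theorem redq (hF0 : F 0 = 𝔟) (hD : 2 ≤ D) (hb2 : b 2 = 0) :
    ∃ w ∈ F 1, w ∉ 𝔟 * Ideal.span (Set.range a) ∧ (∀ r ∈ maximalIdeal R, r * w ∈ 𝔟 * Ideal.span (Set.range a)) ∧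
      ∀ n, F (n + 1) ≤ 𝔟 * Ideal.span (Set.range a) ^ (n + 1) ⊔ Ideal.span (Set.range a) ^ n * Ideal.span {w} := by
  classical
  set J := Ideal.span (Set.range a) with hJdef
  have hex : ∃ q, ¬ F q ≤ 𝔟 * J ^ q := by
    by_contra h
    push Not at h
    have h0 : ∀ n, mn n = 0 := by
      intro n
      have h1 := hmn n
      have h2 : Module.length R (Submodule.map (Submodule.mkQ (𝔟 * J ^ n)) (F n)) = 0 := by
        rw [Module.length_eq_zero_iff, Submodule.subsingleton_iff_eq_bot, Submodule.eq_bot_iff]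
        rintro _ ⟨x, hx, rfl⟩
        exact (Submodule.Quotient.mk_eq_zero _).mpr (h n hx)
      rw [h2] at h1
      exact_mod_cast h1.symm
    have := PB_uniq D b N (fun n hn => by rw [← hmb n hn, h0]; rfl) 0 (Nat.zero_le _)
    omega
  set q := Nat.find hex with hq
  obtain ⟨u, hu, hu'⟩ := SetLike.not_le_iff_exists.mp (Nat.find_spec hex)
  have hmin : ∀ n < q, F n ≤ 𝔟 * J ^ n := fun n hn => not_not.mp (Nat.find_min hex hn)
  have hcyc := fun n v hv => cyc hQ hJ i hm 𝔟 hb F hbF hJF mn b N hmn hfin hmb hb0 hcan q u v hu hu' hmin n hv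
  have hgen : ∀ t, ∀ v ∈ F (t + q), ∃ x ∈ J ^ t, v - x * u ∈ 𝔟 * J ^ (t + q) := by
    intro t v hv
    obtain ⟨f, hf⟩ := hcyc _ v hv
    refine ⟨(phi a f).coeff t, phi_mem_rees a f t, ?_⟩
    have := hf (t + q)
    rwa [coeff_sub, coeff_monomial, if_pos rfl, coeff_mul_monomial] at this
  have hlen : ∀ t, mn (t + q) = (t + D).choose D := by
    intro t
    have h1 : ∀ x ∈ J ^ t, x * u ∈ F (t + q) := fun x hx => hJF _ _ (Ideal.mul_mem_mul hx hu)
    have : Module.length R (Submodule.map (Submodule.mkQ (𝔟 * J ^ (t + q))) (F (t + q))) = ((t + D).choose D : ℕ) := by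
      rw [← len_J_mJ hQ hJ t]
      refine length_eq_of_ker (thm _ _ _ u h1) (zem _ _) ?_ (zem_surj _ _) ?_
      · rintro ⟨_, v, hv, rfl⟩
        obtain ⟨x, hx, hxv⟩ := hgen t v hv
        refine ⟨⟨x, hx⟩, Subtype.ext ?_⟩
        exact ((Submodule.Quotient.eq _).mpr hxv).symm
      · ext ⟨x, hx⟩
        rw [mem_ker_thm, mem_ker_zem]
        constructor
        · intro h
          obtain ⟨g, hg, rfl⟩ := lift_homog1 a _ x hx
          refine eval_notWW hg fun hgW => hu' ?_
          refine mono_BB.mp (BB_cancel hQ i 𝔟 hb hgW _ ?_)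
          rw [phi_homog a hg, monomial_mul_monomial, mono_BB]
          exact h
        · intro h
          refine Submodule.mul_induction_on h ?_ ?_
          · intro r hr y hy
            have := mM hQ hJ i 𝔟 hb F hbF hJF mn b N hmn hfin hmb hb0 q u r hu hr
            rw [pow_add, mul_left_comm, mul_comm r y, mul_assoc]
            exact Ideal.mul_mem_mul hy this
          · intro y z hy hz; rw [add_mul]; exact add_mem hy hz
    rw [hmn] at this
    exact_mod_cast this
  have hbq : ∀ i ≤ D, b i = (-1) ^ i * (q.choose i : ℤ) := by
    intro i hi
    have := PB_uniq D (fun i => b i - (shc^[q] dl) i) (N + q) (fun n hn => by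
      obtain ⟨t, rfl⟩ : ∃ t, n = t + q := ⟨n - q, by omega⟩
      rw [PB_sub, PB_shc_iter, PB_dl', ← hmb _ (by omega), hlen, sub_self]) i hi
    rw [← shc_iter_dl]; linarith
  have hq1 : q = 1 := by
    have h2 := hbq 2 hD
    rw [hb2] at h2
    have h3 : q.choose 2 = 0 := by
      have : ((q.choose 2 : ℕ) : ℤ) = 0 := by linarith
      exact_mod_cast this
    have h4 : q < 2 := Nat.choose_eq_zero_iff.mp h3
    have h5 : q ≠ 0 := by
      intro h
      have := Nat.find_spec hex
      rw [← hq, h, hF0] at this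
      simp at this
    omega
  rw [← hq, hq1] at hu hu'
  rw [hq1] at hgen
  rw [pow_one] at hu'
  refine ⟨u, hu, hu', ?_, ?_⟩
  · intro r hr
    simpa using mM hQ hJ i 𝔟 hb F hbF hJF mn b N hmn hfin hmb hb0 1 u r hu hr
  · intro n v hv
    obtain ⟨x, hx, hxv⟩ := hgen n v hv
    have : v = (v - x * u) + x * u := by ring
    rw [this]
    exact Submodule.add_mem_sup hxv (Ideal.mul_mem_mul hx (Ideal.mem_span_singleton_self u))

end
end NHC

namespace NHC
section
theorem vs_exists {L : Type*} [Field L] (F : Subfield L) (t : L) (ht : ¬ IsIntegral F t) :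
    ∃ V : ValuationSubring L, (∀ c ∈ F, c ∈ V) ∧ t ∉ V := by
  by_contra hcon
  push Not at hcon
  apply ht
  have h := iInf_valuationSubring_superset (K := L) (s := (F : Set L))
  have h1 : t ∈ (⨅ V : {V : ValuationSubring L // (F : Set L) ⊆ V.toSubring}, V.1.toSubring) := by
    rw [Subring.mem_iInf]
    rintro ⟨V, hV⟩
    exact hcon V (fun c hc => hV hc)
  rw [h] at h1
  have h2 : IsIntegral (Subring.closure (F : Set L)) t := h1
  have h3 : Subring.closure (F : Set L) = F.toSubring := Subring.closure_eq F.toSubring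
  rw [h3] at h2
  exact h2

theorem inv_mem_of_notMem {L : Type*} [Field L] (V : ValuationSubring L) (t : L) (h : t ∉ V) : t⁻¹ ∈ V :=
  (V.mem_or_inv_mem t).resolve_left h

open scoped IntermediateField.algebraAdjoinAdjoin in
theorem field_lemma {k L ι : Type*} [Field k] [Field L] [Algebra k L] (x : ι → L) (hx : AlgebraicIndependent k x)
    (i0 : ι) (u : L)
    (h1 : ∀ V : ValuationSubring L, (∀ c, algebraMap k L c ∈ V) → (∀ i, x i ∈ V) → u ∈ V)
    (h2 : ∀ V : ValuationSubring L, (∀ c, algebraMap k L c ∈ V) → (∀ i, i ≠ i0 → x i ∈ V) → x i0 ∉ V → x i0 * u ∈ V) :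
    u = 0 := by
  set F := IntermediateField.adjoin k (x '' {i0}ᶜ) with hF
  have htr : Transcendental F (x i0) := by
    have := hx.transcendental_adjoin (s := {i0}ᶜ) (i := i0) (by simp)
    intro hal
    apply this
    exact (IsFractionRing.isAlgebraic_iff (Algebra.adjoin k (x '' {i0}ᶜ)) F L).mpr hal
  have hInt : ¬ IsIntegral F.toSubfield (x i0) := fun h => htr (IsIntegral.isAlgebraic (R := F) h)
  have hkF : ∀ V : ValuationSubring L, (∀ c ∈ F.toSubfield, c ∈ V) → ∀ c, algebraMap k L c ∈ V :=
    fun V hV c => hV _ (F.algebraMap_mem c)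
  have hxF : ∀ V : ValuationSubring L, (∀ c ∈ F.toSubfield, c ∈ V) → ∀ i, i ≠ i0 → x i ∈ V :=
    fun V hV i hi => hV _ (IntermediateField.subset_adjoin k _ ⟨i, by simpa using hi, rfl⟩)
  have hui : IsIntegral F.toSubfield u := by
    by_contra hu
    obtain ⟨V, hV, hVu⟩ := vs_exists _ u hu
    by_cases ht : x i0 ∈ V
    · refine hVu (h1 V (hkF V hV) fun i => ?_)
      by_cases hi : i = i0
      · rw [hi]; exact ht
      · exact hxF V hV i hi
    · have h3 := mul_mem (inv_mem_of_notMem V _ ht) (h2 V (hkF V hV) (hxF V hV) ht)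
      rw [inv_mul_cancel_left₀ (by rintro h; exact ht (h ▸ zero_mem V))] at h3
      exact hVu h3
  by_contra hu0
  obtain ⟨V, hV, hVt⟩ := vs_exists _ _ hInt
  have h3 := h2 V (hkF V hV) (hxF V hV) hVt
  have h4 : IsIntegral F.toSubfield u⁻¹ := hui.inv
  have h5 : u⁻¹ ∈ V := by
    have : IsIntegral V u⁻¹ := by
      obtain ⟨P, hP, hP2⟩ := h4
      refine ⟨P.map (Subring.inclusion (S := F.toSubfield.toSubring) (T := V.toSubring) hV), hP.map _, ?_⟩
      rw [eval₂_map]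
      exact hP2
    obtain ⟨y, hy⟩ := IsIntegrallyClosed.isIntegral_iff.mp this
    rw [← hy]; exact y.2
  have h6 := mul_mem h3 h5
  rw [mul_assoc, mul_inv_cancel₀ hu0, mul_one] at h6
  exact hVt h6

/-- one-sided Dirichlet approximation -/
theorem dirichlet_one (v : ℝ) (N : ℕ) (hN : 0 < N) : ∃ (k : ℕ) (p : ℤ), 0 < k ∧ (p : ℝ) ≤ v * k ∧ v * k < p + 1 / N := by
  obtain ⟨j, k, hk, hkn, h⟩ := Real.exists_int_int_abs_mul_sub_le v hN
  have hNr : (0 : ℝ) < N := by exact_mod_cast hN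
  have hlt : (1 : ℝ) / (N + 1) < 1 / N := by
    apply one_div_lt_one_div_of_lt hNr; linarith
  have hle1 : (1 : ℝ) / N ≤ 1 := by
    rw [div_le_one hNr]; exact_mod_cast hN
  lift k to ℕ using hk.le
  have hk' : 0 < k := by exact_mod_cast hk
  rw [abs_le] at h
  push_cast at h
  by_cases hs : (j : ℝ) ≤ v * k
  · exact ⟨k, j, hk', hs, by nlinarith [h.2]⟩
  · push Not at hs
    set ε := j - v * k with hε
    have he0 : 0 < ε := by rw [hε]; linarith
    have he1 : ε < 1 / N := by rw [hε]; nlinarith [h.1]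
    set m := ⌊1 / ε⌋₊ with hmd
    have hm1 : (m : ℝ) ≤ 1 / ε := Nat.floor_le (by positivity)
    have hm2 : 1 / ε < m + 1 := Nat.lt_floor_add_one _
    rw [le_div_iff₀ he0] at hm1
    rw [div_lt_iff₀ he0] at hm2
    have hm0 : 0 < m := by
      rcases Nat.eq_zero_or_pos m with h0 | h0
      · rw [h0] at hm2; push_cast at hm2; linarith
      · exact h0
    refine ⟨m * k, m * j - 1, Nat.mul_pos hm0 hk', ?_, ?_⟩
    · push_cast
      have : v * (m * k) = m * j - m * ε := by rw [hε]; ring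
      rw [this]; linarith
    · push_cast
      have : v * (m * k) = m * j - m * ε := by rw [hε]; ring
      rw [this]; linarith

theorem vbar (P : ℕ → ℕ → Prop) (h0 : P 0 1) (h1 : ∀ p k, 0 < k → P p k → p < k)
    (h2 : ∀ p k p' q, 0 < k → 0 < q → p * q ≤ p' * k → P p' q → P p k)
    (h3 : ∀ p k, 0 < k → (∀ l, 0 < l → P (l * p - 1) (l * k)) → P p k) (N : ℕ) (hN : 0 < N) :
    ∃ γ r, 0 < r ∧ P γ r ∧ ¬ P (N * γ + 1) (N * r) := by
  by_contra hcon
  push Not at hcon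
  set S : Set ℝ := {x | ∃ p q : ℕ, 0 < q ∧ P p q ∧ x = p / q} with hS
  have hbdd : BddAbove S := ⟨1, by
    rintro x ⟨p, q, hq, hp, rfl⟩
    have hq' : (0 : ℝ) < q := by exact_mod_cast hq
    rw [div_le_one hq']
    exact_mod_cast (h1 p q hq hp).le⟩
  set v := sSup S with hv
  have hmemS : ∀ p q : ℕ, 0 < q → P p q → (p : ℝ) ≤ v * q := by
    intro p q hq hp
    have hq' : (0 : ℝ) < q := by exact_mod_cast hq
    rw [← div_le_iff₀ hq']
    exact le_csSup hbdd ⟨p, q, hq, hp, rfl⟩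
  have hv0 : 0 ≤ v := by simpa using hmemS 0 1 one_pos h0
  have hlt : ∀ p k : ℕ, 0 < k → (p : ℝ) < v * k → P p k := by
    intro p k hk hp
    have hk' : (0 : ℝ) < k := by exact_mod_cast hk
    have : (p : ℝ) / k < v := by rwa [div_lt_iff₀ hk']
    obtain ⟨x, ⟨p', q, hq, hp', rfl⟩, hx⟩ := exists_lt_of_lt_csSup (⟨_, 0, 1, one_pos, h0, rfl⟩ : S.Nonempty) this
    have hq' : (0 : ℝ) < q := by exact_mod_cast hq
    rw [div_lt_div_iff₀ hk' hq'] at hx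
    exact h2 p k p' q hk hq (by exact_mod_cast hx.le) hp'
  have hle : ∀ p k : ℕ, 0 < k → (p : ℝ) ≤ v * k → P p k := by
    intro p k hk hp
    rcases hp.lt_or_eq with h | h
    · exact hlt p k hk h
    · refine h3 p k hk fun l hl => ?_
      rcases Nat.eq_zero_or_pos p with hp0 | hp0
      · subst hp0
        exact h2 _ _ 0 1 (by positivity) one_pos (by simp) h0
      · refine hlt _ _ (by positivity) ?_
        have : 1 ≤ l * p := Nat.mul_pos hl hp0
        push_cast [Nat.cast_sub this]
        have : v * (l * k) = l * p := by rw [h]; ring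
        rw [this]; linarith
  obtain ⟨k, p, hk, hp1, hp2⟩ := dirichlet_one v N hN
  have hNr : (0 : ℝ) < N := by exact_mod_cast hN
  have hp0 : 0 ≤ p := by
    have h4 : (0 : ℝ) ≤ v * k := by positivity
    have hle1 : (1 : ℝ) / N ≤ 1 := by
      rw [div_le_one hNr]; exact_mod_cast hN
    have : (-1 : ℝ) < p := by linarith
    have : (-1 : ℤ) < p := by exact_mod_cast this
    omega
  lift p to ℕ using hp0
  have h5 := hcon p k hk (hle p k hk (by exact_mod_cast hp1))
  have h6 := hmemS _ _ (by positivity) h5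
  push_cast at h6
  have h7 : v * k * N < (p + 1 / N) * N := mul_lt_mul_of_pos_right (by exact_mod_cast hp2) hNr
  have h8 : ((p : ℝ) + 1 / N) * N = N * p + 1 := by field_simp
  rw [h8] at h7
  nlinarith
end
end NHC

namespace NHC
section
variable {R : Type*} [CommRing R] [IsLocalRing R] {d : ℕ} {a : Fin d → R}
  [Algebra (MvPolynomial (Fin d) R) R[X]] (hal : ∀ g, algebraMap (MvPolynomial (Fin d) R) R[X] g = phi a g)
  (A : Subalgebra (MvPolynomial (Fin d) R) R[X]) (hA : ∀ p, p ∈ A ↔ p ∈ AA (Ideal.span (Set.range a)))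
  (K : Ideal A) (hK : ∀ p : A, p ∈ K ↔ ∀ n, (p : R[X]).coeff n ∈ FF (Ideal.span (Set.range a)) (n + 1))
  {L : Type*} [Field L] (Φ : A →+* L) (V : ValuationSubring L)
  (hR : ∀ r : R, Φ (algebraMap (MvPolynomial (Fin d) R) A (MvPolynomial.C r)) ∈ V)

/-- the ideal of elements whose degree `n` initial form times `c` lies in `V` -/
noncomputable def QI (hal : ∀ g, algebraMap (MvPolynomial (Fin d) R) R[X] g = phi a g)
    (hR : ∀ r : R, Φ (algebraMap (MvPolynomial (Fin d) R) A (MvPolynomial.C r)) ∈ V) (n : ℕ) (c : L) : Ideal R where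
  carrier := {y | ∃ h : monomial n y ∈ A, Φ ⟨monomial n y, h⟩ * c ∈ V}
  zero_mem' := ⟨by simp, by
    have : (⟨monomial n (0 : R), by simp⟩ : A) = 0 := Subtype.ext (by simp)
    rw [this]; simp⟩
  add_mem' := by
    rintro x y ⟨hx, hx'⟩ ⟨hy, hy'⟩
    have h : monomial n (x + y) ∈ A := by rw [map_add]; exact add_mem hx hy
    refine ⟨h, ?_⟩
    have : (⟨monomial n (x + y), h⟩ : A) = ⟨monomial n x, hx⟩ + ⟨monomial n y, hy⟩ := Subtype.ext (by simp)
    rw [this, map_add, add_mul]; exact add_mem hx' hy'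
  smul_mem' := by
    rintro r y ⟨hy, hy'⟩
    have e : monomial n (r • y) = ((algebraMap (MvPolynomial (Fin d) R) A (MvPolynomial.C r) : A) : R[X]) * monomial n y := by
      rw [algMapA hal, phi_C, C_mul_monomial, smul_eq_mul]
    have h : monomial n (r • y) ∈ A := by rw [e]; exact mul_mem (SetLike.coe_mem _) hy
    refine ⟨h, ?_⟩
    have : (⟨monomial n (r • y), h⟩ : A) = algebraMap (MvPolynomial (Fin d) R) A (MvPolynomial.C r) * ⟨monomial n y, hy⟩ := Subtype.ext e
    rw [this, map_mul, mul_assoc]; exact mul_mem (hR r) hy'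

theorem mem_QI {n : ℕ} {c : L} {y : R} : y ∈ QI A Φ V hal hR n c ↔ ∃ h : monomial n y ∈ A, Φ ⟨monomial n y, h⟩ * c ∈ V := Iff.rfl

theorem QI_mul_mem {m n : ℕ} {c c' : L} {x y : R} (hx : x ∈ QI A Φ V hal hR m c) (hy : y ∈ QI A Φ V hal hR n c') :
    x * y ∈ QI A Φ V hal hR (m + n) (c * c') := by
  obtain ⟨hx, hx'⟩ := hx
  obtain ⟨hy, hy'⟩ := hy
  have e : (monomial (m + n) (x * y) : R[X]) = monomial m x * monomial n y := (monomial_mul_monomial _ _ _ _).symm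
  have h : monomial (m + n) (x * y) ∈ A := by rw [e]; exact mul_mem hx hy
  refine ⟨h, ?_⟩
  have : (⟨monomial (m + n) (x * y), h⟩ : A) = ⟨monomial m x, hx⟩ * ⟨monomial n y, hy⟩ := Subtype.ext e
  rw [this, map_mul, mul_mul_mul_comm]
  exact mul_mem hx' hy'

theorem QI_one : (1 : R) ∈ QI A Φ V hal hR 0 1 := by
  refine ⟨by rw [monomial_zero_one]; exact one_mem _, ?_⟩
  have : (⟨monomial 0 (1 : R), by rw [monomial_zero_one]; exact one_mem _⟩ : A) = 1 := Subtype.ext monomial_zero_one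
  rw [this]; simp

theorem QI_ai {c : L} (j : Fin d) (h : Φ (algebraMap (MvPolynomial (Fin d) R) A (MvPolynomial.X j)) * c ∈ V) :
    a j ∈ QI A Φ V hal hR 1 c := by
  have e : (monomial 1 (a j) : R[X]) = ((algebraMap (MvPolynomial (Fin d) R) A (MvPolynomial.X j) : A) : R[X]) := by
    rw [algMapA hal, phi_X, ← C_mul_X_eq_monomial]
  refine ⟨by rw [e]; exact SetLike.coe_mem _, ?_⟩
  convert h

theorem QI_prod {ι : Type*} (s : Finset ι) (f : ι → R) (n : ι → ℕ) (c : ι → L) (h : ∀ i ∈ s, f i ∈ QI A Φ V hal hR (n i) (c i)) :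
    ∏ i ∈ s, f i ∈ QI A Φ V hal hR (∑ i ∈ s, n i) (∏ i ∈ s, c i) := by
  classical
  induction s using Finset.induction_on with
  | empty => simpa using QI_one hal A Φ V hR
  | insert i s hi ih =>
    rw [Finset.prod_insert hi, Finset.prod_insert hi, Finset.sum_insert hi]
    exact QI_mul_mem hal A Φ V hR (h i (by simp)) (ih fun j hj => h j (by simp [hj]))

theorem QI_pow {τ : L} (hτ : ∀ j, Φ (algebraMap (MvPolynomial (Fin d) R) A (MvPolynomial.X j)) * τ ∈ V) (n : ℕ) :
    Ideal.span (Set.range a) ^ n ≤ QI A Φ V hal hR n (τ ^ n) := by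
  induction n with
  | zero =>
    have := QI_one hal A Φ V hR
    rw [pow_zero, pow_zero, (Ideal.eq_top_iff_one _).mpr this]
    exact le_top
  | succ n ih =>
    rw [pow_succ, pow_succ]
    refine Ideal.mul_le.mpr fun x hx y hy => QI_mul_mem hal A Φ V hR (ih hx) ?_
    refine (Ideal.span_le.mpr ?_) hy
    rintro _ ⟨j, rfl⟩
    exact QI_ai hal A Φ V hR j (hτ j)

include hA in
theorem QI_FF {τ : L} (hτ : ∀ j, Φ (algebraMap (MvPolynomial (Fin d) R) A (MvPolynomial.X j)) * τ ∈ V) (n : ℕ) :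
    FF (Ideal.span (Set.range a)) n ≤ QI A Φ V hal hR n (τ ^ n) := by
  intro y hy
  obtain ⟨l, hl, b, hb, hy0⟩ := FF_integral _ _ le_rfl n y hy
  have hyA : monomial n y ∈ A := (hA _).mpr hy
  refine ⟨hyA, ?_⟩
  set Y : L := Φ ⟨monomial n y, hyA⟩ * τ ^ n with hY
  by_contra hYV
  have hYi := inv_mem_of_notMem V _ hYV
  have hY0 : Y ≠ 0 := by rintro h; exact hYV (h ▸ zero_mem V)
  let b' : ℕ → R := fun j => if j ∈ Finset.Icc 1 l then b j else 0
  have hb' : ∀ j, b' j ∈ QI A Φ V hal hR (n * j) (τ ^ (n * j)) := by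
    intro j
    simp only [b']
    split_ifs with h
    · have := hb j h
      rw [← pow_mul] at this
      exact QI_pow hal A Φ V hR hτ _ this
    · exact zero_mem _
  have hb0 : ∀ j, monomial (n * j) (b' j) ∈ A := fun j => (hb' j).1
  let B : ℕ → L := fun j => Φ ⟨monomial (n * j) (b' j), hb0 j⟩ * τ ^ (n * j)
  have hB : ∀ j, B j ∈ V := fun j => (hb' j).2
  have heq : (⟨monomial n y, hyA⟩ : A) ^ l + ∑ j ∈ Finset.Icc 1 l, (⟨monomial (n * j) (b' j), hb0 j⟩ : A) * ⟨monomial n y, hyA⟩ ^ (l - j) = 0 := by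
    apply Subtype.ext
    push_cast
    have e1 : ∀ j ∈ Finset.Icc 1 l, (monomial (n * j) (b' j) : R[X]) * monomial n y ^ (l - j) = monomial (n * l) (b j * y ^ (l - j)) := by
      intro j hj
      have hj' := Finset.mem_Icc.mp hj
      rw [monomial_pow, monomial_mul_monomial, ← mul_add, Nat.add_sub_cancel' hj'.2]
      simp only [b', if_pos hj]
    rw [Finset.sum_congr rfl e1, monomial_pow, ← map_sum, ← map_add, hy0, map_zero]
  have heq2 : Y ^ l + ∑ j ∈ Finset.Icc 1 l, B j * Y ^ (l - j) = 0 := by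
    have e2 := congrArg (fun z => Φ z * τ ^ (n * l)) heq
    simp only [map_add, map_sum, map_mul, map_pow, map_zero, zero_mul, add_mul, Finset.sum_mul] at e2
    rw [← e2]
    congr 1
    · rw [hY, mul_pow, ← pow_mul]
    · refine Finset.sum_congr rfl fun j hj => ?_
      have hj' := Finset.mem_Icc.mp hj
      have : τ ^ (n * l) = τ ^ (n * j) * (τ ^ n) ^ (l - j) := by
        rw [← pow_mul, ← pow_add, ← mul_add, Nat.add_sub_cancel' hj'.2]
      rw [hY, mul_pow, this]
      simp only [B]
      ring
  have h3 : Y = - ∑ j ∈ Finset.Icc 1 l, B j * Y⁻¹ ^ (j - 1) := by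
    have e3 : Y = Y ^ l * Y⁻¹ ^ (l - 1) := by
      conv_rhs => rw [show l = (l - 1) + 1 by omega, Nat.add_sub_cancel, pow_succ', mul_assoc, ← mul_pow, mul_inv_cancel₀ hY0, one_pow, mul_one]
    conv_lhs => rw [e3, eq_neg_of_add_eq_zero_left heq2]
    rw [neg_mul, Finset.sum_mul]
    congr 1
    refine Finset.sum_congr rfl fun j hj => ?_
    have hj' := Finset.mem_Icc.mp hj
    have : Y⁻¹ ^ (l - 1) = Y⁻¹ ^ (l - j) * Y⁻¹ ^ (j - 1) := by rw [← pow_add]; congr 1; omega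
    rw [this, mul_assoc, ← mul_assoc (Y ^ (l - j)), ← mul_pow, mul_inv_cancel₀ hY0, one_pow, one_mul]
  apply hYV
  rw [h3]
  exact neg_mem (sum_mem fun j _ => mul_mem (hB j) (pow_mem hYi _))

include hA hK in
theorem QI_nil (hΦ : ∀ p ∈ K, Φ p = 0) {n r : ℕ} (hr : 0 < r) {c : L} {y : R} (hy : y ∈ FF (Ideal.span (Set.range a)) n)
    (h : y ^ r ∈ FF (Ideal.span (Set.range a)) (n * r + 1)) : y ∈ QI A Φ V hal hR n c := by
  have hyA : monomial n y ∈ A := (hA _).mpr hy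
  refine ⟨hyA, ?_⟩
  have : Φ ⟨monomial n y, hyA⟩ = 0 := by
    rw [← pow_eq_zero_iff hr.ne', ← map_pow]
    apply hΦ
    rw [hK]
    intro k
    push_cast
    rw [monomial_pow, coeff_monomial]
    split_ifs with hk
    · rw [← hk]; exact h
    · exact zero_mem _
  rw [this, zero_mul]
  exact zero_mem _

open scoped Pointwise in
include hal hR hA hK in
theorem core_h2 [IsNoetherianRing R] (hQ : QR a) (hJ : Ideal.span (Set.range a) ≤ maximalIdeal R)
    (hΦ : ∀ p ∈ K, Φ p = 0) (i0 : Fin d) (r γ : ℕ) (hγ : γ < r) (s : Fin d → R)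
    (hs : ∀ i, s i ^ r ∈ FF (Ideal.span (Set.range a)) γ)
    (hw : ∑ i, a i * s i ∈ FF (Ideal.span (Set.range a)) 2)
    (hT : ∀ j, j ≠ i0 → Φ (algebraMap (MvPolynomial (Fin d) R) A (MvPolynomial.X j)) ∈ V)
    (hT0 : Φ (algebraMap (MvPolynomial (Fin d) R) A (MvPolynomial.X i0)) ∉ V)
    (hu : monomial γ (s i0 ^ r) ∈ A) :
    Φ (algebraMap (MvPolynomial (Fin d) R) A (MvPolynomial.X i0)) * Φ ⟨monomial γ (s i0 ^ r), hu⟩ ∈ V := by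
  classical
  set J := Ideal.span (Set.range a) with hJd
  set t := Φ (algebraMap (MvPolynomial (Fin d) R) A (MvPolynomial.X i0)) with ht
  have ht0 : t ≠ 0 := by rintro h; exact hT0 (h ▸ zero_mem V)
  have hti := inv_mem_of_notMem V _ hT0
  have hr : 0 < r := by omega
  have hτ : ∀ j, Φ (algebraMap (MvPolynomial (Fin d) R) A (MvPolynomial.X j)) * t⁻¹ ∈ V := by
    intro j
    by_cases hj : j = i0
    · rw [hj, ← ht, mul_inv_cancel₀ ht0]; exact one_mem V
    · exact mul_mem (hT j hj) hti
  set w := ∑ i, a i * s i with hwd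
  set x := a i0 * s i0 with hx
  have ha1 : ∀ j, a j ∈ FF J 1 := fun j => pow_le_FF J 1 (by rw [pow_one]; exact ai_mem a j)
  have has : ∀ j, (a j * s j) ^ r ∈ FF J (r + γ) := by
    intro j
    rw [mul_pow]
    have := pow_mem_FF (ha1 j) r
    rw [one_mul] at this
    exact mul_mem_FF this (hs j)
  -- products of `r` of the `s j`
  have hprod : ∀ {n : ℕ} (e : Fin n → Fin d), (∏ j, s (e j)) ^ r ∈ FF J (γ * n) := by
    intro n e
    induction n with
    | zero => simp [FF_zero]
    | succ n ih =>
      rw [Fin.prod_univ_castSucc, mul_pow, mul_add, mul_one]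
      exact mul_mem_FF (ih _) (hs _)
  have hprod2 : ∀ {n : ℕ} (e : Fin n → Fin d), (∏ j, (a (e j) * s (e j))) ^ r ∈ FF J ((r + γ) * n) := by
    intro n e
    induction n with
    | zero => simp [FF_zero]
    | succ n ih =>
      rw [Fin.prod_univ_castSucc, mul_pow, mul_add, mul_one]
      exact mul_mem_FF (ih _) (has _)
  set E : Ideal R := Ideal.span (Set.range fun j => a j * s j) with hE
  have hxE : x ∈ E := Ideal.subset_span ⟨i0, rfl⟩
  have hwE : w ∈ E := sum_mem fun j _ => Ideal.subset_span ⟨j, rfl⟩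
  -- the nilpotent part
  have hnil : Ideal.span {w} * E ^ (r - 1) ≤ QI A Φ V hal hR (r + γ) (t⁻¹ ^ γ) := by
    rw [Ideal.span_singleton_mul_le_iff]
    intro z hz
    have hz' : z ∈ Submodule.span R ((Set.range fun j => a j * s j) ^ (r - 1)) := by
      rw [← Submodule.span_pow]; exact hz
    clear hz
    induction hz' using Submodule.span_induction with
    | mem z hz1 =>
      obtain ⟨f, rfl⟩ := Set.mem_pow.mp hz1
      choose e he using fun j => (f j).2
      have hfe : (List.ofFn fun j => (f j : R)).prod = ∏ j, (a (e j) * s (e j)) := by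
        rw [List.prod_ofFn]
        exact Finset.prod_congr rfl fun j _ => (he j).symm
      rw [hfe]
      have h1 : (w * ∏ j, (a (e j) * s (e j))) ^ r ∈ FF J ((r + γ) * r + 1) := by
        rw [mul_pow]
        have := mul_mem_FF (pow_mem_FF hw r) (hprod2 e)
        refine FF_anti hQ hJ i0 ?_ this
        obtain ⟨q, rfl⟩ : ∃ q, r = γ + q + 1 := ⟨r - γ - 1, by omega⟩
        simp only [Nat.add_sub_cancel]
        nlinarith
      exact QI_nil hal A hA K hK Φ V hR hΦ hr (of_pow_mem_FF hr (FF_anti hQ hJ i0 (Nat.le_succ _) h1)) h1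
    | zero => rw [mul_zero]; exact zero_mem _
    | add y z _ _ hy hz =>
      rw [mul_add]; exact add_mem hy hz
    | smul c y _ hy =>
      rw [smul_eq_mul, mul_left_comm]; exact Ideal.mul_mem_left _ _ hy
  have hz : x ^ r - (x - w) ^ r ∈ QI A Φ V hal hR (r + γ) (t⁻¹ ^ γ) := by
    apply hnil
    have : x ^ r - (x - w) ^ r = w * ∑ j ∈ range r, x ^ j * (x - w) ^ (r - 1 - j) := by
      rw [mul_comm w, ← geom_sum₂_mul x (x - w) r, sub_sub_cancel]
    rw [this]
    refine Ideal.mul_mem_mul (Ideal.mem_span_singleton_self w) (sum_mem fun j hj => ?_)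
    have hj' := Finset.mem_range.mp hj
    rw [show r - 1 = j + (r - 1 - j) by omega, pow_add]
    refine Ideal.mul_mem_mul (Ideal.pow_mem_pow hxE _) ?_
    rw [Nat.add_sub_cancel_left]
    exact Ideal.pow_mem_pow (sub_mem hxE hwE) _
  set E' : Ideal R := Ideal.span ((fun j => a j * s j) '' {i0}ᶜ) with hE'
  have hxw : x - w ∈ E' := by
    have : x - w = - ∑ j ∈ Finset.univ.erase i0, a j * s j := by
      rw [hwd, ← Finset.add_sum_erase _ _ (Finset.mem_univ i0)]; ring
    rw [this]
    exact neg_mem (sum_mem fun j hj => Ideal.subset_span ⟨j, by simpa using hj, rfl⟩)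
  have hmain : E' ^ r ≤ QI A Φ V hal hR (r + γ) (t⁻¹ ^ γ) := by
    rw [hE', Ideal.span, Submodule.span_pow, Submodule.span_le]
    intro z hz1
    obtain ⟨f, rfl⟩ := Set.mem_pow.mp hz1
    choose e he1 he using fun j => (f j).2
    have hfe : (List.ofFn fun j => (f j : R)).prod = (∏ j, a (e j)) * ∏ j, s (e j) := by
      rw [List.prod_ofFn, ← Finset.prod_mul_distrib]
      exact Finset.prod_congr rfl fun j _ => (he j).symm
    rw [hfe]
    have h1 := QI_prod hal A Φ V hR Finset.univ (fun j => a (e j)) (fun _ => 1) (fun _ => 1)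
      (fun j _ => QI_ai hal A Φ V hR (e j) (by rw [mul_one]; exact hT _ (he1 j)))
    have h2 := QI_FF hal A hA Φ V hR hτ γ (of_pow_mem_FF hr (hprod e))
    have h3 := QI_mul_mem hal A Φ V hR h1 h2
    simpa using h3
  have hfin : x ^ r ∈ QI A Φ V hal hR (r + γ) (t⁻¹ ^ γ) := by
    have := add_mem hz (hmain (Ideal.pow_mem_pow hxw r))
    rwa [sub_add_cancel] at this
  obtain ⟨h1, h2⟩ := hfin
  have e : (⟨monomial (r + γ) (x ^ r), h1⟩ : A) = algebraMap (MvPolynomial (Fin d) R) A (MvPolynomial.X i0) ^ r * ⟨monomial γ (s i0 ^ r), hu⟩ := by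
    apply Subtype.ext
    change monomial (r + γ) ((a i0 * s i0) ^ r) = (algebraMap (MvPolynomial (Fin d) R) A (MvPolynomial.X i0) : R[X]) ^ r * monomial γ (s i0 ^ r)
    rw [algMapA hal, phi_X, C_mul_X_eq_monomial, monomial_pow, one_mul, monomial_mul_monomial, mul_pow]
  rw [e, map_mul, map_pow, ← ht] at h2
  have h4 := mul_mem h2 (pow_mem hti (r - γ - 1))
  convert h4 using 1
  generalize Φ ⟨monomial γ (s i0 ^ r), hu⟩ = U
  have e5 : t ^ r = t * t ^ γ * t ^ (r - γ - 1) := by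
    rw [← pow_succ', ← pow_add]; congr 1; omega
  rw [e5]
  have e6 : t * t ^ γ * t ^ (r - γ - 1) * U * t⁻¹ ^ γ * t⁻¹ ^ (r - γ - 1) =
      t * U * (t * t⁻¹) ^ γ * (t * t⁻¹) ^ (r - γ - 1) := by rw [mul_pow, mul_pow]; ring
  rw [e6, mul_inv_cancel₀ ht0]; simp
end
end NHC

namespace NHC
theorem exists_field_inj.{u} (A : Type u) [CommRing A] (𝔭 : Ideal A) [𝔭.IsPrime] :
    ∃ (L : Type u) (_ : Field L) (ι : A ⧸ 𝔭 →+* L), Function.Injective ι :=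
  ⟨FractionRing (A ⧸ 𝔭), inferInstance, algebraMap _ _, IsFractionRing.injective (A ⧸ 𝔭) (FractionRing (A ⧸ 𝔭))⟩

section
variable {R : Type*} [CommRing R] [IsLocalRing R] [IsNoetherianRing R] {d : ℕ} {a : Fin d → R}
  (hQ : QR a) (hJ : Ideal.span (Set.range a) ≤ maximalIdeal R) (i : Fin d)
  (hm : ∃ k, maximalIdeal R ^ k ≤ Ideal.span (Set.range a))
  (C0 : ℕ) (hC : ∀ n, Module.length R (R ⧸ FF (Ideal.span (Set.range a)) (n + 1)) ≤ ((C0 * (n + 1) ^ d : ℕ) : ℕ∞))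

include hQ hJ i hm C0 hC in
theorem M5_core (hFJ : ∀ n, FF (Ideal.span (Set.range a)) (n + 1) ≤ Ideal.span (Set.range a) ^ n) (s : Fin d → R)
    (hw : ∑ i, a i * s i ∈ FF (Ideal.span (Set.range a)) 2) (j : Fin d) : s j ∈ FF (Ideal.span (Set.range a)) 1 := by
  classical
  letI : Algebra (MvPolynomial (Fin d) R) R[X] := (phi a).toRingHom.toAlgebra
  have hal : ∀ g, algebraMap (MvPolynomial (Fin d) R) R[X] g = phi a g := fun g => rfl
  obtain ⟨A, hA⟩ : ∃ A : Subalgebra (MvPolynomial (Fin d) R) R[X], ∀ p, p ∈ A ↔ p ∈ AA (Ideal.span (Set.range a)) := ⟨mkA hal, mem_mkA hal⟩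
  obtain ⟨K, hK⟩ := exists_K hQ hJ i A hA
  have hN := noethG hal A hA K hK hm hQ hJ i C0 hC
  set J := Ideal.span (Set.range a) with hJd
  have hNR : IsNoetherianRing (A ⧸ K) := isNoetherian_of_tower (MvPolynomial (Fin d) R) hN
  obtain ⟨N, hNil⟩ : ∃ N, 0 < N ∧ nilradical (A ⧸ K) ^ N = ⊥ := by
    obtain ⟨N, h⟩ := IsNoetherianRing.isNilpotent_nilradical (A ⧸ K)
    exact ⟨N + 1, N.succ_pos, by rw [pow_succ, h, zero_mul]; rfl⟩
  have hmK : ∀ (γ : ℕ) (y : R) (hy : monomial γ y ∈ A) (k : ℕ), (⟨monomial γ y, hy⟩ : A) ^ k ∈ K ↔ y ^ k ∈ FF J (γ * k + 1) := by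
    intro γ y hy k
    rw [hK]
    constructor
    · intro h
      have := h (γ * k)
      push_cast at this
      rwa [monomial_pow, coeff_monomial_same] at this
    · intro h n
      push_cast
      rw [monomial_pow, coeff_monomial]
      split_ifs with hn
      · rw [← hn]; exact h
      · exact zero_mem _
  have hnil : ∀ (γ : ℕ) (y : R) (k : ℕ), y ∈ FF J γ → y ^ k ∈ FF J (γ * k + 1) → y ^ N ∈ FF J (γ * N + 1) := by
    intro γ y k hy hk
    have hyA : monomial γ y ∈ A := (hA _).mpr hy
    rw [← hmK γ y hyA] at hk ⊢
    rw [← Ideal.Quotient.eq_zero_iff_mem, map_pow] at hk ⊢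
    have : Ideal.Quotient.mk K ⟨monomial γ y, hyA⟩ ∈ nilradical (A ⧸ K) := ⟨k, hk⟩
    have := Ideal.pow_mem_pow this N
    rw [hNil.2] at this
    exact this
  by_contra hsj
  obtain ⟨γ, r, hr, hP, hnP⟩ := vbar (fun p k => ∀ i, s i ^ k ∈ FF J p) (fun i => by rw [FF_zero]; trivial)
    (fun p k hk h => by
      by_contra hpk
      refine hsj (of_pow_mem_FF hk (FF_anti hQ hJ i ?_ (h j)))
      omega)
    (fun p k p' q hk hq hpq h l => by
      refine of_pow_mem_FF hq ?_
      rw [← pow_mul, mul_comm k, pow_mul]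
      exact FF_anti hQ hJ i hpq (pow_mem_FF (h l) k))
    (fun p k hk h l => by
      refine FF_crit2 hQ hJ i 2 fun q => ?_
      rcases Nat.eq_zero_or_pos q with rfl | hq
      · simp
      have h1 := h q hq l
      rw [mul_comm q k, pow_mul] at h1
      have h2 := Ideal.pow_mem_pow (ai_mem a i) 2
      by_cases h3 : q * p ≤ 1
      · exact Ideal.pow_le_pow_right (by rw [mul_comm]; omega) (Ideal.mul_mem_right _ _ h2)
      · have h4 := hFJ (q * p - 2) (by rwa [show q * p - 2 + 1 = q * p - 1 by omega])
        have := Ideal.mul_mem_mul h2 h4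
        rwa [← pow_add, show 2 + (q * p - 2) = p * q by rw [mul_comm p]; omega] at this)
    N hNil.1
  have hγ : γ < r := by
    by_contra hpk
    refine hsj (of_pow_mem_FF hr (FF_anti hQ hJ i ?_ (hP j)))
    omega
  push Not at hnP
  obtain ⟨i0, hi0⟩ := hnP
  have huA : monomial γ (s i0 ^ r) ∈ A := (hA _).mpr (hP i0)
  set u : A := ⟨monomial γ (s i0 ^ r), huA⟩ with hu
  have h1F : (1 : R) ∉ FF J 1 := fun h => hsj (by rw [(Ideal.eq_top_iff_one _).mpr h]; trivial)
  let M : Submonoid A := (WW R d).map (algebraMap (MvPolynomial (Fin d) R) A) ⊔ Submonoid.powers u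
  have hdis : Disjoint (K : Set A) (M : Set A) := by
    rw [Set.disjoint_left]
    intro z hzK hzM
    obtain ⟨_, ⟨g, hg, rfl⟩, _, ⟨k, rfl⟩, rfl⟩ := Submonoid.mem_sup.mp hzM
    have h1 := (hK _).mp hzK
    have h2 : s i0 ^ (r * k) ∈ FF J (γ * k + 1) := by
      have h3 : X * monomial (γ * k) (s i0 ^ (r * k)) ∈ AA J := by
        refine AA_cancel hQ hJ i hg _ ?_
        rw [AA_iff hQ hJ i]
        intro n
        rw [mul_left_comm]
        cases n with
        | zero => rw [FF_zero]; trivial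
        | succ n =>
          rw [coeff_X_mul]
          have := h1 n
          have e : ((algebraMap (MvPolynomial (Fin d) R) A g * u ^ k : A) : R[X]) = phi a g * monomial (γ * k) (s i0 ^ (r * k)) := by
            change (algebraMap (MvPolynomial (Fin d) R) A g : R[X]) * (monomial γ (s i0 ^ r)) ^ k = _
            rw [algMapA hal, monomial_pow, ← pow_mul]
          rw [← e]; exact this
      have h4 := AA_coeff hQ hJ i _ h3 (γ * k + 1)
      rwa [coeff_X_mul, coeff_monomial_same] at h4
    rcases Nat.eq_zero_or_pos k with rfl | hk
    · exact h1F (by simpa using h2)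
    · apply hi0
      rw [mul_comm N r, pow_mul, mul_comm N]
      exact hnil γ _ k (hP i0) (by rwa [← pow_mul])
  obtain ⟨𝔭, hp, hKp, hpM⟩ := Ideal.exists_le_prime_disjoint K M hdis
  have hup : u ∉ 𝔭 := fun h => Set.disjoint_left.mp hpM h (Submonoid.mem_sup_right (Submonoid.mem_powers u))
  have hW : ∀ w ∈ WW R d, algebraMap (MvPolynomial (Fin d) R) A w ∉ 𝔭 := fun w hw h =>
    Set.disjoint_left.mp hpM h (Submonoid.mem_sup_left ⟨w, hw, rfl⟩)
  obtain ⟨ψ, hψ⟩ := exists_psi hal A K hK hm 𝔭 hKp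
  have hinj := psi_inj A 𝔭 hW ψ hψ
  obtain ⟨L, instL, ι, hι⟩ := exists_field_inj A 𝔭
  let Φ : A →+* L := ι.comp (Ideal.Quotient.mk 𝔭)
  letI algk : Algebra (ResidueField R) L := ((ι.comp ψ).comp MvPolynomial.C).toAlgebra
  have hkL : ∀ c, algebraMap (ResidueField R) L c = ι (ψ (MvPolynomial.C c)) := fun c => rfl
  let x : Fin d → L := fun i => Φ (algebraMap (MvPolynomial (Fin d) R) A (MvPolynomial.X i))
  have hxψ : ∀ i, x i = ι (ψ (MvPolynomial.X i)) := by
    intro i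
    have := hψ (MvPolynomial.X i)
    rw [MvPolynomial.map_X] at this
    rw [this]; rfl
  have hCr : ∀ r : R, Φ (algebraMap (MvPolynomial (Fin d) R) A (MvPolynomial.C r)) = algebraMap (ResidueField R) L (residue R r) := by
    intro r
    have := hψ (MvPolynomial.C r)
    rw [MvPolynomial.map_C] at this
    rw [hkL, this]; rfl
  have hAI : AlgebraicIndependent (ResidueField R) x := by
    have e : (MvPolynomial.aeval x : MvPolynomial (Fin d) (ResidueField R) →ₐ[ResidueField R] L).toRingHom = ι.comp ψ := by
      apply MvPolynomial.ringHom_ext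
      · intro c
        simp [hkL]
      · intro i
        simp [hxψ]
    have : Function.Injective (MvPolynomial.aeval x : MvPolynomial (Fin d) (ResidueField R) →ₐ[ResidueField R] L).toRingHom := by
      rw [e]; exact hι.comp hinj
    exact this
  have hΦ : ∀ p ∈ K, Φ p = 0 := by
    intro p hp
    have : Ideal.Quotient.mk 𝔭 p = 0 := Ideal.Quotient.eq_zero_iff_mem.mpr (hKp hp)
    change ι (Ideal.Quotient.mk 𝔭 p) = 0
    rw [this, map_zero]
  have hu0 : Φ u = 0 := by
    refine field_lemma x hAI i0 (Φ u) ?_ ?_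
    · intro V hkV hxV
      have hR : ∀ r : R, Φ (algebraMap (MvPolynomial (Fin d) R) A (MvPolynomial.C r)) ∈ V := fun r => by rw [hCr]; exact hkV _
      obtain ⟨h1, h2⟩ := QI_FF hal A hA Φ V hR (τ := 1) (fun j => by rw [mul_one]; exact hxV j) γ (hP i0)
      rwa [one_pow, mul_one] at h2
    · intro V hkV hxV hx0
      have hR : ∀ r : R, Φ (algebraMap (MvPolynomial (Fin d) R) A (MvPolynomial.C r)) ∈ V := fun r => by rw [hCr]; exact hkV _
      exact core_h2 hal A hA K hK Φ V hR hQ hJ hΦ i0 r γ hγ s hP hw hxV hx0 huA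
  apply hup
  rw [← Ideal.Quotient.eq_zero_iff_mem]
  exact hι (by rw [map_zero]; exact hu0)
end
end NHC

namespace NHC

section
variable {R : Type*} [CommRing R] [IsLocalRing R] [IsNoetherianRing R] {d : ℕ} {a : Fin d → R}
  (hQ : QR a) (hJ : Ideal.span (Set.range a) ≤ maximalIdeal R) (i : Fin d)
  (hm : ∃ k, maximalIdeal R ^ k ≤ Ideal.span (Set.range a))
  (C0 : ℕ) (hC : ∀ n, Module.length R (R ⧸ FF (Ideal.span (Set.range a)) (n + 1)) ≤ ((C0 * (n + 1) ^ d : ℕ) : ℕ∞))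

include hQ hJ i hm C0 hC in
theorem M5 (w : R) (hw2 : w ∈ FF (Ideal.span (Set.range a)) 2)
    (hmw : ∀ r ∈ maximalIdeal R, r * w ∈ FF (Ideal.span (Set.range a)) 1 * Ideal.span (Set.range a))
    (hF : ∀ n, FF (Ideal.span (Set.range a)) (n + 2) ≤
      FF (Ideal.span (Set.range a)) 1 * Ideal.span (Set.range a) ^ (n + 1) ⊔ Ideal.span (Set.range a) ^ n * Ideal.span {w}) :
    Ideal.span (Set.range a) ⊓ FF (Ideal.span (Set.range a)) 2 ≤ Ideal.span (Set.range a) * FF (Ideal.span (Set.range a)) 1 := by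
  have key : w ∈ Ideal.span (Set.range a) → w ∈ Ideal.span (Set.range a) * FF (Ideal.span (Set.range a)) 1 := by
    intro hwJ
    have hFJ : ∀ n, FF (Ideal.span (Set.range a)) (n + 1) ≤ Ideal.span (Set.range a) ^ n := by
      rintro (_ | n)
      · simp
      · refine (hF n).trans (sup_le Ideal.mul_le_right ?_)
        rw [pow_succ]
        exact Ideal.mul_mono_right ((Ideal.span_singleton_le_iff_mem _).mpr hwJ)
    obtain ⟨s, hs⟩ := Ideal.mem_span_range_iff_exists_fun.mp hwJ
    have hs' : ∑ i, a i * s i = w := by rw [← hs]; exact Finset.sum_congr rfl fun _ _ => mul_comm _ _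
    rw [← hs']
    refine Ideal.sum_mem _ fun j _ => Ideal.mul_mem_mul (ai_mem a j) ?_
    exact M5_core hQ hJ i hm C0 hC hFJ s (by rw [hs']; exact hw2) j
  rintro x ⟨hxJ, hx2⟩
  have h := hF 0 hx2
  rw [zero_add, pow_one, pow_zero, Ideal.one_eq_top, Ideal.top_mul, mul_comm] at h
  obtain ⟨y, hy, z, hz, rfl⟩ := Submodule.mem_sup.mp h
  obtain ⟨r, rfl⟩ := Ideal.mem_span_singleton'.mp hz
  refine add_mem hy ?_
  by_cases hr : r ∈ maximalIdeal R
  · rw [mul_comm (Ideal.span _)]; exact hmw r hr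
  · have hu : IsUnit r := by simpa using hr
    refine Ideal.mul_mem_left _ _ (key ?_)
    have : r * w ∈ Ideal.span (Set.range a) := (Ideal.add_mem_iff_right (Ideal.span (Set.range a)) (Ideal.mul_le_left (I := Ideal.span (Set.range a)) (J := FF (Ideal.span (Set.range a)) 1) hy)).mp hxJ
    exact (Ideal.unit_mul_mem_iff_mem _ hu).mp this

theorem redNum (w : R) (hw2 : w ∈ FF (Ideal.span (Set.range a)) 2)
    (hF : ∀ n, FF (Ideal.span (Set.range a)) (n + 2) ≤
      FF (Ideal.span (Set.range a)) 1 * Ideal.span (Set.range a) ^ (n + 1) ⊔ Ideal.span (Set.range a) ^ n * Ideal.span {w}) (k : ℕ) :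
    FF (Ideal.span (Set.range a)) (k + 2) = Ideal.span (Set.range a) ^ k * FF (Ideal.span (Set.range a)) 2 := by
  have hJ1 : Ideal.span (Set.range a) ≤ FF (Ideal.span (Set.range a)) 1 := by simpa using pow_le_FF (Ideal.span (Set.range a)) 1
  apply le_antisymm
  · refine (hF k).trans (sup_le ?_ (Ideal.mul_mono_right ((Ideal.span_singleton_le_iff_mem _).mpr hw2)))
    rw [pow_succ, mul_comm, mul_assoc]
    exact Ideal.mul_mono_right ((Ideal.mul_mono_left hJ1).trans (FF_mul_le _ 1 1))
  · refine (Ideal.mul_mono_left (pow_le_FF _ k)).trans (FF_mul_le _ k 2)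

theorem M6 (hM5 : Ideal.span (Set.range a) ⊓ FF (Ideal.span (Set.range a)) 2 ≤ Ideal.span (Set.range a) * FF (Ideal.span (Set.range a)) 1)
    (hred : ∀ k, FF (Ideal.span (Set.range a)) (k + 2) = Ideal.span (Set.range a) ^ k * FF (Ideal.span (Set.range a)) 2) (n : ℕ) :
    Ideal.span (Set.range a) ⊓ FF (Ideal.span (Set.range a)) (n + 1) ≤ Ideal.span (Set.range a) * FF (Ideal.span (Set.range a)) n := by
  rcases n with _ | _ | n
  · rw [FF_zero, Ideal.mul_top]; exact inf_le_left
  · exact hM5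
  · rw [show n + 1 + 1 + 1 = (n + 1) + 2 by ring, show n + 1 + 1 = n + 2 by ring, hred (n + 1), hred n, pow_succ', mul_assoc]
    exact inf_le_right
end
end NHC

namespace NHC

section
variable {R : Type*} [CommRing R] {d : ℕ} (a : Fin d → R)

theorem eval_mem_b (𝔟 : Ideal R) {n : ℕ} {f : MvPolynomial (Fin d) R} (hf : f.IsHomogeneous n)
    (h : f ∈ 𝔟.map (MvPolynomial.C (σ := Fin d))) : MvPolynomial.eval a f ∈ 𝔟 * Ideal.span (Set.range a) ^ n := by
  have := phi_mem a 𝔟 f h n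
  rwa [phi_homog a hf, coeff_monomial_same] at this

theorem eval_mem_S (S : Set (Fin d)) (𝔟 : Ideal R) {n : ℕ} {f : MvPolynomial (Fin d) R} (hf : f.IsHomogeneous (n + 1))
    (h : f ∈ 𝔟.map (MvPolynomial.C (σ := Fin d)))
    (hS : f ∈ Ideal.span ((MvPolynomial.X : Fin d → MvPolynomial (Fin d) R) '' S)) :
    MvPolynomial.eval a f ∈ Ideal.span (a '' S) * (𝔟 * Ideal.span (Set.range a) ^ n) := by
  classical
  rw [MvPolynomial.mem_ideal_span_X_image] at hS
  rw [MvPolynomial.mem_map_C_iff] at h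
  rw [f.as_sum, map_sum]
  refine Ideal.sum_mem _ fun c hc => ?_
  obtain ⟨l, hl, hcl⟩ := hS c hc
  have h1 : c = Finsupp.single l 1 + (c - Finsupp.single l 1) := by
    rw [add_tsub_cancel_of_le]
    rw [Finsupp.single_le_iff]; omega
  have hdeg : (c - Finsupp.single l 1).degree = n := by
    have h2 : c.degree = n + 1 := by
      have := hf (MvPolynomial.mem_support_iff.mp hc)
      rw [Finsupp.degree_eq_weight_one]; exact this
    rw [h1, map_add, Finsupp.degree_single] at h2
    omega
  have h3 : MvPolynomial.eval a (MvPolynomial.monomial (c - Finsupp.single l 1) (1 : R)) ∈ Ideal.span (Set.range a) ^ n :=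
    eval_homog_mem a (MvPolynomial.isHomogeneous_monomial _ hdeg)
  have h4 : MvPolynomial.monomial c (f.coeff c) = MvPolynomial.X l * (MvPolynomial.C (f.coeff c) * MvPolynomial.monomial (c - Finsupp.single l 1) (1 : R)) := by
    rw [MvPolynomial.C_mul_monomial, mul_one, MvPolynomial.X, MvPolynomial.monomial_mul, one_mul, ← h1]
  rw [h4, map_mul, map_mul, MvPolynomial.eval_X, MvPolynomial.eval_C]
  exact Ideal.mul_mem_mul (Ideal.subset_span ⟨l, hl, rfl⟩) (Ideal.mul_mem_mul (h c) h3)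

theorem lift_S (S : Set (Fin d)) (n : ℕ) (x : R) (hx : x ∈ Ideal.span (a '' S) * Ideal.span (Set.range a) ^ n) :
    ∃ f : MvPolynomial (Fin d) R, f.IsHomogeneous (n + 1) ∧
      f ∈ Ideal.span ((MvPolynomial.X : Fin d → MvPolynomial (Fin d) R) '' S) ∧ MvPolynomial.eval a f = x := by
  induction hx using Submodule.mul_induction_on' with
  | add x _ y _ hx hy =>
    obtain ⟨f, h1, h2, rfl⟩ := hx
    obtain ⟨g, h3, h4, rfl⟩ := hy
    exact ⟨f + g, h1.add h3, add_mem h2 h4, map_add _ _ _⟩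
  | mem_mul_mem x hx y hy =>
    obtain ⟨g, hg, rfl⟩ := lift_homog1 a n y hy
    induction hx using Submodule.span_induction with
    | mem x hx =>
      obtain ⟨l, hl, rfl⟩ := hx
      refine ⟨MvPolynomial.X l * g, ?_, Ideal.mul_mem_right _ _ (Ideal.subset_span ⟨l, hl, rfl⟩), by simp⟩
      rw [add_comm]; exact (MvPolynomial.isHomogeneous_X R l).mul hg
    | zero => exact ⟨0, MvPolynomial.isHomogeneous_zero _ _ _, zero_mem _, by simp⟩
    | add x y _ _ hx hy =>
      obtain ⟨f, h1, h2, h5⟩ := hx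
      obtain ⟨g, h3, h4, h6⟩ := hy
      exact ⟨f + g, h1.add h3, add_mem h2 h4, by rw [map_add, h5, h6, add_mul]⟩
    | smul r x _ hx =>
      obtain ⟨f, h1, h2, h5⟩ := hx
      refine ⟨MvPolynomial.C r * f, ?_, Ideal.mul_mem_left _ _ h2, by simp [h5, mul_assoc]⟩
      have := (MvPolynomial.isHomogeneous_C (Fin d) r).mul h1
      rwa [zero_add] at this

theorem exists_Spart (S : Set (Fin d)) (𝔟 : Ideal R) {n : ℕ} {q : MvPolynomial (Fin d) R} (hq : q.IsHomogeneous n)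
    (h : q ∈ 𝔟.map (MvPolynomial.C (σ := Fin d))) : ∃ q' : MvPolynomial (Fin d) R, q'.IsHomogeneous n ∧
      q' ∈ 𝔟.map (MvPolynomial.C (σ := Fin d)) ∧ q' ∈ Ideal.span ((MvPolynomial.X : Fin d → MvPolynomial (Fin d) R) '' S) ∧
      ∀ c, (∃ i ∈ S, c i ≠ 0) → q'.coeff c = q.coeff c := by
  classical
  let q' : MvPolynomial (Fin d) R := ∑ c ∈ q.support.filter (fun c => ∃ i ∈ S, c i ≠ 0), MvPolynomial.monomial c (q.coeff c)
  have hc : ∀ c, q'.coeff c = if ∃ i ∈ S, c i ≠ 0 then q.coeff c else 0 := by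
    intro c
    simp only [q', MvPolynomial.coeff_sum, MvPolynomial.coeff_monomial, Finset.sum_ite_eq', Finset.mem_filter]
    by_cases h1 : ∃ i ∈ S, c i ≠ 0
    · rw [if_pos h1]
      by_cases h2 : c ∈ q.support
      · rw [if_pos ⟨h2, h1⟩]
      · rw [if_neg (fun h => h2 h.1)]; exact (MvPolynomial.notMem_support_iff.mp h2).symm
    · rw [if_neg (fun h => h1 h.2), if_neg h1]
  refine ⟨q', ?_, ?_, ?_, fun c h => by rw [hc, if_pos h]⟩
  · intro c h
    rw [hc] at h
    split_ifs at h with h1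
    · exact hq h
    · exact absurd rfl h
  · rw [MvPolynomial.mem_map_C_iff] at h ⊢
    intro c
    rw [hc]
    split_ifs
    · exact h c
    · exact zero_mem _
  · rw [MvPolynomial.mem_ideal_span_X_image]
    intro c h
    rw [MvPolynomial.mem_support_iff, hc] at h
    by_contra h1
    rw [if_neg h1] at h
    exact h rfl

variable {a} (hQ : QR a) (F : ℕ → Ideal R) (hF0 : F 0 = ⊤) (hJF : ∀ m n, Ideal.span (Set.range a) ^ m * F n ≤ F (m + n))
  (hM6 : ∀ n, Ideal.span (Set.range a) ⊓ F (n + 1) ≤ Ideal.span (Set.range a) * F n)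

include hQ hM6 in
theorem VV_i (hanti : Antitone F) (i k : ℕ) : F (i + k) ⊓ Ideal.span (Set.range a) ^ i ≤ F k * Ideal.span (Set.range a) ^ i := by
  induction i generalizing k with
  | zero => simp
  | succ i ih =>
    rintro x ⟨h1, h2⟩
    have h3 := ih (k + 1) ⟨by rwa [show i + (k + 1) = i + 1 + k by ring], Ideal.pow_le_pow_right (Nat.le_succ i) h2⟩
    obtain ⟨f, hf, hfF, rfl⟩ := lift_homog a _ _ _ h3
    have h4 := homog_mem hQ (Ideal.span (Set.range a)) le_rfl hf (by rwa [← pow_succ'])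
    have h5 : f ∈ (Ideal.span (Set.range a) * F k).map (MvPolynomial.C (σ := Fin d)) := by
      rw [MvPolynomial.mem_map_C_iff] at *
      exact fun c => hM6 k ⟨h4 c, hfF c⟩
    have h6 := eval_mem_b a _ hf h5
    rwa [mul_comm (Ideal.span _), mul_assoc, ← pow_succ'] at h6

include hQ in
theorem VV_A (S : Set (Fin d)) (i : ℕ) : Ideal.span (a '' S) ⊓ Ideal.span (Set.range a) ^ (i + 1) ≤
    Ideal.span (a '' S) * Ideal.span (Set.range a) ^ i := by
  induction i with
  | zero => simp
  | succ i ih =>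
    rintro x ⟨h1, h2⟩
    obtain ⟨p, hp, hpS, rfl⟩ := lift_S a S i x (ih ⟨h1, Ideal.pow_le_pow_right (Nat.le_succ _) h2⟩)
    have h4 := homog_mem hQ (Ideal.span (Set.range a)) le_rfl hp (by rwa [← pow_succ'])
    have := eval_mem_S a S _ hp h4 hpS
    rwa [← pow_succ'] at this

include hQ hM6 hF0 hJF in
theorem VV_B (hanti : Antitone F) (S : Set (Fin d)) (k i : ℕ) :
    Ideal.span (a '' S) ⊓ F (i + 1 + k) ⊓ Ideal.span (Set.range a) ^ (i + 1) ≤ Ideal.span (a '' S) * F (i + k) := by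
  have hS : Ideal.span (a '' S) ≤ Ideal.span (Set.range a) := Ideal.span_mono (Set.image_subset_range _ _)
  induction k generalizing i with
  | zero =>
    rintro x ⟨⟨h1, -⟩, h2⟩
    refine Ideal.mul_mono_right ?_ (VV_A hQ S i ⟨h1, h2⟩)
    have := hJF i 0
    rwa [hF0, Ideal.mul_top] at this
  | succ k ih =>
    rintro x ⟨⟨h1, h3⟩, h2⟩
    obtain ⟨p, hp, hpS, hpx⟩ := lift_S a S i x (VV_A hQ S i ⟨h1, h2⟩)
    obtain ⟨q, hq, hqF, hqx⟩ := lift_homog a _ _ _ (VV_i hQ F hM6 hanti (i + 1) (k + 1) ⟨h3, h2⟩)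
    obtain ⟨q', hq', hqF', hqS', hqc⟩ := exists_Spart S _ hq hqF
    have hpq : p - q ∈ (Ideal.span (Set.range a)).map (MvPolynomial.C (σ := Fin d)) :=
      homog_mem hQ _ le_rfl (hp.sub hq) (by rw [map_sub, hpx, hqx, sub_self]; exact zero_mem _)
    have hpq' : p - q' ∈ (Ideal.span (Set.range a)).map (MvPolynomial.C (σ := Fin d)) := by
      have hs := sub_mem hpS hqS'
      rw [MvPolynomial.mem_ideal_span_X_image] at hs
      rw [MvPolynomial.mem_map_C_iff] at hpq ⊢
      intro c
      by_cases hc : c ∈ (p - q').support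
      · rw [MvPolynomial.coeff_sub, hqc c (hs c hc), ← MvPolynomial.coeff_sub]; exact hpq c
      · rw [MvPolynomial.notMem_support_iff.mp hc]; exact zero_mem _
    have e1 := eval_mem_S a S _ (hp.sub hq') hpq' (sub_mem hpS hqS')
    rw [← pow_succ', map_sub, hpx] at e1
    have e2 := eval_mem_S a S _ hq' hqF' hqS'
    have e3 : MvPolynomial.eval a q' ∈ Ideal.span (a '' S) * F (i + (k + 1)) := by
      refine Ideal.mul_mono_right ?_ e2
      rw [mul_comm]; exact hJF i (k + 1)
    have e4 : MvPolynomial.eval a q' ∈ F (i + 1 + (k + 1)) := by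
      have := hJF 1 (i + (k + 1)) (Ideal.mul_mono_left (by simpa using hS) e3)
      rwa [show 1 + (i + (k + 1)) = i + 1 + (k + 1) by ring] at this
    have e5 := ih (i + 1) ⟨⟨Ideal.mul_le_left e1, by
      have := sub_mem h3 e4
      rwa [show i + 1 + 1 + k = i + 1 + (k + 1) by ring]⟩, by
      have := Ideal.mul_mono_left (K := Ideal.span (Set.range a) ^ (i + 1)) hS e1
      rwa [← pow_succ'] at this⟩
    rw [show i + 1 + k = i + (k + 1) by ring] at e5
    have := add_mem e5 e3
    rwa [sub_add_cancel] at this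

include hQ hM6 hF0 hJF in
theorem VV (hanti : Antitone F) (S : Set (Fin d)) (n : ℕ) :
    Ideal.span (a '' S) ⊓ F (n + 1) ≤ Ideal.span (a '' S) * F n := by
  rintro x ⟨h1, h2⟩
  have := VV_B hQ F hF0 hJF hM6 hanti S n 0 ⟨⟨h1, by rwa [zero_add, add_comm]⟩, by
    simpa using Ideal.span_mono (Set.image_subset_range a S) h1⟩
  rwa [zero_add] at this

include hQ hM6 hF0 hJF in
theorem VV_reg (hanti : Antitone F) (S : Set (Fin d)) (j : Fin d) (hj : ∀ y, a j * y ∈ Ideal.span (a '' S) → y ∈ Ideal.span (a '' S))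
    (n : ℕ) (g : R) (hg : g ∈ F n) (h : a j * g ∈ Ideal.span (a '' S) * F n ⊔ F (n + 2)) :
    (n = 0 → g ∈ F 1) ∧ ∀ m, n = m + 1 → g ∈ Ideal.span (a '' S) * F m ⊔ F (m + 2) := by
  obtain ⟨y, hy, z, hz, e⟩ := Submodule.mem_sup.mp h
  have hS : Ideal.span (a '' S) ≤ F 1 := by
    have h1 := hJF 1 0
    rw [hF0, Ideal.mul_top, pow_one, add_zero] at h1
    exact (Ideal.span_mono (Set.image_subset_range _ _)).trans h1
  have hzS : z ∈ Ideal.span (a '' (insert j S)) := by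
    have : z = a j * g - y := by rw [← e]; ring
    rw [this]
    refine sub_mem (Ideal.mul_mem_right _ _ (Ideal.subset_span ⟨j, Set.mem_insert _ _, rfl⟩)) ?_
    exact Ideal.span_mono (Set.image_mono (Set.subset_insert j S)) (Ideal.mul_le_left hy)
  have hz2 := VV hQ F hF0 hJF hM6 hanti (insert j S) (n + 1) ⟨hzS, hz⟩
  rw [Set.image_insert_eq, Ideal.span_insert, Ideal.sup_mul] at hz2
  obtain ⟨u, hu, v, hv, e2⟩ := Submodule.mem_sup.mp hz2
  obtain ⟨g', hg', rfl⟩ := Ideal.mem_span_singleton_mul.mp hu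
  have h3 : g - g' ∈ Ideal.span (a '' S) := by
    apply hj
    have : a j * (g - g') = y + v := by rw [mul_sub, ← e, ← e2]; ring
    rw [this]
    exact add_mem (Ideal.mul_le_left hy) (Ideal.mul_le_left hv)
  have h4 : g = (g - g') + g' := by ring
  refine ⟨?_, ?_⟩
  · rintro rfl
    rw [h4]
    exact add_mem (hS h3) hg'
  · rintro m rfl
    rw [h4]
    refine add_mem (Ideal.mem_sup_left ?_) (Ideal.mem_sup_right hg')
    exact VV hQ F hF0 hJF hM6 hanti S m ⟨h3, sub_mem hg (hanti (Nat.le_succ _) hg')⟩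
end
end NHC

namespace NHC

theorem ofList_take {B : Type*} [CommRing B] {d : ℕ} (x : Fin d → B) (i : ℕ) :
    Ideal.ofList ((List.ofFn x).take i) = Ideal.span (x '' {l | l.1 < i}) := by
  rw [Ideal.ofList]
  congr 1
  ext r
  simp only [Set.mem_setOf_eq, Set.mem_image, List.mem_take_iff_getElem, List.length_ofFn, List.getElem_ofFn]
  constructor
  · rintro ⟨k, hk, rfl⟩
    exact ⟨⟨k, by omega⟩, by simp; omega, rfl⟩
  · rintro ⟨l, hl, rfl⟩
    exact ⟨l.1, lt_min hl l.2, rfl⟩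

theorem weaklyReg_of {B : Type*} [CommRing B] (K : Ideal B) {d : ℕ} (x : Fin d → B)
    (h : ∀ j : Fin d, ∀ p, x j * p ∈ Ideal.span (x '' {l | l.1 < j.1}) ⊔ K → p ∈ Ideal.span (x '' {l | l.1 < j.1}) ⊔ K) :
    RingTheory.Sequence.IsWeaklyRegular (B ⧸ K) (List.ofFn fun j => Ideal.Quotient.mk K (x j)) := by
  rw [RingTheory.Sequence.isWeaklyRegular_iff_Fin]
  intro j
  rw [isSMulRegular_quotient_iff_mem_of_smul_mem]
  have e : ∀ y : B, Ideal.Quotient.mk K y ∈ (Ideal.ofList ((List.ofFn fun j => Ideal.Quotient.mk K (x j)).take j) • ⊤ : Submodule (B ⧸ K) (B ⧸ K)) ↔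
      y ∈ Ideal.span (x '' {l | l.1 < j.1}) ⊔ K := by
    intro y
    rw [ofList_take, smul_eq_mul, Ideal.mul_top, ← Ideal.mem_quotient_iff_mem_sup, Ideal.map_span, Set.image_image]
  intro y hy
  obtain ⟨y, rfl⟩ := Ideal.Quotient.mk_surjective y
  rw [e]
  have hj : j.1 < d := by have := j.2; simpa using this
  refine h ⟨j.1, hj⟩ y ((e _).mp ?_)
  simpa using hy

theorem of_weaklyReg {B : Type*} [CommRing B] {d : ℕ} (x : Fin d → B)
    (h : RingTheory.Sequence.IsWeaklyRegular B (List.ofFn x)) (j : Fin d) (p : B)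
    (hp : x j * p ∈ Ideal.span (x '' {l | l.1 < j.1})) : p ∈ Ideal.span (x '' {l | l.1 < j.1}) := by
  rw [RingTheory.Sequence.isWeaklyRegular_iff_Fin] at h
  have := h ⟨j.1, by simp⟩
  rw [isSMulRegular_quotient_iff_mem_of_smul_mem] at this
  have h1 := this p
  rw [ofList_take, smul_eq_mul, Ideal.mul_top] at h1
  apply h1
  simpa using hp

section
variable {R : Type*} [CommRing R] {d : ℕ} (a : Fin d → R) (F : ℕ → Ideal R) (hF0 : F 0 = ⊤)
  (hJF : ∀ m n, Ideal.span (Set.range a) ^ m * F n ≤ F (m + n))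
  (A : Subalgebra R R[X]) (hA : ∀ p : R[X], p ∈ A ↔ ∀ n, p.coeff n ∈ F n)
  (K : Ideal A) (hK : ∀ p : A, p ∈ K ↔ ∀ n, (p : R[X]).coeff n ∈ F (n + 1))
  (x : Fin d → A) (hx : ∀ l, (x l : R[X]) = monomial 1 (a l))

include hA hK hx in
theorem char1 (S : Set (Fin d)) (p : A) (hp : p ∈ Ideal.span (x '' S) ⊔ K) :
    (p : R[X]).coeff 0 ∈ F 1 ∧ ∀ n, (p : R[X]).coeff (n + 1) ∈ Ideal.span (a '' S) * F n ⊔ F (n + 2) := by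
  obtain ⟨u, hu, k, hk, rfl⟩ := Submodule.mem_sup.mp hp
  rw [hK] at hk
  have h : (u : R[X]).coeff 0 = 0 ∧ ∀ n, (u : R[X]).coeff (n + 1) ∈ Ideal.span (a '' S) * F n := by
    obtain ⟨t, ht, c, rfl⟩ := (Submodule.mem_span_image_iff_exists_fun _).mp hu
    have e : ((∑ i : t, c i • x i.1 : A) : R[X]) = ∑ i : t, (c i : R[X]) * monomial 1 (a i.1) := by
      rw [AddSubmonoidClass.coe_finsetSum]
      refine Finset.sum_congr rfl fun i _ => ?_
      rw [smul_eq_mul, MulMemClass.coe_mul, hx]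
    constructor
    · rw [e, finsetSum_coeff]
      refine Finset.sum_eq_zero fun i _ => ?_
      rw [mul_coeff_zero, coeff_monomial_of_ne _ (by norm_num), mul_zero]
    · intro n
      rw [e, finsetSum_coeff]
      refine Ideal.sum_mem _ fun i _ => ?_
      rw [coeff_mul_monomial, mul_comm ((c i : R[X]).coeff n)]
      exact Ideal.mul_mem_mul (Ideal.subset_span ⟨i.1, ht i.2, rfl⟩) ((hA _).mp (c i).2 n)
  refine ⟨?_, fun n => ?_⟩
  · rw [AddMemClass.coe_add, coeff_add, h.1, zero_add]; exact hk 0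
  · rw [AddMemClass.coe_add, coeff_add]; exact add_mem (Ideal.mem_sup_left (h.2 n)) (Ideal.mem_sup_right (hk (n + 1)))

include hA hx in
theorem char2a (S : Set (Fin d)) (n : ℕ) (y : R) (hy : y ∈ Ideal.span (a '' S) * F n) :
    ∃ q ∈ Ideal.span (x '' S), (q : R[X]) = monomial (n + 1) y := by
  induction hy using Submodule.mul_induction_on' with
  | add u _ v _ hu hv =>
    obtain ⟨f, h1, h2⟩ := hu
    obtain ⟨g, h3, h4⟩ := hv
    exact ⟨f + g, add_mem h1 h3, by rw [AddMemClass.coe_add, h2, h4, map_add]⟩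
  | mem_mul_mem u hu v hv =>
    induction hu using Submodule.span_induction with
    | mem u hu =>
      obtain ⟨l, hl, rfl⟩ := hu
      have hvA : monomial n v ∈ A := by
        rw [hA]; intro k; rw [coeff_monomial]; split_ifs with h
        · rw [← h]; exact hv
        · exact zero_mem _
      refine ⟨x l * ⟨monomial n v, hvA⟩, Ideal.mul_mem_right _ _ (Ideal.subset_span ⟨l, hl, rfl⟩), ?_⟩
      rw [MulMemClass.coe_mul, hx, monomial_mul_monomial, add_comm]
    | zero => exact ⟨0, zero_mem _, by simp⟩
    | add x y _ _ hu hv =>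
      obtain ⟨f, h1, h2⟩ := hu
      obtain ⟨g, h3, h4⟩ := hv
      exact ⟨f + g, add_mem h1 h3, by rw [AddMemClass.coe_add, h2, h4, add_mul, map_add]⟩
    | smul r x _ hx =>
      obtain ⟨f, h1, h2⟩ := hx
      refine ⟨algebraMap R A r * f, Ideal.mul_mem_left _ _ h1, ?_⟩
      rw [MulMemClass.coe_mul, h2, smul_eq_mul, mul_assoc, ← C_mul_monomial (a := r)]; rfl

include hA hK hx hJF hF0 in
theorem char2 (hanti : Antitone F) (S : Set (Fin d)) (p : A) (h0 : (p : R[X]).coeff 0 ∈ F 1)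
    (h : ∀ n, (p : R[X]).coeff (n + 1) ∈ Ideal.span (a '' S) * F n ⊔ F (n + 2)) :
    p ∈ Ideal.span (x '' S) ⊔ K := by
  have hmK : ∀ n z, z ∈ F (n + 1) → ∃ q ∈ K, (q : R[X]) = monomial n z := by
    intro n z hz
    have hzA : monomial n z ∈ A := by
      rw [hA]; intro k; rw [coeff_monomial]; split_ifs with h
      · rw [← h]; exact hanti (Nat.le_succ n) hz
      · exact zero_mem _
    refine ⟨⟨monomial n z, hzA⟩, ?_, rfl⟩
    rw [hK]; intro k; simp only [coeff_monomial]; split_ifs with h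
    · rw [← h]; exact hz
    · exact zero_mem _
  have h1 : ∀ n, ∃ q ∈ Ideal.span (x '' S) ⊔ K, (q : R[X]) = monomial n ((p : R[X]).coeff n) := by
    rintro (_ | n)
    · obtain ⟨q, hq, e⟩ := hmK 0 _ h0
      exact ⟨q, Ideal.mem_sup_right hq, e⟩
    · obtain ⟨y, hy, z, hz, e⟩ := Submodule.mem_sup.mp (h n)
      obtain ⟨q, hq, e1⟩ := hmK (n + 1) z hz
      obtain ⟨q', hq', e2⟩ := char2a a F A hA x hx S n y hy
      exact ⟨q' + q, add_mem (Ideal.mem_sup_left hq') (Ideal.mem_sup_right hq), by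
        rw [AddMemClass.coe_add, e1, e2, ← map_add, e]⟩
  choose q hq e using h1
  have : p = ∑ n ∈ range ((p : R[X]).natDegree + 1), q n := by
    apply Subtype.ext
    rw [AddSubmonoidClass.coe_finsetSum]
    simp_rw [e]
    exact as_sum_range _
  rw [this]
  exact Ideal.sum_mem _ fun n _ => hq n

include hA hK hx hJF hF0 in
theorem agr_reg (hQ : QR a) (hM6 : ∀ n, Ideal.span (Set.range a) ⊓ F (n + 1) ≤ Ideal.span (Set.range a) * F n)
    (hanti : Antitone F) (hreg : RingTheory.Sequence.IsWeaklyRegular R (List.ofFn a)) :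
    RingTheory.Sequence.IsWeaklyRegular (A ⧸ K) (List.ofFn fun j => Ideal.Quotient.mk K (x j)) := by
  refine weaklyReg_of K x fun j p hp => ?_
  obtain ⟨-, h2⟩ := char1 a F A hA K hK x hx _ _ hp
  have h3 : ∀ n, a j * (p : R[X]).coeff n ∈ Ideal.span (a '' {l | l.1 < j.1}) * F n ⊔ F (n + 2) := by
    intro n
    have := h2 n
    rwa [MulMemClass.coe_mul, hx, mul_comm (monomial 1 (a j)), coeff_mul_monomial, mul_comm _ (a j)] at this
  have h4 := fun n => VV_reg hQ F hF0 hJF hM6 hanti {l | l.1 < j.1} j (of_weaklyReg a hreg j) n _ ((hA _).mp p.2 n) (h3 n)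
  exact char2 a F hF0 hJF A hA K hK x hx hanti _ p ((h4 0).1 rfl) (fun n => (h4 (n + 1)).2 n rfl)
end
end NHC

namespace NHC

theorem reg_le_dim_aux {B : Type*} [CommRing B] {d : ℕ} (x : Fin d → B)
    (h : ∀ j : Fin d, ∀ p, x j * p ∈ Ideal.span (x '' {l | l.1 < j.1}) → p ∈ Ideal.span (x '' {l | l.1 < j.1}))
    (k : ℕ) (hk : k ≤ d) : ringKrullDim (B ⧸ Ideal.span (x '' {l | l.1 < k})) + k ≤ ringKrullDim B := by
  induction k with
  | zero =>
    rw [Nat.cast_zero, add_zero]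
    exact ringKrullDim_quotient_le _
  | succ k ih =>
    refine le_trans ?_ (ih (by omega))
    rw [Nat.cast_succ, add_comm (k : WithBot ℕ∞) 1, ← add_assoc]
    gcongr
    set j : Fin d := ⟨k, hk⟩
    have e : Ideal.span (x '' {l | l.1 < k + 1}) = Ideal.span (x '' {l | l.1 < k}) ⊔ Ideal.span {x j} := by
      rw [← Ideal.span_union]
      congr 1
      ext r
      simp only [Set.mem_image, Set.mem_setOf_eq, Set.mem_union, Set.mem_singleton_iff]
      constructor
      · rintro ⟨l, hl, rfl⟩
        rcases Nat.lt_succ_iff_lt_or_eq.mp hl with h | h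
        · exact Or.inl ⟨l, h, rfl⟩
        · exact Or.inr (by congr 1; exact Fin.ext h)
      · rintro (⟨l, hl, rfl⟩ | rfl)
        · exact ⟨l, by omega, rfl⟩
        · exact ⟨j, by simp [j], rfl⟩
    have e2 := ringKrullDim_eq_of_ringEquiv (DoubleQuot.quotQuotEquivQuotSup (Ideal.span (x '' {l | l.1 < k})) (Ideal.span {x j}))
    rw [e, ← e2, Ideal.map_span, Set.image_singleton]
    apply ringKrullDim_quotient_succ_le_of_nonZeroDivisor
    rw [mem_nonZeroDivisors_iff_right]
    intro y hy
    obtain ⟨y, rfl⟩ := Ideal.Quotient.mk_surjective y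
    rw [← map_mul, Ideal.Quotient.eq_zero_iff_mem] at hy
    rw [Ideal.Quotient.eq_zero_iff_mem]
    exact h j y (by rwa [mul_comm])

theorem reg_le_dim {B : Type*} [CommRing B] (rs : List B) (h : RingTheory.Sequence.IsRegular B rs) :
    (rs.length : WithBot ℕ∞) ≤ ringKrullDim B := by
  obtain ⟨d, x, rfl⟩ : ∃ (d : ℕ) (x : Fin d → B), rs = List.ofFn x := ⟨_, rs.get, (List.ofFn_get rs).symm⟩
  have h1 := reg_le_dim_aux x (of_weaklyReg x h.1) d le_rfl
  have h2 := h.2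
  rw [smul_eq_mul, Ideal.mul_top, ← List.take_length (l := List.ofFn x), List.length_ofFn, ofList_take] at h2
  rw [List.length_ofFn]
  haveI : Nontrivial (B ⧸ Ideal.span (x '' {l | l.1 < d})) := Ideal.Quotient.nontrivial_iff.mpr h2.symm
  refine le_trans ?_ h1
  exact le_add_of_nonneg_left ringKrullDim_nonneg_of_nontrivial

theorem dim_le_of_integral {P B : Type*} [CommRing P] [CommRing B] (f : P →+* B) (hf : f.IsIntegral) (I : Ideal P)
    (hI : ∀ 𝔮 : Ideal B, 𝔮.IsPrime → I ≤ 𝔮.comap f) : ringKrullDim B ≤ ringKrullDim (P ⧸ I) := by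
  rw [ringKrullDim_quotient]
  letI := f.toAlgebra
  haveI : Algebra.IsIntegral P B := ⟨hf⟩
  let g : PrimeSpectrum B → PrimeSpectrum.zeroLocus (R := P) (I : Set P) := fun q => ⟨PrimeSpectrum.comap f q, hI q.asIdeal q.2⟩
  refine Order.krullDim_le_of_strictMono g ?_
  intro p q hpq
  exact Ideal.IsIntegral.comap_lt_comap (R := P) (I := p.asIdeal) (J := q.asIdeal) hpq

theorem dim_le_of_integral' {P B : Type*} [CommRing P] [CommRing B] (f : P →+* B) (hf : f.IsIntegral) (K : Ideal B) (I : Ideal P)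
    (hI : ∀ r ∈ I, ∃ k, f r ^ k ∈ K) : ringKrullDim (B ⧸ K) ≤ ringKrullDim (P ⧸ I) := by
  refine dim_le_of_integral ((Ideal.Quotient.mk K).comp f) (hf.trans _ _ (RingHom.isIntegral_of_surjective _ Ideal.Quotient.mk_surjective)) I ?_
  intro 𝔮 h𝔮 r hr
  obtain ⟨k, hk⟩ := hI r hr
  refine h𝔮.mem_of_pow_mem k ?_
  rw [RingHom.comp_apply, ← map_pow, Ideal.Quotient.eq_zero_iff_mem.mpr hk]
  exact zero_mem _

section
variable {R : Type*} [CommRing R] [IsLocalRing R] [IsNoetherianRing R] {d : ℕ} {a : Fin d → R}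

theorem dim_le_agr (A : Subalgebra R R[X]) (hA : ∀ p : R[X], p ∈ A ↔ p ∈ AA (Ideal.span (Set.range a)))
    (K : Ideal A) (hmK : ∃ k, ∀ r ∈ maximalIdeal R ^ k, algebraMap R A r ∈ K) :
    ringKrullDim (A ⧸ K) ≤ d := by
  have hphi : ∀ g, phi a g ∈ A := fun g => (hA _).mpr (rees_le_AA (phi_mem_rees a g))
  let f0 : MvPolynomial (Fin d) R →ₐ[R] A := (phi a).codRestrict A hphi
  have hf : f0.toRingHom.IsIntegral := by
    rintro ⟨p, hp⟩
    obtain ⟨P, hP, hPx⟩ := (hA p).mp hp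
    choose g hg using fun q : reesAlgebra (Ideal.span (Set.range a)) => phi_lift_rees a q.1 q.2
    letI : Algebra (MvPolynomial (Fin d) R) A := f0.toRingHom.toAlgebra
    change IsIntegral (MvPolynomial (Fin d) R) _
    refine isIntegral_of_pow_eq _ P.natDegree (fun j => (- g (P.coeff j))) ?_
    change _ = ∑ j ∈ range P.natDegree, f0 (- g (P.coeff j)) * _
    apply Subtype.ext
    rw [eval₂_eq_sum_range, Finset.sum_range_succ, hP.coeff_natDegree, map_one, one_mul] at hPx
    rw [AddSubmonoidClass.coe_finsetSum]
    simp only [SubmonoidClass.coe_pow, MulMemClass.coe_mul, f0, AlgHom.coe_codRestrict]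
    rw [eq_neg_of_add_eq_zero_right hPx, ← Finset.sum_neg_distrib]
    refine Finset.sum_congr rfl fun j _ => ?_
    rw [map_neg, hg, neg_mul]
    rfl
  refine (dim_le_of_integral' f0.toRingHom hf K ((maximalIdeal R).map MvPolynomial.C) ?_).trans ?_
  · obtain ⟨k, hk⟩ := hmK
    intro r hr
    refine ⟨k, ?_⟩
    have h1 : ((maximalIdeal R).map MvPolynomial.C) ^ k ≤ K.comap f0.toRingHom := by
      rw [← Ideal.map_pow, Ideal.map_le_iff_le_comap]
      intro r hr
      rw [Ideal.mem_comap, Ideal.mem_comap]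
      have : f0.toRingHom (MvPolynomial.C r) = algebraMap R A r := f0.commutes r
      rw [this]
      exact hk r hr
    have := h1 (Ideal.pow_mem_pow hr k)
    rwa [Ideal.mem_comap, map_pow] at this
  · letI := Ideal.Quotient.field (maximalIdeal R)
    have e := ringKrullDim_eq_of_ringEquiv (MvPolynomial.quotientEquivQuotientMvPolynomial (σ := Fin d) (maximalIdeal R)).toRingEquiv
    rw [← e, MvPolynomial.ringKrullDim_of_isNoetherianRing, ringKrullDim_eq_zero_of_field]
    simp
end
end NHC

namespace NHC

theorem choose_le_pow' (n k : ℕ) : (n + k).choose k ≤ (n + 1) ^ k := by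
  induction k with
  | zero => simp
  | succ k ih =>
    have h := Nat.add_one_mul_choose_eq (n + k) k
    have h2 : (n + k).succ ≤ (n + 1) * (k + 1) := by
      have : 0 ≤ n * k := Nat.zero_le _
      rw [Nat.succ_eq_add_one]; nlinarith
    have h3 : (n + (k + 1)).choose (k + 1) * (k + 1) ≤ (n + 1) ^ (k + 1) * (k + 1) := by
      calc (n + (k + 1)).choose (k + 1) * (k + 1) = (n + k).succ * (n + k).choose k := h.symm
        _ ≤ ((n + 1) * (k + 1)) * (n + 1) ^ k := Nat.mul_le_mul h2 ih
        _ = _ := by ring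
    exact Nat.le_of_mul_le_mul_right h3 (Nat.succ_pos k)

theorem PB_bound (D : ℕ) (c : ℕ → ℤ) (L : ℕ → ℕ) (N0 : ℕ) (h : ∀ n ≥ N0, (L n : ℤ) = PB D c n) :
    ∃ C0 : ℕ, ∀ n, L n ≤ C0 * (n + 1) ^ D := by
  refine ⟨∑ i ∈ range (D + 1), (c i).natAbs + ∑ n ∈ range N0, L n, fun n => ?_⟩
  have h1 : 1 ≤ (n + 1) ^ D := Nat.one_le_pow _ _ (Nat.succ_pos n)
  rw [add_mul]
  by_cases hn : n < N0
  · have h2 : L n ≤ ∑ n ∈ range N0, L n := Finset.single_le_sum (f := L) (fun _ _ => Nat.zero_le _) (Finset.mem_range.mpr hn)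
    exact (h2.trans (Nat.le_mul_of_pos_right _ h1)).trans (Nat.le_add_left _ _)
  · refine le_trans ?_ (Nat.le_add_right _ _)
    rw [← Int.ofNat_le, h n (by omega), PB]
    push_cast
    rw [Finset.sum_mul]
    refine Finset.sum_le_sum fun i hi => ?_
    have hi' : i ≤ D := by simpa [Nat.lt_succ_iff] using hi
    refine mul_le_mul (le_abs_self _) ?_ (by positivity) (abs_nonneg _)
    have h3 := choose_le_pow' n (D - i)
    rw [show n + (D - i) = n + D - i by omega] at h3
    have h4 : (n + 1) ^ (D - i) ≤ (n + 1) ^ D := Nat.pow_le_pow_right (Nat.succ_pos n) (Nat.sub_le _ _)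
    exact_mod_cast h3.trans h4

section
variable {R : Type*} [CommRing R] [IsLocalRing R] [IsNoetherianRing R] {D : ℕ} {a : Fin (D + 1) → R} (hQ : QR a)

include hQ in
theorem main_FF (hJ : Ideal.span (Set.range a) ≤ maximalIdeal R) (i : Fin (D + 1)) (hD : 2 ≤ D)
    (hm : ∃ k, maximalIdeal R ^ k ≤ Ideal.span (Set.range a)) (hAU : AnalyticallyUnramified R)
    (L : ℕ → ℕ) (e : ℕ → ℤ) (hL : ∀ n, Module.length R (R ⧸ FF (Ideal.span (Set.range a)) (n + 1)) = L n)
    (N0 : ℕ) (hLe : ∀ n ≥ N0, (L n : ℤ) = PB (D + 1) (fun i => (-1) ^ i * e i) n)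
    (he1 : e 1 = e 0 - L 0 + 1) (he3 : e 3 = 0) :
    (∀ n, Ideal.span (Set.range a) ⊓ FF (Ideal.span (Set.range a)) (n + 1) ≤ Ideal.span (Set.range a) * FF (Ideal.span (Set.range a)) n) ∧
    ∀ k, FF (Ideal.span (Set.range a)) (k + 2) = Ideal.span (Set.range a) ^ k * FF (Ideal.span (Set.range a)) 2 := by
  obtain ⟨C0, hC0⟩ := PB_bound (D + 1) _ L N0 hLe
  have hC : ∀ n, Module.length R (R ⧸ FF (Ideal.span (Set.range a)) (n + 1)) ≤ ((C0 * (n + 1) ^ (D + 1) : ℕ) : ℕ∞) := by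
    intro n; rw [hL]; exact_mod_cast hC0 n
  obtain ⟨mn, b, N, hmn, hmb, hb0, hb2⟩ := mn_poly hQ hJ i hm hAU L e hL C0 hC N0 hLe he1 he3
  have hJ1 : Ideal.span (Set.range a) ≤ FF (Ideal.span (Set.range a)) 1 := by simpa using pow_le_FF (Ideal.span (Set.range a)) 1
  obtain ⟨w, hw, -, hmw, hF⟩ := redq hQ hJ i hm (FF (Ideal.span (Set.range a)) 1) hJ1 (fun n => FF (Ideal.span (Set.range a)) (n + 1))
    (fun n => (Ideal.mul_mono_right (pow_le_FF _ n)).trans ((FF_mul_le _ 1 n).trans (le_of_eq (by rw [Nat.add_comm 1 n]))))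
    (fun m n => (Ideal.mul_mono_left (pow_le_FF _ m)).trans (FF_mul_le _ m (n + 1)))
    mn b N hmn (fun n => by rw [hL]; exact ENat.coe_ne_top _) hmb hb0
    (by
      intro g hg z hz n
      have h1 : X * z ∈ AA (Ideal.span (Set.range a)) := by
        refine AA_cancel hQ hJ i hg _ ?_
        rw [AA_iff hQ hJ i]
        rintro (_ | n)
        · rw [FF_zero]; trivial
        · rw [mul_left_comm, coeff_X_mul]; exact hz n
      have := (AA_iff hQ hJ i _).mp h1 (n + 1)
      rwa [coeff_X_mul] at this)
    rfl hD hb2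
  have hred := redNum w hw hF
  exact ⟨M6 (M5 hQ hJ i hm C0 hC w hw hmw hF) hred, hred⟩
end

theorem rdepth_eq_dim {B : Type*} [CommRing B] (K MG : Ideal B) (hKM : K ≤ MG) (h1 : (1 : B) ∉ MG) {d : ℕ} (x : Fin d → B)
    (hx : ∀ j, x j ∈ MG) (hreg : RingTheory.Sequence.IsWeaklyRegular (B ⧸ K) (List.ofFn fun j => Ideal.Quotient.mk K (x j)))
    (hdim : ringKrullDim (B ⧸ K) ≤ d) :
    (rdepth (B ⧸ K) (MG.map (Ideal.Quotient.mk K)) (B ⧸ K) : WithBot ℕ∞) = ringKrullDim (B ⧸ K) := by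
  have hmem : ∀ y ∈ (List.ofFn fun j => Ideal.Quotient.mk K (x j)), y ∈ MG.map (Ideal.Quotient.mk K) := by
    intro y hy
    obtain ⟨j, rfl⟩ := List.mem_ofFn.mp hy
    exact Ideal.mem_map_of_mem _ (hx j)
  have hR : RingTheory.Sequence.IsRegular (B ⧸ K) (List.ofFn fun j => Ideal.Quotient.mk K (x j)) := by
    refine ⟨hreg, fun h => h1 ?_⟩
    have h2 : (⊤ : Ideal (B ⧸ K)) ≤ MG.map (Ideal.Quotient.mk K) := by
      rw [smul_eq_mul, Ideal.mul_top] at h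
      rw [h, Ideal.ofList, Ideal.span_le]
      exact fun y hy => hmem y hy
    have h3 : Ideal.Quotient.mk K 1 ∈ MG.map (Ideal.Quotient.mk K) := h2 Submodule.mem_top
    rw [Ideal.mem_quotient_iff_mem_sup, sup_eq_left.mpr hKM] at h3
    exact h3
  have hd1 : (d : WithBot ℕ∞) ≤ ringKrullDim (B ⧸ K) := by
    have := reg_le_dim _ hR
    rwa [List.length_ofFn] at this
  have hd : ringKrullDim (B ⧸ K) = d := le_antisymm hdim hd1
  rw [hd]
  have : rdepth (B ⧸ K) (MG.map (Ideal.Quotient.mk K)) (B ⧸ K) = d := by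
    apply le_antisymm
    · refine sSup_le ?_
      rintro n ⟨rs, rfl, -, h⟩
      have := reg_le_dim rs h
      rw [hd] at this
      exact_mod_cast this
    · refine le_sSup ⟨_, ?_, hmem, hR⟩
      rw [List.length_ofFn]
  rw [this]; rfl

theorem exists_reg_of_CM {R : Type*} [CommRing R] [IsLocalRing R] (d : ℕ) (hd : 1 ≤ d) (hdim : ringKrullDim R = d) (hCM : IsCMLocal R) :
    ∃ rs : List R, rs.length = d ∧ (∀ r ∈ rs, r ∈ maximalIdeal R) ∧ RingTheory.Sequence.IsRegular R rs := by
  unfold IsCMLocal at hCM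
  rw [hdim] at hCM
  have h : rdepth R (maximalIdeal R) R = (d : ℕ∞) := WithBot.coe_injective hCM
  have h1 : ((d - 1 : ℕ) : ℕ∞) < rdepth R (maximalIdeal R) R := by
    rw [h]; exact_mod_cast (by omega : d - 1 < d)
  obtain ⟨n, hn, hn2⟩ := lt_sSup_iff.mp h1
  have h3 : n ≤ (d : ℕ∞) := by rw [← h]; exact le_sSup hn
  obtain ⟨rs, rfl, hrs, hr⟩ := hn
  refine ⟨rs, ?_, hrs, hr⟩
  have h4 : d - 1 < rs.length := by exact_mod_cast hn2
  have h5 : rs.length ≤ d := by exact_mod_cast h3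
  omega
end NHC

open NHC

theorem CM_agr_of_e1_almost_extremal_e3_zero
    (R : Type*) [CommRing R] [IsLocalRing R] [IsNoetherianRing R]
    (d : ℕ) (hd : 3 ≤ d) (hdim : ringKrullDim R = d)
    (hCM : IsCMLocal R) (hAU : AnalyticallyUnramified R)
    (hres : Infinite (ResidueField R))
    (I J : Ideal R) (hI : IsMPrimary I) (hJ : IsMinimalReduction d J I)
    (L : ℕ → ℕ) (e : ℕ → ℤ) (hHilb : NormalHilbertData d I L e)
    (he1 : e 1 = e 0 - L 0 + 1) (he3 : e 3 = 0)
    -- the Rees algebra of the normal filtration and its associated graded ring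
    (A : Subalgebra R (Polynomial R))
    (hA : ∀ p : Polynomial R, p ∈ A ↔ ∀ n, p.coeff n ∈ intCl (I ^ n))
    (K : Ideal A)
    (hK : ∀ p : A, p ∈ K ↔ ∀ n, (p : Polynomial R).coeff n ∈ intCl (I ^ (n + 1)))
    (MG : Ideal A)
    (hMG : ∀ p : A, p ∈ MG ↔ (p : Polynomial R).coeff 0 ∈ maximalIdeal R) :
    -- `Ḡ` is Cohen-Macaulay and the normal filtration has reduction number at most 2
    ((rdepth (A ⧸ K) (MG.map (Ideal.Quotient.mk K)) (A ⧸ K) : WithBot ℕ∞) =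
      ringKrullDim (A ⧸ K)) ∧
    (∀ n, 1 ≤ n → intCl (I ^ (n + 1)) = J ^ (n - 1) * intCl (I ^ 2)) := by
  obtain ⟨hJI, ⟨a, rfl⟩, N, hN⟩ := hJ
  obtain ⟨D, rfl⟩ : ∃ D, d = D + 1 := ⟨d - 1, by omega⟩
  have hIm : I ≤ maximalIdeal R := by rw [← hI]; exact Ideal.le_radical
  have hJm := hJI.trans hIm
  have hm : ∃ k, maximalIdeal R ^ k ≤ Ideal.span (Set.range a) := by
    obtain ⟨k, hk⟩ := Ideal.exists_radical_pow_le_of_fg I (IsNoetherian.noetherian _)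
    rw [hI] at hk
    refine ⟨k * (N + 1), ?_⟩
    rw [pow_mul]
    refine (Ideal.pow_right_mono hk _).trans ?_
    rw [hN N le_rfl]
    exact Ideal.mul_le_left
  obtain ⟨rs, hrs, hrm, hrr⟩ := exists_reg_of_CM (D + 1) (by omega) hdim hCM
  have hofm : ∀ r ∈ List.ofFn a, r ∈ maximalIdeal R := by
    intro r hr
    obtain ⟨j, rfl⟩ := List.mem_ofFn.mp hr
    exact hJm (ai_mem a j)
  have hofl : Ideal.ofList (List.ofFn a) = Ideal.span (Set.range a) := by
    rw [Ideal.ofList]; congr 1; ext r; simp only [List.mem_ofFn, Set.mem_ofPred_eq, Set.mem_range]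
  have hofl2 : Ideal.ofList (List.ofFn a).reverse = Ideal.span (Set.range a) := by
    rw [← hofl, Ideal.ofList, Ideal.ofList]; congr 1; ext r; simp only [List.mem_reverse, Set.mem_ofPred_eq]
  obtain ⟨k, hk⟩ := hm
  have hreg : RingTheory.Sequence.IsRegular R (List.ofFn a) :=
    sop_regular _ R ⟨rs, by simpa using hrs, hrm, hrr⟩ hofm k (by rw [hofl]; exact hk.trans le_sup_left)
  have hreg2 : RingTheory.Sequence.IsRegular R (List.ofFn a).reverse :=
    sop_regular _ R ⟨rs, by simpa using hrs, hrm, hrr⟩ (fun r hr => hofm r (List.mem_reverse.mp hr)) k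
      (by rw [hofl2]; exact hk.trans le_sup_left)
  have hm : ∃ k, maximalIdeal R ^ k ≤ Ideal.span (Set.range a) := ⟨k, hk⟩
  have hQ : QR a := qr_of_reg _ a (regFn_of_list _ a hreg2.1)
  have i : Fin (D + 1) := 0
  have hcl : ∀ n, intCl (I ^ n) = FF (Ideal.span (Set.range a)) n := intCl_eq_FF hQ hJm i I hJI N hN
  obtain ⟨hL, N0, hLe⟩ := hHilb
  simp only [hcl] at hA hK
  have hL1 : ∀ n, Module.length R (R ⧸ FF (Ideal.span (Set.range a)) (n + 1)) = L n := by
    intro n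
    rw [← hcl]
    have := hL n
    unfold mlen at this
    rw [← Module.coe_length] at this
    exact WithBot.coe_injective this
  obtain ⟨hM6, hred⟩ := main_FF hQ hJm i (by omega) hm hAU L e hL1 N0 (by
    intro n hn
    rw [hLe n hn]; rfl) he1 he3
  refine ⟨?_, ?_⟩
  · have hanti := FF_anti hQ hJm i
    have hF1 : FF (Ideal.span (Set.range a)) 1 ≤ maximalIdeal R := by
      refine IsLocalRing.le_maximalIdeal fun h => ?_
      obtain ⟨l, hl⟩ := FF_chev hQ hJm i hAU 1
      have h1 : (1 : R) ∈ FF (Ideal.span (Set.range a)) 1 := by rw [h]; trivial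
      have h2 := pow_mem_FF h1 l
      rw [one_pow, one_mul] at h2
      have h3 := hl h2
      rw [pow_one] at h3
      exact (Ideal.ne_top_iff_one _).mp (IsLocalRing.maximalIdeal.isMaximal R).ne_top h3
    have hxA : ∀ j, monomial 1 (a j) ∈ A := by
      intro j
      rw [hA]
      intro n
      rw [coeff_monomial]
      split_ifs with h
      · rw [← h]; exact pow_le_FF _ 1 (by rw [pow_one]; exact ai_mem a j)
      · exact zero_mem _
    refine rdepth_eq_dim K MG ?_ ?_ (fun j => (⟨monomial 1 (a j), hxA j⟩ : A)) ?_ ?_ ?_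
    · intro p hp
      rw [hMG]
      exact hF1 ((hK p).mp hp 0)
    · rw [hMG]
      intro h
      rw [OneMemClass.coe_one, coeff_one_zero] at h
      exact (Ideal.ne_top_iff_one _).mp (IsLocalRing.maximalIdeal.isMaximal R).ne_top h
    · intro j
      rw [hMG]
      simp [coeff_monomial]
    · exact agr_reg a (FF (Ideal.span (Set.range a))) (FF_zero _)
        (fun m n => (Ideal.mul_mono_left (pow_le_FF _ m)).trans (FF_mul_le _ m n)) A hA K hK _ (fun l => rfl) hQ hM6 hanti hreg.1
    · refine dim_le_agr (a := a) A (fun p => (hA p).trans (AA_iff hQ hJm i p).symm) K ⟨k, fun r hr => ?_⟩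
      rw [hK]
      intro n
      change (C r).coeff n ∈ _
      rw [coeff_C]
      split_ifs with h
      · rw [h]; exact pow_le_FF _ 1 (by rw [pow_one]; exact hk hr)
      · exact zero_mem _
  · intro n hn
    obtain ⟨n, rfl⟩ : ∃ k, n = k + 1 := ⟨n - 1, by omega⟩
    rw [hcl, hcl, Nat.add_sub_cancel]
    exact hred n
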